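/- Generalized Cherednik–Macdonald identity for Σ of type B_n, case (i): let n ≥ 2, ω₊,ω₋ ∈ ℂ₊ with Im(ω₊ω₋) < 0, and k_s, k_l ∈ ℂ₋ ∩ ω₊ω₋ℂ₊. Then ∫_{ℝⁿ} ∏_{α∈R_s} G(⟨α,v⟩+iω)/G(⟨α,v⟩+i(k_s+ω)) · ∏_{β∈R_l} G(⟨β,v⟩+iω)/G(⟨β,v⟩+i(k_l+ω)) d′v converges absolutely and equals N_BC(ω₊,ω₋; γ = (k_s, −ω₊/2, −ω₋/2, −ω), κ = k_l). -/

import Mathlib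

open MeasureTheory Set
open scoped BigOperators Classical

noncomputable section

/-- Ruijsenaars' hyperbolic gamma function `G(ω₊,ω₋;z)`, defined by the integral
representation, valid on the strip `|Im z| < Re((ω₊+ω₋)/2)`. -/
def hypGammaInt (op om z : ℂ) : ℂ :=
  Complex.exp (Complex.I * ∫ y in Set.Ioi (0:ℝ),
    (1/(y:ℂ)) * (Complex.sin (2*(y:ℂ)*z) /
        (2 * Complex.sinh (op*(y:ℂ)) * Complex.sinh (om*(y:ℂ)))
      - z/(op*om*(y:ℂ))))

/-- The locus `-iω - Λ` (with `ω = (ω₊+ω₋)/2`, `Λ = ℤ≥0·iω₊ + ℤ≥0·iω₋`) containing the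
poles of the hyperbolic gamma function; off this set the meromorphic extension is defined. -/
def hypGammaPoles (op om : ℂ) : Set ℂ :=
  {z | ∃ m n : ℕ, z = -Complex.I*(op+om)/2 - (m:ℂ)*Complex.I*op - (n:ℂ)*Complex.I*om}

/-- Predicate expressing that `G : ℂ → ℂ` is the meromorphic extension in `z` of
Ruijsenaars' hyperbolic gamma function with quasi-periods `ω₊ = op`, `ω₋ = om`:
it agrees with the integral representation on the strip `|Im z| < Re((ω₊+ω₋)/2)`,
satisfies both functional equations (away from the zeros of the `cosh` factor, where
the two sides have poles), and is continuous away from the pole locus. -/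
structure IsHypGamma (op om : ℂ) (G : ℂ → ℂ) : Prop where
  strip : ∀ z : ℂ, |z.im| < ((op+om)/2).re → G z = hypGammaInt op om z
  funEqm : ∀ z : ℂ, Complex.cosh (Real.pi * z / op) ≠ 0 →
    G (z + Complex.I * om/2) = 2 * Complex.cosh (Real.pi * z / op) * G (z - Complex.I * om/2)
  funEqp : ∀ z : ℂ, Complex.cosh (Real.pi * z / om) ≠ 0 →
    G (z + Complex.I * op/2) = 2 * Complex.cosh (Real.pi * z / om) * G (z - Complex.I * op/2)
  cont : ContinuousOn G (hypGammaPoles op om)ᶜ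

/-- `∏_{α ∈ R_s} f(⟨α,v⟩)` where `R_s = {±ε_j}_{j=1}^n`. -/
def bcShort {n : ℕ} (f : ℝ → ℂ) (v : Fin n → ℝ) : ℂ :=
  ∏ j : Fin n, (f (v j) * f (-v j))

/-- `∏_{β ∈ R_l} f(⟨β,v⟩)` where `R_l = {±(ε_r ± ε_s)}_{1 ≤ r < s ≤ n}` (empty for `n = 1`). -/
def bcLong {n : ℕ} (f : ℝ → ℂ) (v : Fin n → ℝ) : ℂ :=
  ∏ p ∈ Finset.univ.filter (fun p : Fin n × Fin n => p.1 < p.2),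
    (f (v p.1 + v p.2) * f (-(v p.1 + v p.2)) * f (v p.1 - v p.2) * f (v p.2 - v p.1))

/-- The evaluation `N_BC` of the hyperbolic `BC_n` (Koornwinder-type) integral. -/
def NBC (G : ℂ → ℂ → ℂ → ℂ) (n : ℕ) (op om : ℂ) (γ : Fin 4 → ℂ) (κ : ℂ) : ℂ :=
  2^n * (Nat.factorial n : ℂ) * ((op*om) ^ ((1:ℂ)/2))^n *
    ∏ j ∈ Finset.range n,
      (G op om (Complex.I*((op+om)/2 + κ)) *
          G op om (Complex.I*((op+om)/2 + (2*(n:ℂ) - (j:ℂ) - 2)*κ + (γ 0 + γ 1 + γ 2 + γ 3)))) /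
        (G op om (Complex.I*((op+om)/2 + ((j:ℂ)+1)*κ)) *
          ∏ p ∈ Finset.univ.filter (fun p : Fin 4 × Fin 4 => p.1 < p.2),
            G op om (Complex.I*((op+om)/2 + (j:ℂ)*κ + γ p.1 + γ p.2)))

/-- Membership in the parameter space `𝒮_BC`. -/
def inSBC (op om : ℂ) (γ : Fin 4 → ℂ) (κ : ℂ) : Prop :=
  0 < op.re ∧ 0 < om.re ∧ (op*om).im < 0 ∧ (∀ r, (γ r).re < 0) ∧
    (∃ w : ℂ, 0 < w.re ∧ op + om + (γ 0 + γ 1 + γ 2 + γ 3) = op*om*w) ∧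
    κ.re < 0 ∧ ∃ w : ℂ, 0 < w.re ∧ κ = op*om*w

section

open Filter Topology

/-- A parameter integral of holomorphic functions with local integrable domination is
holomorphic. -/
theorem differentiableOn_integral_of_dominated {α : Type*} [MeasurableSpace α] {μ : Measure α}
    {U : Set ℂ} {F : ℂ → α → ℂ} (hU : IsOpen U)
    (hm : ∀ z ∈ U, AEStronglyMeasurable (F z) μ)
    (hd : ∀ᵐ a ∂μ, DifferentiableOn ℂ (fun z => F z a) U)
    (hb : ∀ z₀ ∈ U, ∃ g : α → ℝ, Integrable g μ ∧
      ∃ r > 0, ∀ᵐ a ∂μ, ∀ z ∈ Metric.ball z₀ r, z ∈ U → ‖F z a‖ ≤ g a) :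
    DifferentiableOn ℂ (fun z => ∫ a, F z a ∂μ) U := by
  intro z₀ hz₀
  obtain ⟨g, hg, r₁, hr₁, hb⟩ := hb z₀ hz₀
  obtain ⟨R, hR, hRU⟩ := Metric.isOpen_iff.1 hU z₀ hz₀
  have hr0 : 0 < min r₁ R := lt_min hr₁ hR
  generalize hrdef : min r₁ R = r at hr0
  have hsub : Metric.ball z₀ r ⊆ U :=
    (Metric.ball_subset_ball (hrdef ▸ min_le_right _ _)).trans hRU
  have hr : ∀ᵐ a ∂μ, ∀ z ∈ Metric.ball z₀ r, ‖F z a‖ ≤ g a := by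
    filter_upwards [hb] with a ha z hz
    exact ha z (Metric.ball_subset_ball (hrdef ▸ min_le_left _ _) hz) (hsub hz)
  have hda : ∀ᵐ a ∂μ, ∀ z ∈ Metric.ball z₀ r,
      HasDerivAt (fun z => F z a) (deriv (fun z => F z a) z) z := by
    filter_upwards [hd] with a ha z hz
    exact (ha.differentiableAt (hU.mem_nhds (hsub hz))).hasDerivAt
  have hmem : z₀ ∈ Metric.ball z₀ (r / 2) := Metric.mem_ball_self (by positivity)
  have hmem' : z₀ ∈ Metric.ball z₀ r := Metric.mem_ball_self (by positivity)
  have hbd : ∀ᵐ a ∂μ, ∀ z ∈ Metric.ball z₀ (r / 2),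
      ‖deriv (fun z => F z a) z‖ ≤ (4 / r) * g a := by
    filter_upwards [hd, hr] with a ha hga z hz
    have hcb : Metric.closedBall z (r / 4) ⊆ Metric.ball z₀ r := by
      intro w hw
      rw [Metric.mem_ball] at hz ⊢
      rw [Metric.mem_closedBall] at hw
      linarith [dist_triangle w z z₀]
    have := Complex.norm_deriv_le_of_forall_mem_sphere_norm_le (f := fun z => F z a) (c := z)
      (R := r / 4) (C := g a) (by positivity)
      (ha.mono (Metric.closure_ball_subset_closedBall.trans
        (hcb.trans hsub))).diffContOnCl
      (fun w hw => hga w (hcb (Metric.sphere_subset_closedBall hw)))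
    calc _ ≤ _ := this
      _ = _ := by field_simp
  have hmd : AEStronglyMeasurable (fun a => deriv (fun z => F z a) z₀) μ := by
    have hu : Filter.Tendsto (fun n : ℕ => ((r / 2 / ((n : ℝ) + 1) : ℝ) : ℂ)) Filter.atTop
        (nhdsWithin 0 {0}ᶜ) := by
      rw [tendsto_nhdsWithin_iff]
      constructor
      · have := (tendsto_one_div_add_atTop_nhds_zero_nat (𝕜 := ℝ)).const_mul (r / 2)
        rw [mul_zero] at this
        have h2 := (Complex.continuous_ofReal.tendsto 0).comp this
        refine h2.congr fun n => ?_
        simp only [Function.comp]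
        congr 1
        ring
      · refine Filter.Eventually.of_forall fun n => ?_
        simp only [mem_compl_iff, mem_singleton_iff, Complex.ofReal_eq_zero]
        positivity
    refine aestronglyMeasurable_of_tendsto_ae Filter.atTop
      (f := fun (n : ℕ) a => ((r / 2 / ((n : ℝ) + 1) : ℝ) : ℂ)⁻¹ •
        (F (z₀ + ((r / 2 / ((n : ℝ) + 1) : ℝ) : ℂ)) a - F z₀ a)) ?_ ?_
    · intro n
      have h1 : AEStronglyMeasurable
          (fun a => F (z₀ + ((r / 2 / ((n : ℝ) + 1) : ℝ) : ℂ)) a - F z₀ a) μ :=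
        (hm _ (hsub ?_)).sub (hm _ hz₀)
      · simp only [smul_eq_mul]
        exact h1.const_mul _
      rw [Metric.mem_ball, dist_eq_norm, add_sub_cancel_left, Complex.norm_real,
        Real.norm_of_nonneg (by positivity)]
      calc r / 2 / ((n : ℝ) + 1) ≤ r / 2 / 1 := by gcongr; linarith [n.cast_nonneg (α := ℝ)]
        _ < r := by linarith
    · filter_upwards [hda] with a ha
      exact (hasDerivAt_iff_tendsto_slope_zero.1 (ha z₀ hmem')).comp hu
  have hinv : Integrable (F z₀) μ := by
    refine hg.mono' (hm _ hz₀) ?_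
    filter_upwards [hr] with a ha using ha _ hmem'
  have key := hasDerivAt_integral_of_dominated_loc_of_deriv_le (μ := μ) (F := F)
    (F' := fun z a => deriv (fun z => F z a) z) (x₀ := z₀) (s := Metric.ball z₀ (r / 2))
    (bound := fun a => (4 / r) * g a) (Metric.ball_mem_nhds _ (by positivity))
    (by
      filter_upwards [hU.mem_nhds hz₀] with z hz using hm z hz)
    hinv hmd hbd (hg.const_mul _)
    (by
      filter_upwards [hda] with a ha z hz
      exact ha z (Metric.ball_subset_ball (by linarith) hz))
  exact key.2.differentiableAt.differentiableWithinAt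

/-- Product weight with a one-body factor and two-body factors of `v i + v j`, `v i - v j`. -/
def wt {n : ℕ} (h q r : ℝ → ℂ) (v : Fin n → ℝ) : ℂ :=
  (∏ j, h (v j)) * ∏ p ∈ Finset.univ.filter (fun p : Fin n × Fin n => p.1 < p.2),
    (q (v p.1 + v p.2) * r (v p.1 - v p.2))

theorem norm_wt_le {n : ℕ} {h q r : ℝ → ℂ} {C c : ℝ}
    (hh : ∀ x, ‖h x‖ ≤ C * Real.exp (-c * |x|)) (hq : ∀ x, ‖q x‖ ≤ C) (hr : ∀ x, ‖r x‖ ≤ C)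
    (v : Fin n → ℝ) :
    ‖wt h q r v‖ ≤ (C ^ n * (C * C) ^ (Finset.univ.filter
      (fun p : Fin n × Fin n => p.1 < p.2)).card) * ∏ j, Real.exp (-c * |v j|) := by
  have hC : 0 ≤ C := (norm_nonneg _).trans (hq 0)
  unfold wt
  rw [norm_mul, norm_prod, norm_prod, mul_right_comm]
  refine mul_le_mul ?_ ?_ (Finset.prod_nonneg fun _ _ => norm_nonneg _) (by positivity)
  · calc ∏ j, ‖h (v j)‖ ≤ ∏ j, (C * Real.exp (-c * |v j|)) :=
          Finset.prod_le_prod (fun _ _ => norm_nonneg _) fun j _ => hh _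
      _ = _ := by rw [Finset.prod_mul_distrib]; simp
  · rw [← Finset.prod_const]
    refine Finset.prod_le_prod (fun _ _ => norm_nonneg _) fun p _ => ?_
    rw [norm_mul]
    exact mul_le_mul (hq _) (hr _) (norm_nonneg _) hC

theorem continuous_wt {n : ℕ} {h q r : ℝ → ℂ} (hh : Continuous h) (hq : Continuous q)
    (hr : Continuous r) : Continuous (wt h q r : (Fin n → ℝ) → ℂ) := by
  unfold wt
  fun_prop

theorem measurable_wt {n : ℕ} {h q r : ℝ → ℂ} (hh : Measurable h) (hq : Measurable q)
    (hr : Measurable r) : Measurable (wt h q r : (Fin n → ℝ) → ℂ) := by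
  unfold wt
  fun_prop

theorem integrable_exp_neg_mul_abs {c : ℝ} (hc : 0 < c) :
    Integrable (fun x : ℝ => Real.exp (-c * |x|)) := by
  by_contra h
  have h1 := integral_comp_abs (f := fun x => Real.exp (-c * x))
  have h2 := integral_exp_mul_Ioi (a := -c) (by linarith) 0
  rw [integral_undef h, h2] at h1
  simp [hc.ne'] at h1

theorem integrable_prod_exp {n : ℕ} {c : ℝ} (hc : 0 < c) :
    Integrable (fun v : Fin n → ℝ => ∏ j, Real.exp (-c * |v j|)) :=
  Integrable.fintype_prod (f := fun _ x => Real.exp (-c * |x|))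
    (fun _ => integrable_exp_neg_mul_abs hc)

theorem integrable_wt {n : ℕ} {h q r : ℝ → ℂ} {C c : ℝ} (hc : 0 < c) (hh' : Continuous h)
    (hq' : Continuous q) (hr' : Continuous r)
    (hh : ∀ x, ‖h x‖ ≤ C * Real.exp (-c * |x|)) (hq : ∀ x, ‖q x‖ ≤ C) (hr : ∀ x, ‖r x‖ ≤ C) :
    Integrable (wt h q r : (Fin n → ℝ) → ℂ) :=
  ((integrable_prod_exp hc).const_mul _).mono' (continuous_wt hh' hq' hr').aestronglyMeasurable
    (Filter.Eventually.of_forall fun v => norm_wt_le hh hq hr v)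

theorem differentiableOn_integral_wt {n : ℕ} {U : Set ℂ} {h q r : ℂ → ℝ → ℂ} (hU : IsOpen U)
    (hh' : ∀ z ∈ U, Continuous (h z)) (hq' : ∀ z ∈ U, Continuous (q z))
    (hr' : ∀ z ∈ U, Continuous (r z))
    (hh : ∀ x, DifferentiableOn ℂ (fun z => h z x) U)
    (hq : ∀ x, DifferentiableOn ℂ (fun z => q z x) U)
    (hr : ∀ x, DifferentiableOn ℂ (fun z => r z x) U)
    (hb : ∀ z₀ ∈ U, ∃ C c : ℝ, 0 < c ∧ ∀ᶠ z in nhds z₀, ∀ x, ‖h z x‖ ≤ C * Real.exp (-c * |x|) ∧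
      ‖q z x‖ ≤ C ∧ ‖r z x‖ ≤ C) :
    DifferentiableOn ℂ (fun z => ∫ v : Fin n → ℝ, wt (h z) (q z) (r z) v) U := by
  refine differentiableOn_integral_of_dominated hU
    (fun z hz => (continuous_wt (hh' z hz) (hq' z hz) (hr' z hz)).aestronglyMeasurable)
    (Filter.Eventually.of_forall fun v => ?_) fun z₀ hz₀ => ?_
  · unfold wt
    refine DifferentiableOn.mul (DifferentiableOn.fun_finsetProd fun j _ => hh _)
      (DifferentiableOn.fun_finsetProd fun p _ => (hq _).mul (hr _))
  · obtain ⟨C, c, hc, hb⟩ := hb z₀ hz₀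
    obtain ⟨ρ, hρ, hb⟩ := Metric.eventually_nhds_iff_ball.1 hb
    exact ⟨_, (integrable_prod_exp hc).const_mul _, ρ, hρ,
      Filter.Eventually.of_forall fun v z hz _ => norm_wt_le (fun x => (hb z hz x).1)
        (fun x => (hb z hz x).2.1) (fun x => (hb z hz x).2.2) v⟩

theorem tendsto_integral_wt {n : ℕ} {ι : Type*} {l : Filter ι} [l.IsCountablyGenerated]
    {h q r : ι → ℝ → ℂ} {h₀ q₀ r₀ : ℝ → ℂ}
    (hc : ∀ᶠ t in l, Measurable (h t) ∧ Measurable (q t) ∧ Measurable (r t))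
    (hh : ∀ x, Filter.Tendsto (fun t => h t x) l (nhds (h₀ x)))
    (hq : ∀ x, Filter.Tendsto (fun t => q t x) l (nhds (q₀ x)))
    (hr : ∀ x, Filter.Tendsto (fun t => r t x) l (nhds (r₀ x)))
    (hb : ∃ C c : ℝ, 0 < c ∧ ∀ᶠ t in l, ∀ x, ‖h t x‖ ≤ C * Real.exp (-c * |x|) ∧
      ‖q t x‖ ≤ C ∧ ‖r t x‖ ≤ C) :
    Filter.Tendsto (fun t => ∫ v : Fin n → ℝ, wt (h t) (q t) (r t) v) l
      (nhds (∫ v : Fin n → ℝ, wt h₀ q₀ r₀ v)) := by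
  obtain ⟨C, c, hc0, hb⟩ := hb
  refine tendsto_integral_filter_of_dominated_convergence
    (fun v => (C ^ n * (C * C) ^ (Finset.univ.filter
      (fun p : Fin n × Fin n => p.1 < p.2)).card) * ∏ j, Real.exp (-c * |v j|)) ?_ ?_
    ((integrable_prod_exp hc0).const_mul _) (Filter.Eventually.of_forall fun v => ?_)
  · filter_upwards [hc] with t ht using
      (measurable_wt ht.1 ht.2.1 ht.2.2).aestronglyMeasurable
  · filter_upwards [hb] with t ht
    exact Filter.Eventually.of_forall fun v => norm_wt_le (fun x => (ht x).1)
      (fun x => (ht x).2.1) (fun x => (ht x).2.2) v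
  · unfold wt
    exact (tendsto_finsetProd _ fun j _ => hh _).mul
      (tendsto_finsetProd _ fun p _ => (hq _).mul (hr _))

section

open Filter Topology Asymptotics in
theorem bound_of_isBigO_of_tail {Λ : Type*} {l : Filter Λ} {f : Λ → ℝ → ℂ}
    (h0 : (fun x : Λ × ℝ => f x.1 x.2) =O[l ×ˢ 𝓝[>] (0 : ℝ)] (fun _ => (1 : ℝ)))
    (h1 : ∀ δ > 0, ∃ C : ℝ, ∀ᶠ t in l, ∀ y ≥ δ, ‖f t y‖ ≤ C / (1 + y ^ 2)) :
    ∃ C : ℝ, ∀ᶠ t in l, ∀ y > 0, ‖f t y‖ ≤ C / (1 + y ^ 2) := by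
  obtain ⟨C₀, hC₀⟩ := h0.bound
  obtain ⟨pa, hpa, pb, hpb, h⟩ := Filter.eventually_prod_iff.1 hC₀
  obtain ⟨δ, hδ, hδ'⟩ := (nhdsGT_basis (0 : ℝ)).eventually_iff.1 hpb
  obtain ⟨C₁, hC₁⟩ := h1 (min (δ / 2) 1) (by positivity)
  refine ⟨max (2 * C₀) C₁, ?_⟩
  filter_upwards [hpa, hC₁] with t ht ht' y hy
  rcases le_or_gt (min (δ / 2) 1) y with hy' | hy'
  · exact (ht' y hy').trans (by gcongr; exact le_max_right _ _)
  · have h2 := h ht (hδ' ⟨hy, hy'.trans_le ((min_le_left _ _).trans (by linarith))⟩)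
    rw [norm_one, mul_one] at h2
    have hy1 : y ≤ 1 := (hy'.trans_le (min_le_right _ _)).le
    rw [le_div_iff₀ (by positivity)]
    have hC : 0 ≤ C₀ := (norm_nonneg _).trans h2
    calc ‖f t y‖ * (1 + y ^ 2) ≤ C₀ * 2 := by
          refine mul_le_mul h2 ?_ (by positivity) hC
          nlinarith
      _ ≤ _ := by rw [mul_comm]; exact le_max_left _ _

/-- The function `sinh w / w`. -/
def shc (w : ℂ) : ℂ := Complex.sinh w / w

open Filter Topology Asymptotics in
theorem shc_sub_one_isBigO :
    (fun w : ℂ => shc w - 1) =O[𝓝[≠] (0 : ℂ)] (fun w => w ^ 2) := by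
  have h : ∀ w : ℂ, ‖w‖ ≤ 1 → ‖Complex.sinh w - w‖ ≤ ‖w‖ ^ 3 := by
    intro w hw
    have h1 := Complex.exp_bound (x := w) hw (n := 3) (by norm_num)
    have h2 := Complex.exp_bound (x := -w) (by simpa using hw) (n := 3) (by norm_num)
    rw [norm_neg] at h2
    have e : Complex.sinh w - w =
        ((Complex.exp w - ∑ m ∈ Finset.range 3, w ^ m / (m.factorial : ℂ)) -
        (Complex.exp (-w) - ∑ m ∈ Finset.range 3, (-w) ^ m / (m.factorial : ℂ))) / 2 := by
      simp [Finset.sum_range_succ, Complex.sinh]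
      ring
    rw [e, norm_div]
    have h3 := norm_sub_le (Complex.exp w - ∑ m ∈ Finset.range 3, w ^ m / (m.factorial : ℂ))
      (Complex.exp (-w) - ∑ m ∈ Finset.range 3, (-w) ^ m / (m.factorial : ℂ))
    norm_num [Nat.factorial] at h1 h2 h3 ⊢
    nlinarith [norm_nonneg w, pow_nonneg (norm_nonneg w) 3]
  refine IsBigO.of_bound 1 ?_
  have h1 : ∀ᶠ w in 𝓝[≠] (0 : ℂ), ‖w‖ ≤ 1 := by
    refine nhdsWithin_le_nhds ?_
    filter_upwards [Metric.closedBall_mem_nhds (0 : ℂ) one_pos] with w hw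
    simpa using hw
  filter_upwards [h1, self_mem_nhdsWithin] with w hw hw0
  have hw0 : w ≠ 0 := hw0
  have : shc w - 1 = (Complex.sinh w - w) / w := by unfold shc; field_simp
  rw [this, norm_div, div_le_iff₀ (norm_pos_iff.2 hw0), norm_pow, one_mul]
  calc _ ≤ _ := h w hw
    _ = _ := by ring

open Filter Topology Asymptotics in
theorem shc_mul_sub_one_isBigO {Λ : Type*} {l : Filter Λ} {a : Λ → ℂ} {a₀ : ℂ}
    (ha : Tendsto a l (𝓝 a₀)) :
    (fun x : Λ × ℝ => a x.1 * (shc (a x.1 * (x.2 : ℂ)) - 1)) =O[l ×ˢ 𝓝[>] (0 : ℝ)]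
      (fun x => (x.2 : ℝ) ^ 2) := by
  have h : (fun w : ℂ => (if w = 0 then 0 else shc w - 1)) =O[𝓝 (0 : ℂ)] (fun w => w ^ 2) := by
    obtain ⟨C, hC⟩ := shc_sub_one_isBigO.bound
    refine IsBigO.of_bound C ?_
    rw [eventually_nhdsWithin_iff] at hC
    filter_upwards [hC] with w hw
    split_ifs with h0
    · simp [h0]
    · exact hw h0
  have hy : Tendsto (fun x : Λ × ℝ => (x.2 : ℂ)) (l ×ˢ 𝓝[>] (0 : ℝ)) (𝓝 0) := by
    have := (Complex.continuous_ofReal.tendsto 0).comp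
      (tendsto_snd (f := l) (g := 𝓝[>] (0 : ℝ)) |>.mono_right nhdsWithin_le_nhds)
    exact this
  have hay := (ha.comp (tendsto_fst (f := l) (g := 𝓝[>] (0 : ℝ)))).mul hy
  rw [mul_zero] at hay
  have h2 := h.comp_tendsto hay
  have ha1 : (fun x : Λ × ℝ => a x.1) =O[l ×ˢ 𝓝[>] (0 : ℝ)] (fun _ => (1 : ℝ)) :=
    (ha.comp tendsto_fst).isBigO_one ℝ
  have h3 : (fun x : Λ × ℝ => (a x.1 * (x.2 : ℂ)) ^ 2) =O[l ×ˢ 𝓝[>] (0 : ℝ)]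
      (fun x => (x.2 : ℝ) ^ 2) := by
    have h4 : (fun x : Λ × ℝ => (x.2 : ℂ)) =O[l ×ˢ 𝓝[>] (0 : ℝ)] (fun x => (x.2 : ℝ)) :=
      IsBigO.of_bound 1 (Eventually.of_forall fun x => by simp)
    have := (ha1.mul h4).pow 2
    simpa using this
  have h5 := ha1.mul (h2.trans h3)
  simp only [one_mul] at h5
  refine h5.congr' ?_ EventuallyEq.rfl
  have hpos : ∀ᶠ x : Λ × ℝ in l ×ˢ 𝓝[>] (0 : ℝ), 0 < x.2 :=
    tendsto_snd.eventually self_mem_nhdsWithin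
  filter_upwards [hpos] with x hx
  simp only [Function.comp]
  split_ifs with h0
  · rcases mul_eq_zero.1 h0 with h0 | h0
    · simp [h0]
    · exact absurd (Complex.ofReal_eq_zero.1 h0) hx.ne'
  · rfl

theorem sinh_re_le_norm_sinh (w : ℂ) : Real.sinh w.re ≤ ‖Complex.sinh w‖ := by
  have h := norm_sub_norm_le (Complex.exp w) (Complex.exp (-w))
  rw [Complex.norm_exp, Complex.norm_exp, Complex.neg_re] at h
  rw [Real.sinh_eq, Complex.sinh, norm_div, Complex.norm_two]
  linarith

theorem norm_sinh_le (w : ℂ) : ‖Complex.sinh w‖ ≤ Real.exp |w.re| := by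
  rw [Complex.sinh, norm_div, Complex.norm_two]
  have h := norm_sub_le (Complex.exp w) (Complex.exp (-w))
  rw [Complex.norm_exp, Complex.norm_exp, Complex.neg_re] at h
  have h1 := Real.exp_le_exp.2 (le_abs_self w.re)
  have h2 := Real.exp_le_exp.2 (neg_le_abs w.re)
  linarith

theorem norm_sin_le (w : ℂ) : ‖Complex.sin w‖ ≤ Real.exp |w.im| := by
  have h := norm_sinh_le (w * Complex.I)
  rw [Complex.sinh_mul_I, norm_mul, Complex.norm_I, mul_one] at h
  simpa using h

theorem sinh_mul_ne_zero {p : ℂ} (hp : 0 < p.re) {y : ℝ} (hy : 0 < y) :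
    Complex.sinh (p * y) ≠ 0 := by
  have h : 0 < Real.sinh (p * y).re := by
    rw [Real.sinh_pos_iff]; simpa using mul_pos hp hy
  exact norm_pos_iff.1 (h.trans_le (sinh_re_le_norm_sinh _))

theorem exp_le_sinh {δ r : ℝ} (h : δ ≤ r) :
    (1 - Real.exp (-2 * δ)) / 2 * Real.exp r ≤ Real.sinh r := by
  rw [Real.sinh_eq]
  have : Real.exp (-r) ≤ Real.exp (-2 * δ) * Real.exp r := by
    rw [← Real.exp_add]
    exact Real.exp_le_exp.2 (by linarith)
  linarith

open Filter Topology Asymptotics in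
theorem exp_div_sinh_tail {Λ : Type*} {l : Filter Λ} {p q : Λ → ℂ} {p₀ q₀ : ℂ}
    (hp : Tendsto p l (𝓝 p₀)) (hq : Tendsto q l (𝓝 q₀)) (hp0 : 0 < p₀.re) (hq0 : 0 < q₀.re)
    {m : ℝ} (hm : 2 * m < p₀.re + q₀.re) {δ : ℝ} (hδ : 0 < δ) :
    ∃ C : ℝ, 0 ≤ C ∧ ∀ᶠ t in l, ∀ y ≥ δ, Real.exp (2 * m * y) /
      (‖Complex.sinh (p t * y)‖ * ‖Complex.sinh (q t * y)‖) ≤ C / (1 + y ^ 2) := by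
  obtain ⟨ε, hε, hε1, hε2, hε3⟩ : ∃ ε > 0, ε < p₀.re ∧ ε < q₀.re ∧
      2 * m < p₀.re + q₀.re - 3 * ε := by
    have h1 : 0 < min (min p₀.re q₀.re) ((p₀.re + q₀.re - 2 * m) / 3) := by
      refine lt_min (lt_min hp0 hq0) (by linarith)
    obtain ⟨ε, h2, h3⟩ := exists_between h1
    exact ⟨ε, h2, h3.trans_le ((min_le_left _ _).trans (min_le_left _ _)),
      h3.trans_le ((min_le_left _ _).trans (min_le_right _ _)),
      by have := h3.trans_le (min_le_right _ _); linarith⟩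
  have hpe : ∀ᶠ t in l, p₀.re - ε < (p t).re :=
    ((Complex.continuous_re.tendsto _).comp hp).eventually_const_lt (by linarith)
  have hqe : ∀ᶠ t in l, q₀.re - ε < (q t).re :=
    ((Complex.continuous_re.tendsto _).comp hq).eventually_const_lt (by linarith)
  set cp := (1 - Real.exp (-2 * ((p₀.re - ε) * δ))) / 2 with hcp
  set cq := (1 - Real.exp (-2 * ((q₀.re - ε) * δ))) / 2 with hcq
  have hcp0 : 0 < cp := by
    have : 0 < (p₀.re - ε) * δ := mul_pos (by linarith) hδ
    have : Real.exp (-2 * ((p₀.re - ε) * δ)) < 1 := Real.exp_lt_one_iff.2 (by linarith)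
    rw [hcp]; linarith
  have hcq0 : 0 < cq := by
    have : 0 < (q₀.re - ε) * δ := mul_pos (by linarith) hδ
    have : Real.exp (-2 * ((q₀.re - ε) * δ)) < 1 := Real.exp_lt_one_iff.2 (by linarith)
    rw [hcq]; linarith
  have hbd : ∀ (a : ℝ) (w : ℂ) (y : ℝ), a < w.re → 0 < a → δ ≤ y →
      (1 - Real.exp (-2 * (a * δ))) / 2 * Real.exp (a * y) ≤ ‖Complex.sinh (w * y)‖ := by
    intro a w y haw ha hy
    have hy0 : 0 < y := hδ.trans_le hy
    have h1 : a * y ≤ (w * y).re := by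
      simp; exact mul_le_mul_of_nonneg_right haw.le hy0.le
    calc _ ≤ Real.sinh (a * y) := exp_le_sinh (mul_le_mul_of_nonneg_left hy ha.le)
      _ ≤ Real.sinh (w * y).re := Real.sinh_le_sinh.2 h1
      _ ≤ _ := sinh_re_le_norm_sinh _
  obtain ⟨M, hM⟩ : ∃ M : ℝ, ∀ y : ℝ, 0 ≤ y → Real.exp (-ε * y) * (1 + y ^ 2) ≤ M := by
    refine ⟨1 + 2 / ε ^ 2, fun y hy => ?_⟩
    have h1 := Real.quadratic_le_exp_of_nonneg (x := ε * y) (by positivity)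
    have h2 : Real.exp (-ε * y) * Real.exp (ε * y) = 1 := by rw [← Real.exp_add]; simp
    have h3 : 1 + y ^ 2 ≤ (1 + 2 / ε ^ 2) * Real.exp (ε * y) := by
      have : (1 + 2 / ε ^ 2) * Real.exp (ε * y) ≥
        (1 + 2 / ε ^ 2) * (1 + ε * y + (ε * y) ^ 2 / 2) := by gcongr
      have e : (1 + 2 / ε ^ 2) * (1 + ε * y + (ε * y) ^ 2 / 2) = 1 + ε * y + (ε * y) ^ 2 / 2
        + 2 / ε ^ 2 + 2 / ε ^ 2 * (ε * y) + y ^ 2 := by field_simp; ring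
      have : 0 ≤ ε * y := by positivity
      have : 0 ≤ 2 / ε ^ 2 := by positivity
      have : 0 ≤ 2 / ε ^ 2 * (ε * y) := by positivity
      nlinarith
    calc Real.exp (-ε * y) * (1 + y ^ 2)
        ≤ Real.exp (-ε * y) * ((1 + 2 / ε ^ 2) * Real.exp (ε * y)) := by gcongr
      _ = (1 + 2 / ε ^ 2) * (Real.exp (-ε * y) * Real.exp (ε * y)) := by ring
      _ = _ := by rw [h2, mul_one]
  have hM0 : 0 ≤ M := by
    have := hM 0 le_rfl
    simp at this; linarith
  refine ⟨M / (cp * cq), by positivity, ?_⟩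
  filter_upwards [hpe, hqe] with t htp htq y hy
  have hy0 : 0 < y := hδ.trans_le hy
  have h1 := hbd _ _ y htp (by linarith) hy
  have h2 := hbd _ _ y htq (by linarith) hy
  rw [← hcp] at h1
  rw [← hcq] at h2
  calc _ ≤ Real.exp (2 * m * y) / ((cp * Real.exp ((p₀.re - ε) * y)) *
        (cq * Real.exp ((q₀.re - ε) * y))) := by gcongr
    _ = Real.exp ((2 * m - (p₀.re - ε) - (q₀.re - ε)) * y) / (cp * cq) := by
        rw [show (2 * m - (p₀.re - ε) - (q₀.re - ε)) * y =
          2 * m * y - (p₀.re - ε) * y - (q₀.re - ε) * y by ring, Real.exp_sub, Real.exp_sub]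
        field_simp
    _ ≤ Real.exp (-ε * y) / (cp * cq) := by
        gcongr; linarith
    _ ≤ M / (cp * cq) / (1 + y ^ 2) := by
        rw [div_div M, mul_comm (cp * cq), ← div_div M]
        refine div_le_div_of_nonneg_right ?_ (by positivity)
        rw [le_div_iff₀ (by positivity)]
        exact hM y hy0.le

end

section

/-- Regularised `sinh` kernel of the hyperbolic gamma function. -/
def kerS (e : ℝ → ℝ) (p q U : ℂ) (y : ℝ) : ℂ :=
  Complex.sinh (2 * U * y) / (2 * y * (Complex.sinh (p * y) * Complex.sinh (q * y))) -
    U / (p * q) * (e y / y ^ 2 : ℝ)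

/-- Regularised `sinh ^ 2` kernel. -/
def kerC (p q U : ℂ) (y : ℝ) : ℂ :=
  Complex.sinh (U * y) ^ 2 / (y * (Complex.sinh (p * y) * Complex.sinh (q * y))) -
    U ^ 2 / (p * q) * (Real.exp (-y) / y : ℝ)

theorem sinh_mul_eq_shc (U : ℂ) {y : ℝ} (hy : 0 < y) :
    Complex.sinh (U * y) = U * y * shc (U * y) := by
  have hy' : (y : ℂ) ≠ 0 := Complex.ofReal_ne_zero.2 hy.ne'
  by_cases hU : U = 0
  · simp [hU]
  · unfold shc; field_simp

section
open Filter Topology Asymptotics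

variable {Λ : Type*} {l : Filter Λ} {p q U : Λ → ℂ} {p₀ q₀ U₀ : ℂ}

theorem shc_sub_one_isBigO_of_ne_zero (hp : Tendsto p l (𝓝 p₀)) (hp0 : p₀ ≠ 0) :
    (fun x : Λ × ℝ => shc (p x.1 * (x.2 : ℂ)) - 1) =O[l ×ˢ 𝓝[>] (0 : ℝ)]
      (fun x => (x.2 : ℝ) ^ 2) := by
  have h1 : (fun x : Λ × ℝ => (p x.1)⁻¹) =O[l ×ˢ 𝓝[>] (0 : ℝ)] (fun _ => (1 : ℝ)) :=
    ((hp.inv₀ hp0).comp tendsto_fst).isBigO_one ℝ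
  have h2 := h1.mul (shc_mul_sub_one_isBigO hp)
  simp only [one_mul] at h2
  refine h2.congr' ?_ EventuallyEq.rfl
  have : ∀ᶠ x : Λ × ℝ in l ×ˢ 𝓝[>] (0 : ℝ), p x.1 ≠ 0 :=
    tendsto_fst.eventually (hp.eventually_ne hp0)
  filter_upwards [this] with x hx
  field_simp

theorem snd_tendsto_zero : Tendsto (fun x : Λ × ℝ => x.2) (l ×ˢ 𝓝[>] (0 : ℝ)) (𝓝 0) :=
  (tendsto_snd (f := l) (g := 𝓝[>] (0 : ℝ))).mono_right nhdsWithin_le_nhds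

theorem snd_pos : ∀ᶠ x : Λ × ℝ in l ×ˢ 𝓝[>] (0 : ℝ), 0 < x.2 :=
  tendsto_snd.eventually self_mem_nhdsWithin

theorem tendsto_shc (hp : Tendsto p l (𝓝 p₀)) (hp0 : p₀ ≠ 0) :
    Tendsto (fun x : Λ × ℝ => shc (p x.1 * (x.2 : ℂ))) (l ×ˢ 𝓝[>] (0 : ℝ)) (𝓝 1) := by
  have h := (shc_sub_one_isBigO_of_ne_zero hp hp0).trans_tendsto
    (by simpa using (snd_tendsto_zero (l := l)).pow 2)
  simpa using h.add_const 1

theorem sq_isBigO_self : (fun x : Λ × ℝ => (x.2 : ℝ) ^ 2) =O[l ×ˢ 𝓝[>] (0 : ℝ)]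
    (fun x => x.2) := by
  have h1 : (fun x : Λ × ℝ => x.2) =O[l ×ˢ 𝓝[>] (0 : ℝ)] (fun _ => (1 : ℝ)) :=
    snd_tendsto_zero.isBigO_one ℝ
  have := h1.mul (isBigO_refl (fun x : Λ × ℝ => x.2) (l ×ˢ 𝓝[>] (0 : ℝ)))
  simpa [sq] using this

theorem one_sub_mul_isBigO {ι : Type*} {l : Filter ι} {f g : ι → ℂ} {k : ι → ℝ}
    (hf : (fun x => f x - 1) =O[l] k)
    (hg : (fun x => g x - 1) =O[l] k) (hk : k =O[l] (fun _ => (1 : ℝ))) :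
    (fun x => f x * g x - 1) =O[l] k := by
  have h : (fun x => (f x - 1) * (g x - 1)) =O[l] k := by
    simpa using hf.mul (hg.trans hk)
  refine ((h.add hf).add hg).congr_left fun x => ?_
  ring

theorem ofReal_sub_one_isBigO {e : ℝ → ℝ} {k : ℝ → ℝ}
    (he : (fun y => e y - 1) =O[𝓝[>] (0 : ℝ)] k) :
    (fun x : Λ × ℝ => ((e x.2 : ℝ) : ℂ) - 1) =O[l ×ˢ 𝓝[>] (0 : ℝ)] (fun x => k x.2) := by
  have := he.comp_tendsto (tendsto_snd (f := l) (g := 𝓝[>] (0 : ℝ)))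
  refine IsBigO.trans (IsBigO.of_bound 1 (Eventually.of_forall fun x => ?_)) this
  rw [one_mul, ← Complex.ofReal_one, ← Complex.ofReal_sub, Complex.norm_real]
  rfl

theorem kerS_isBigO_one {e : ℝ → ℝ} (he : (fun y => e y - 1) =O[𝓝[>] (0 : ℝ)] (fun y => y ^ 2))
    (hp : Tendsto p l (𝓝 p₀)) (hq : Tendsto q l (𝓝 q₀)) (hU : Tendsto U l (𝓝 U₀))
    (hp0 : p₀ ≠ 0) (hq0 : q₀ ≠ 0) :
    (fun x : Λ × ℝ => kerS e (p x.1) (q x.1) (U x.1) x.2) =O[l ×ˢ 𝓝[>] (0 : ℝ)]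
      (fun _ => (1 : ℝ)) := by
  have hk : (fun x : Λ × ℝ => (x.2 : ℝ) ^ 2) =O[l ×ˢ 𝓝[>] (0 : ℝ)] (fun _ => (1 : ℝ)) :=
    (by simpa using (snd_tendsto_zero (l := l)).pow 2 : Tendsto _ _ (𝓝 (0 : ℝ))).isBigO_one ℝ
  have hP := shc_sub_one_isBigO_of_ne_zero hp hp0
  have hQ := shc_sub_one_isBigO_of_ne_zero hq hq0
  have hD := one_sub_mul_isBigO (ofReal_sub_one_isBigO (l := l) he)
    (one_sub_mul_isBigO hP hQ hk) hk
  have hU1 : (fun x : Λ × ℝ => U x.1) =O[l ×ˢ 𝓝[>] (0 : ℝ)] (fun _ => (1 : ℝ)) :=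
    (hU.comp tendsto_fst).isBigO_one ℝ
  have h2U := shc_mul_sub_one_isBigO (hU.const_mul 2)
  have hnum := (h2U.const_mul_left (1 / 2)).sub (by simpa using hU1.mul hD)
  have hden : (fun x : Λ × ℝ => (p x.1 * q x.1 * (shc (p x.1 * (x.2 : ℂ)) *
      shc (q x.1 * (x.2 : ℂ))))⁻¹) =O[l ×ˢ 𝓝[>] (0 : ℝ)] (fun _ => (1 : ℝ)) := by
    refine Tendsto.isBigO_one ℝ (c := (p₀ * q₀ * (1 * 1))⁻¹) (Tendsto.inv₀ ?_ (by simp [hp0, hq0]))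
    exact ((hp.comp tendsto_fst).mul (hq.comp tendsto_fst)).mul
      ((tendsto_shc hp hp0).mul (tendsto_shc hq hq0))
  have hinv : (fun x : Λ × ℝ => (((((x.2 : ℝ) ^ 2)⁻¹ : ℝ)) : ℂ)) =O[l ×ˢ 𝓝[>] (0 : ℝ)]
      (fun x => ((x.2 : ℝ) ^ 2)⁻¹) :=
    IsBigO.of_bound 1 (Eventually.of_forall fun x => by
      rw [Complex.norm_real, one_mul])
  have hall := (hden.mul hnum).mul hinv
  have hP1 := (tendsto_shc hp hp0).eventually_ne one_ne_zero
  have hQ1 := (tendsto_shc hq hq0).eventually_ne one_ne_zero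
  have hpne : ∀ᶠ x : Λ × ℝ in l ×ˢ 𝓝[>] (0 : ℝ), p x.1 ≠ 0 :=
    tendsto_fst.eventually (hp.eventually_ne hp0)
  have hqne : ∀ᶠ x : Λ × ℝ in l ×ˢ 𝓝[>] (0 : ℝ), q x.1 ≠ 0 :=
    tendsto_fst.eventually (hq.eventually_ne hq0)
  have hl : (fun x : Λ × ℝ => kerS e (p x.1) (q x.1) (U x.1) x.2) =O[l ×ˢ 𝓝[>] (0 : ℝ)]
      (fun x : Λ × ℝ => 1 * x.2 ^ 2 * (x.2 ^ 2)⁻¹) := by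
    refine IsBigO.trans (IsBigO.of_bound 1 ?_) hall
    filter_upwards [hP1, hQ1, snd_pos, hpne, hqne] with x h1 h2 h3 h4 h5
    rw [one_mul]
    refine le_of_eq ?_
    have hy' : (x.2 : ℂ) ≠ 0 := Complex.ofReal_ne_zero.2 h3.ne'
    congr 1
    unfold kerS
    rw [sinh_mul_eq_shc _ h3, sinh_mul_eq_shc _ h3, sinh_mul_eq_shc _ h3]
    generalize shc (p x.1 * x.2) = P at *
    generalize shc (q x.1 * x.2) = Q at *
    generalize shc (2 * U x.1 * x.2) = V at *
    push_cast
    field_simp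
    ring
  refine hl.trans (IsBigO.of_bound 1 ?_)
  filter_upwards [snd_pos] with x hx
  field_simp
  simp

theorem kerC_isBigO_one
    (hp : Tendsto p l (𝓝 p₀)) (hq : Tendsto q l (𝓝 q₀)) (hU : Tendsto U l (𝓝 U₀))
    (hp0 : p₀ ≠ 0) (hq0 : q₀ ≠ 0) :
    (fun x : Λ × ℝ => kerC (p x.1) (q x.1) (U x.1) x.2) =O[l ×ˢ 𝓝[>] (0 : ℝ)]
      (fun _ => (1 : ℝ)) := by
  have hk : (fun x : Λ × ℝ => (x.2 : ℝ)) =O[l ×ˢ 𝓝[>] (0 : ℝ)] (fun _ => (1 : ℝ)) :=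
    snd_tendsto_zero.isBigO_one ℝ
  have hP := (shc_sub_one_isBigO_of_ne_zero hp hp0).trans sq_isBigO_self
  have hQ := (shc_sub_one_isBigO_of_ne_zero hq hq0).trans sq_isBigO_self
  have he : (fun y : ℝ => Real.exp (-y) - 1) =O[𝓝[>] (0 : ℝ)] (fun y => y) := by
    have h : HasDerivAt (fun y : ℝ => Real.exp (-y)) (-1) 0 := by
      simpa using (hasDerivAt_neg (0 : ℝ)).exp
    have := h.isBigO_sub
    simp only [neg_zero, Real.exp_zero, sub_zero] at this
    exact this.mono nhdsWithin_le_nhds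
  have hD := one_sub_mul_isBigO (ofReal_sub_one_isBigO (l := l) he)
    (one_sub_mul_isBigO hP hQ hk) hk
  have hU1 : (fun x : Λ × ℝ => U x.1 ^ 2) =O[l ×ˢ 𝓝[>] (0 : ℝ)] (fun _ => (1 : ℝ)) :=
    ((hU.comp tendsto_fst).pow 2).isBigO_one ℝ
  have hUs := (shc_mul_sub_one_isBigO hU).trans sq_isBigO_self
  have hU2 : (fun x : Λ × ℝ => U x.1 * (shc (U x.1 * (x.2 : ℂ)) - 1) + 2 * U x.1)
      =O[l ×ˢ 𝓝[>] (0 : ℝ)] (fun _ => (1 : ℝ)) :=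
    (hUs.trans hk).add (((hU.comp tendsto_fst).const_mul 2).isBigO_one ℝ)
  have hnum : (fun x : Λ × ℝ => U x.1 * (shc (U x.1 * (x.2 : ℂ)) - 1) *
      (U x.1 * (shc (U x.1 * (x.2 : ℂ)) - 1) + 2 * U x.1) - U x.1 ^ 2 *
      ((Real.exp (-x.2) : ℝ) * (shc (p x.1 * (x.2 : ℂ)) * shc (q x.1 * (x.2 : ℂ))) - 1))
      =O[l ×ˢ 𝓝[>] (0 : ℝ)] (fun x => x.2) := by
    have h1 := hUs.mul hU2
    have h2 := hU1.mul hD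
    simp only [mul_one, one_mul] at h1 h2
    exact h1.sub h2
  have hden : (fun x : Λ × ℝ => (p x.1 * q x.1 * (shc (p x.1 * (x.2 : ℂ)) *
      shc (q x.1 * (x.2 : ℂ))))⁻¹) =O[l ×ˢ 𝓝[>] (0 : ℝ)] (fun _ => (1 : ℝ)) := by
    refine Tendsto.isBigO_one ℝ (c := (p₀ * q₀ * (1 * 1))⁻¹) (Tendsto.inv₀ ?_ (by simp [hp0, hq0]))
    exact ((hp.comp tendsto_fst).mul (hq.comp tendsto_fst)).mul
      ((tendsto_shc hp hp0).mul (tendsto_shc hq hq0))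
  have hinv : (fun x : Λ × ℝ => ((((x.2 : ℝ)⁻¹ : ℝ)) : ℂ)) =O[l ×ˢ 𝓝[>] (0 : ℝ)]
      (fun x => (x.2 : ℝ)⁻¹) :=
    IsBigO.of_bound 1 (Eventually.of_forall fun x => by
      rw [Complex.norm_real, one_mul])
  have hall := (hden.mul hnum).mul hinv
  have hP1 := (tendsto_shc hp hp0).eventually_ne one_ne_zero
  have hQ1 := (tendsto_shc hq hq0).eventually_ne one_ne_zero
  have hpne : ∀ᶠ x : Λ × ℝ in l ×ˢ 𝓝[>] (0 : ℝ), p x.1 ≠ 0 :=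
    tendsto_fst.eventually (hp.eventually_ne hp0)
  have hqne : ∀ᶠ x : Λ × ℝ in l ×ˢ 𝓝[>] (0 : ℝ), q x.1 ≠ 0 :=
    tendsto_fst.eventually (hq.eventually_ne hq0)
  have hl : (fun x : Λ × ℝ => kerC (p x.1) (q x.1) (U x.1) x.2) =O[l ×ˢ 𝓝[>] (0 : ℝ)]
      (fun x : Λ × ℝ => 1 * x.2 * (x.2)⁻¹) := by
    refine IsBigO.trans (IsBigO.of_bound 1 ?_) hall
    filter_upwards [hP1, hQ1, snd_pos, hpne, hqne] with x h1 h2 h3 h4 h5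
    rw [one_mul]
    refine le_of_eq ?_
    have hy' : (x.2 : ℂ) ≠ 0 := Complex.ofReal_ne_zero.2 h3.ne'
    congr 1
    unfold kerC
    rw [sinh_mul_eq_shc _ h3, sinh_mul_eq_shc _ h3, sinh_mul_eq_shc _ h3]
    generalize shc (p x.1 * x.2) = P at *
    generalize shc (q x.1 * x.2) = Q at *
    generalize shc (U x.1 * x.2) = V at *
    push_cast
    field_simp
    ring
  refine hl.trans (IsBigO.of_bound 1 ?_)
  filter_upwards [snd_pos] with x hx
  field_simp
  simp

theorem kerS_bound {e : ℝ → ℝ} (he : (fun y => e y - 1) =O[𝓝[>] (0 : ℝ)] (fun y => y ^ 2))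
    (he1 : ∀ y > 0, |e y| ≤ 1)
    (hp : Tendsto p l (𝓝 p₀)) (hq : Tendsto q l (𝓝 q₀)) (hU : Tendsto U l (𝓝 U₀))
    (hp0 : 0 < p₀.re) (hq0 : 0 < q₀.re) (hU0 : 2 * |U₀.re| < p₀.re + q₀.re) :
    ∃ C : ℝ, ∀ᶠ t in l, ∀ y > 0, ‖kerS e (p t) (q t) (U t) y‖ ≤ C / (1 + y ^ 2) := by
  have hp0' : p₀ ≠ 0 := fun h => by simp [h] at hp0
  have hq0' : q₀ ≠ 0 := fun h => by simp [h] at hq0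
  refine bound_of_isBigO_of_tail (kerS_isBigO_one he hp hq hU hp0' hq0') fun δ hδ => ?_
  obtain ⟨m, hm1, hm2⟩ := exists_between (show |U₀.re| < (p₀.re + q₀.re) / 2 by linarith)
  have hUm : ∀ᶠ t in l, |(U t).re| < m :=
    ((Complex.continuous_re.tendsto _).comp hU).abs.eventually_lt_const hm1
  obtain ⟨C, hC0, hC⟩ := exp_div_sinh_tail hp hq hp0 hq0 (m := m) (by linarith) hδ
  have hT : Tendsto (fun t => U t / (p t * q t)) l (𝓝 (U₀ / (p₀ * q₀))) :=
    Tendsto.div hU (hp.mul hq) (mul_ne_zero hp0' hq0')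
  obtain ⟨M, hM⟩ : ∃ M : ℝ, ∀ᶠ t in l, ‖U t / (p t * q t)‖ < M :=
    ⟨_, hT.norm.eventually_lt_const (lt_add_one _)⟩
  refine ⟨1 / (2 * δ) * C + M * (1 + 1 / δ ^ 2), ?_⟩
  filter_upwards [hUm, hC, hM] with t h1 h2 h3 y hy
  have hy0 : 0 < y := lt_of_lt_of_le hδ hy
  unfold kerS
  refine (norm_sub_le _ _).trans ?_
  rw [add_div]
  gcongr ?_ + ?_
  · calc _ = 1 / (2 * y) * (‖Complex.sinh (2 * U t * y)‖ /
          (‖Complex.sinh (p t * y)‖ * ‖Complex.sinh (q t * y)‖)) := by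
          rw [norm_div, norm_mul _ (_ * _), norm_mul, norm_mul]
          simp only [Complex.norm_two, Complex.norm_real, Real.norm_of_nonneg hy0.le]
          field_simp
      _ ≤ 1 / (2 * δ) * (Real.exp (2 * m * y) /
          (‖Complex.sinh (p t * y)‖ * ‖Complex.sinh (q t * y)‖)) := by
          gcongr
          refine (norm_sinh_le _).trans (Real.exp_le_exp.2 ?_)
          have : (2 * U t * (y : ℂ)).re = 2 * (U t).re * y := by simp
          rw [this, abs_mul, abs_mul, abs_two, abs_of_pos hy0]
          gcongr
      _ ≤ 1 / (2 * δ) * (C / (1 + y ^ 2)) := by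
          exact mul_le_mul_of_nonneg_left (h2 y hy) (by positivity)
      _ = _ := by ring
  · rw [norm_mul, Complex.norm_real, Real.norm_eq_abs, abs_div, abs_of_pos (pow_pos hy0 2)]
    have hM0 : 0 ≤ M := (norm_nonneg _).trans h3.le
    calc _ ≤ M * (1 / y ^ 2) := by
          gcongr
          exact he1 y hy0
      _ ≤ M * ((1 + 1 / δ ^ 2) / (1 + y ^ 2)) := by
          refine mul_le_mul_of_nonneg_left ?_ hM0
          rw [div_le_div_iff₀ (by positivity) (by positivity)]
          have : 1 ≤ 1 / δ ^ 2 * y ^ 2 := by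
            rw [one_div_mul_eq_div, one_le_div (by positivity)]
            gcongr
          nlinarith
      _ = _ := by ring

theorem kerC_bound
    (hp : Tendsto p l (𝓝 p₀)) (hq : Tendsto q l (𝓝 q₀)) (hU : Tendsto U l (𝓝 U₀))
    (hp0 : 0 < p₀.re) (hq0 : 0 < q₀.re) (hU0 : 2 * |U₀.re| < p₀.re + q₀.re) :
    ∃ C : ℝ, ∀ᶠ t in l, ∀ y > 0, ‖kerC (p t) (q t) (U t) y‖ ≤ C / (1 + y ^ 2) := by
  have hp0' : p₀ ≠ 0 := fun h => by simp [h] at hp0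
  have hq0' : q₀ ≠ 0 := fun h => by simp [h] at hq0
  refine bound_of_isBigO_of_tail (kerC_isBigO_one hp hq hU hp0' hq0') fun δ hδ => ?_
  obtain ⟨m, hm1, hm2⟩ := exists_between (show |U₀.re| < (p₀.re + q₀.re) / 2 by linarith)
  have hUm : ∀ᶠ t in l, |(U t).re| < m :=
    ((Complex.continuous_re.tendsto _).comp hU).abs.eventually_lt_const hm1
  obtain ⟨C, hC0, hC⟩ := exp_div_sinh_tail hp hq hp0 hq0 (m := m) (by linarith) hδ
  have hT : Tendsto (fun t => U t ^ 2 / (p t * q t)) l (𝓝 (U₀ ^ 2 / (p₀ * q₀))) :=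
    Tendsto.div (hU.pow 2) (hp.mul hq) (mul_ne_zero hp0' hq0')
  obtain ⟨M, hM⟩ : ∃ M : ℝ, ∀ᶠ t in l, ‖U t ^ 2 / (p t * q t)‖ < M :=
    ⟨_, hT.norm.eventually_lt_const (lt_add_one _)⟩
  refine ⟨1 / δ * C + M * (2 / δ), ?_⟩
  filter_upwards [hUm, hC, hM] with t h1 h2 h3 y hy
  have hy0 : 0 < y := lt_of_lt_of_le hδ hy
  unfold kerC
  refine (norm_sub_le _ _).trans ?_
  rw [add_div]
  gcongr ?_ + ?_
  · calc _ = 1 / y * (‖Complex.sinh (U t * y)‖ ^ 2 /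
          (‖Complex.sinh (p t * y)‖ * ‖Complex.sinh (q t * y)‖)) := by
          rw [norm_div, norm_mul _ (_ * _), norm_mul, norm_pow]
          simp only [Complex.norm_real, Real.norm_of_nonneg hy0.le]
          field_simp
      _ ≤ 1 / δ * (Real.exp (2 * m * y) /
          (‖Complex.sinh (p t * y)‖ * ‖Complex.sinh (q t * y)‖)) := by
          gcongr
          have h4 : ‖Complex.sinh (U t * y)‖ ≤ Real.exp (m * y) := by
            refine (norm_sinh_le _).trans (Real.exp_le_exp.2 ?_)
            have : (U t * (y : ℂ)).re = (U t).re * y := by simp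
            rw [this, abs_mul, abs_of_pos hy0]
            gcongr
          calc _ ≤ Real.exp (m * y) ^ 2 := by gcongr
            _ = _ := by rw [← Real.exp_nat_mul]; congr 1; push_cast; ring
      _ ≤ 1 / δ * (C / (1 + y ^ 2)) := by
          exact mul_le_mul_of_nonneg_left (h2 y hy) (by positivity)
      _ = _ := by ring
  · rw [norm_mul, Complex.norm_real, Real.norm_eq_abs,
      abs_of_pos (div_pos (Real.exp_pos _) hy0)]
    have hM0 : 0 ≤ M := (norm_nonneg _).trans h3.le
    have h5 : Real.exp (-y) ≤ 2 / (1 + y ^ 2) := by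
      have h6 := Real.quadratic_le_exp_of_nonneg hy0.le
      rw [Real.exp_neg, ← one_div, div_le_div_iff₀ (by positivity) (by positivity)]
      nlinarith
    calc _ ≤ M * (2 / (1 + y ^ 2) / δ) := by
          gcongr
      _ = _ := by ring

end

end

theorem integrableOn_exp_neg {a : ℝ} (ha : 0 < a) :
    IntegrableOn (fun y : ℝ => Real.exp (-a * y)) (Ioi 0) :=
  exp_neg_integrableOn_Ioi 0 ha

theorem integral_cos_sin_exp (x : ℝ) :
    (∫ y in Ioi (0 : ℝ), Real.cos (2 * x * y) * Real.exp (-y)) = 1 / (1 + 4 * x ^ 2) ∧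
    (∫ y in Ioi (0 : ℝ), Real.sin (2 * x * y) * Real.exp (-y)) = 2 * x / (1 + 4 * x ^ 2) := by
  set a : ℂ := -1 + 2 * x * Complex.I with ha
  have hare : a.re < 0 := by simp [ha]
  have hi : IntegrableOn (fun y : ℝ => Complex.exp (a * y)) (Ioi 0) :=
    integrableOn_exp_mul_complex_Ioi hare 0
  have hv := integral_exp_mul_complex_Ioi hare 0
  have hexp : ∀ y : ℝ, Complex.exp (a * y) =
      ((Real.cos (2 * x * y) * Real.exp (-y) : ℝ) : ℂ) +
      ((Real.sin (2 * x * y) * Real.exp (-y) : ℝ) : ℂ) * Complex.I := by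
    intro y
    rw [show a * y = ((-y : ℝ) : ℂ) + ((2 * x * y : ℝ) : ℂ) * Complex.I by
      rw [ha]; push_cast; ring, Complex.exp_add, Complex.exp_mul_I]
    push_cast
    ring
  have hval : -Complex.exp (a * (0 : ℝ)) / a =
      ((1 / (1 + 4 * x ^ 2) : ℝ) : ℂ) + ((2 * x / (1 + 4 * x ^ 2) : ℝ) : ℂ) * Complex.I := by
    have h1 : a ≠ 0 := fun h => by simp [h] at hare
    have h2 : (1 + 4 * x ^ 2 : ℂ) ≠ 0 := by
      have : (1 + 4 * x ^ 2 : ℝ) ≠ 0 := by positivity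
      exact_mod_cast this
    simp only [Complex.ofReal_zero, mul_zero, Complex.exp_zero]
    push_cast
    rw [div_eq_iff h1, ha]
    field_simp
    linear_combination (-(4 * x ^ 2 : ℂ)) * Complex.I_sq
  rw [hval] at hv
  have hre := congrArg Complex.re hv
  have him := congrArg Complex.im hv
  have e1 := integral_re hi
  have e2 := integral_im hi
  simp only [RCLike.re_eq_complex_re, RCLike.im_eq_complex_im] at e1 e2
  rw [← e1] at hre
  rw [← e2] at him
  simp only [hexp, Complex.add_re, Complex.add_im, Complex.ofReal_re, Complex.ofReal_im,
    Complex.re_ofReal_mul, Complex.im_ofReal_mul, Complex.I_re, Complex.I_im, mul_zero, mul_one,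
    add_zero, zero_add] at hre him
  exact ⟨hre, him⟩

theorem integrableOn_trig_exp {f : ℝ → ℝ} (hf : Continuous f) (h : ∀ y, |f y| ≤ 1) :
    IntegrableOn (fun y => f y * Real.exp (-y)) (Ioi 0) := by
  refine Integrable.mono' (integrableOn_exp_neg one_pos) (by fun_prop)
    (Filter.Eventually.of_forall fun y => ?_)
  rw [norm_mul, Real.norm_eq_abs, Real.norm_eq_abs, Real.abs_exp, neg_one_mul]
  exact mul_le_of_le_one_left (Real.exp_pos _).le (h y)

/-- The regularising cutoff `(1 + y) e^{-y}`. -/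
def cutoff (y : ℝ) : ℝ := (1 + y) * Real.exp (-y)

theorem cutoff_le_one {y : ℝ} : cutoff y ≤ 1 := by
  have := Real.add_one_le_exp y
  unfold cutoff
  rw [Real.exp_neg, ← div_eq_mul_inv, div_le_one (Real.exp_pos _)]
  linarith

theorem one_sub_cutoff_le {y : ℝ} (hy : 0 < y) : 1 - cutoff y ≤ y ^ 2 := by
  have := mul_le_mul_of_nonneg_left (Real.add_one_le_exp (-y)) (by linarith : 0 ≤ 1 + y)
  unfold cutoff
  nlinarith

theorem cutoff_pos {y : ℝ} (hy : 0 < y) : 0 < cutoff y :=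
  mul_pos (by linarith) (Real.exp_pos _)

theorem cutoff_le_exp {y : ℝ} : cutoff y ≤ 2 * Real.exp (-(1 / 2) * y) := by
  have h := Real.add_one_le_exp (y / 2)
  have h2 : Real.exp (-y) = Real.exp (-(1 / 2) * y) * Real.exp (-(y / 2)) := by
    rw [← Real.exp_add]; congr 1; ring
  have h3 : Real.exp (y / 2) * Real.exp (-(y / 2)) = 1 := by rw [← Real.exp_add]; simp
  unfold cutoff
  rw [h2]
  have h4 : (1 + y) * Real.exp (-(y / 2)) ≤ 2 := by
    have := Real.exp_pos (-(y / 2))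
    nlinarith
  have := Real.exp_pos (-(1 / 2) * y)
  nlinarith

theorem continuous_cutoff : Continuous cutoff := by unfold cutoff; fun_prop

theorem measurable_cutoff : Measurable cutoff := continuous_cutoff.measurable

theorem integrableOn_one_sub_cutoff :
    IntegrableOn (fun y => (1 - cutoff y) / y ^ 2) (Ioi 0) := by
  refine Integrable.mono' ((integrable_inv_one_add_sq.const_mul 2).integrableOn)
    ((measurable_const.sub measurable_cutoff).div (by fun_prop)).aestronglyMeasurable ?_
  refine (ae_restrict_iff' measurableSet_Ioi).2 (Filter.Eventually.of_forall fun y hy => ?_)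
  have hy : 0 < y := hy
  have h1 := @cutoff_le_one y
  have h2 := one_sub_cutoff_le hy
  have h3 := cutoff_pos hy
  rw [Real.norm_of_nonneg (div_nonneg (by linarith) (by positivity)), ← div_eq_mul_inv,
    div_le_div_iff₀ (by positivity) (by positivity)]
  nlinarith [sq_nonneg y, mul_le_mul_of_nonneg_right h2 (sq_nonneg y),
    mul_nonneg h3.le (sq_nonneg y)]

theorem abs_sin_div_le (x : ℝ) {y : ℝ} (hy : 0 < y) : |Real.sin (2 * x * y) / y| ≤ 2 * |x| := by
  have h := Real.abs_sin_le_abs (x := 2 * x * y)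
  rw [abs_div, abs_of_pos hy, div_le_iff₀ hy]
  refine h.trans (le_of_eq ?_)
  rw [abs_mul, abs_mul, abs_two, abs_of_pos hy]

theorem integrableOn_sin_div (x : ℝ) :
    IntegrableOn (fun y => Real.sin (2 * x * y) * (Real.exp (-y) / y)) (Ioi 0) := by
  refine Integrable.mono' ((integrableOn_exp_neg one_pos).const_mul (2 * |x|))
    (Measurable.aestronglyMeasurable (by fun_prop)) ?_
  refine (ae_restrict_iff' measurableSet_Ioi).2 (Filter.Eventually.of_forall fun y hy => ?_)
  have hy : 0 < y := hy
  rw [mul_div_left_comm, mul_comm, norm_mul, Real.norm_eq_abs, Real.norm_eq_abs, Real.abs_exp,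
    neg_one_mul]
  exact mul_le_mul_of_nonneg_right (abs_sin_div_le x hy) (Real.exp_pos _).le

theorem integral_sin_div (x : ℝ) :
    ∫ y in Ioi (0 : ℝ), Real.sin (2 * x * y) * (Real.exp (-y) / y) = Real.arctan (2 * x) := by
  have hd : ∀ x : ℝ, HasDerivAt (fun x : ℝ => ∫ y in Ioi (0 : ℝ),
      Real.sin (2 * x * y) * (Real.exp (-y) / y)) (2 * (1 / (1 + 4 * x ^ 2))) x := by
    intro x
    have := hasDerivAt_integral_of_dominated_loc_of_deriv_le (μ := volume.restrict (Ioi (0 : ℝ)))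
      (F := fun x y : ℝ => Real.sin (2 * x * y) * (Real.exp (-y) / y))
      (F' := fun x y : ℝ => 2 * (Real.cos (2 * x * y) * Real.exp (-y))) (x₀ := x) (s := univ)
      (bound := fun y => 2 * Real.exp (-1 * y)) Filter.univ_mem
      (Filter.Eventually.of_forall fun x => (integrableOn_sin_div x).aestronglyMeasurable)
      (integrableOn_sin_div x) (by fun_prop)
      (Filter.Eventually.of_forall fun y x _ => by
        rw [norm_mul, norm_mul, Real.norm_eq_abs, Real.norm_eq_abs, Real.norm_eq_abs,
          Real.abs_exp, abs_two, neg_one_mul]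
        gcongr
        exact mul_le_of_le_one_left (Real.exp_pos _).le (Real.abs_cos_le_one _))
      ((integrableOn_exp_neg one_pos).const_mul 2)
      ((ae_restrict_iff' measurableSet_Ioi).2 (Filter.Eventually.of_forall fun y hy x _ => by
        have hy : y ≠ 0 := ne_of_gt hy
        have h1 : HasDerivAt (fun x : ℝ => 2 * x * y) (2 * y) x := by
          simpa using ((hasDerivAt_id x).const_mul 2).mul_const y
        have h2 := (h1.sin).mul_const (Real.exp (-y) / y)
        exact h2.congr_deriv (by field_simp)))
    have h2 := this.2
    rwa [integral_const_mul, (integral_cos_sin_exp x).1] at h2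
  have hd2 : ∀ x : ℝ, HasDerivAt (fun x : ℝ => Real.arctan (2 * x)) (2 * (1 / (1 + 4 * x ^ 2))) x := by
    intro x
    have h1 : HasDerivAt (fun x : ℝ => 2 * x) 2 x := by
      simpa using (hasDerivAt_id x).const_mul 2
    exact h1.arctan.congr_deriv (by ring)
  have h := is_const_of_deriv_eq_zero (f := fun x => (∫ y in Ioi (0 : ℝ),
      Real.sin (2 * x * y) * (Real.exp (-y) / y)) - Real.arctan (2 * x))
    (fun x => ((hd x).sub (hd2 x)).differentiableAt)
    (fun x => (((hd x).sub (hd2 x)).congr_deriv (sub_self _)).deriv) x 0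
  simp only [mul_zero, zero_mul, Real.sin_zero, integral_zero, Real.arctan_zero, sub_zero] at h
  linarith

theorem integrableOn_one_sub_cos (x : ℝ) :
    IntegrableOn (fun y => (1 - Real.cos (2 * x * y)) * (cutoff y / y ^ 2)) (Ioi 0) := by
  refine Integrable.mono' ((integrableOn_exp_neg (a := 1 / 2) (by norm_num)).const_mul
    (2 * x ^ 2 * 2))
    ((by fun_prop : Measurable fun y : ℝ => 1 - Real.cos (2 * x * y)).mul
      (measurable_cutoff.div (by fun_prop))).aestronglyMeasurable ?_
  refine (ae_restrict_iff' measurableSet_Ioi).2 (Filter.Eventually.of_forall fun y hy => ?_)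
  have hy : 0 < y := hy
  have h1 := Real.one_sub_sq_div_two_le_cos (x := 2 * x * y)
  have h2 := Real.cos_le_one (2 * x * y)
  have h3 := cutoff_pos hy
  rw [Real.norm_of_nonneg (mul_nonneg (by linarith) (by positivity))]
  calc _ ≤ (2 * x * y) ^ 2 / 2 * (cutoff y / y ^ 2) := by gcongr; linarith
    _ = 2 * x ^ 2 * cutoff y := by field_simp
    _ ≤ 2 * x ^ 2 * (2 * Real.exp (-(1 / 2) * y)) := by gcongr; exact cutoff_le_exp
    _ = _ := by ring

theorem integral_one_sub_cos (x : ℝ) :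
    ∫ y in Ioi (0 : ℝ), (1 - Real.cos (2 * x * y)) * (cutoff y / y ^ 2) =
      2 * x * Real.arctan (2 * x) := by
  have hd : ∀ x : ℝ, HasDerivAt (fun x : ℝ => ∫ y in Ioi (0 : ℝ),
      (1 - Real.cos (2 * x * y)) * (cutoff y / y ^ 2))
      (2 * Real.arctan (2 * x) + 2 * (2 * x / (1 + 4 * x ^ 2))) x := by
    intro x
    have := hasDerivAt_integral_of_dominated_loc_of_deriv_le (μ := volume.restrict (Ioi (0 : ℝ)))
      (F := fun x y : ℝ => (1 - Real.cos (2 * x * y)) * (cutoff y / y ^ 2))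
      (F' := fun x y : ℝ => 2 * (Real.sin (2 * x * y) * (Real.exp (-y) / y)) +
        2 * (Real.sin (2 * x * y) * Real.exp (-y))) (x₀ := x) (s := Metric.ball x 1)
      (bound := fun y => 4 * (|x| + 1) * (2 * Real.exp (-(1 / 2) * y)))
      (Metric.ball_mem_nhds _ one_pos)
      (Filter.Eventually.of_forall fun x => (integrableOn_one_sub_cos x).aestronglyMeasurable)
      (integrableOn_one_sub_cos x) (Measurable.aestronglyMeasurable (by fun_prop))
      ((ae_restrict_iff' measurableSet_Ioi).2 (Filter.Eventually.of_forall fun y hy x' hx' => by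
        have hy : 0 < y := hy
        have h1 : 2 * (Real.sin (2 * x' * y) * (Real.exp (-y) / y)) +
            2 * (Real.sin (2 * x' * y) * Real.exp (-y)) =
            2 * (Real.sin (2 * x' * y) / y) * cutoff y := by
          unfold cutoff; field_simp
        rw [h1, norm_mul, norm_mul, Real.norm_eq_abs, Real.norm_eq_abs, Real.norm_eq_abs, abs_two,
          abs_of_pos (cutoff_pos hy)]
        have h2 := abs_sin_div_le x' hy
        have h3 : |x'| ≤ |x| + 1 := by
          rw [Metric.mem_ball, Real.dist_eq] at hx'
          have := abs_sub_abs_le_abs_sub x' x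
          linarith
        have h5 : 2 * |Real.sin (2 * x' * y) / y| ≤ 4 * (|x| + 1) := by linarith
        exact mul_le_mul h5 (cutoff_le_exp) (cutoff_pos hy).le (by positivity)))
      (((integrableOn_exp_neg (a := 1 / 2) (by norm_num)).const_mul 2).const_mul _)
      ((ae_restrict_iff' measurableSet_Ioi).2 (Filter.Eventually.of_forall fun y hy x _ => by
        have hy : y ≠ 0 := ne_of_gt hy
        have h1 : HasDerivAt (fun x : ℝ => 2 * x * y) (2 * y) x := by
          simpa using ((hasDerivAt_id x).const_mul 2).mul_const y
        have h2 := ((h1.cos).const_sub 1).mul_const (cutoff y / y ^ 2)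
        refine h2.congr_deriv ?_
        unfold cutoff
        field_simp))
    have h2 := this.2
    rw [integral_add ((integrableOn_sin_div x).const_mul 2)
      ((integrableOn_trig_exp (by fun_prop) (fun y => Real.abs_sin_le_one _)).const_mul 2),
      integral_const_mul, integral_const_mul,
      (integral_cos_sin_exp x).2, integral_sin_div] at h2
    exact h2
  have hd2 : ∀ x : ℝ, HasDerivAt (fun x : ℝ => 2 * x * Real.arctan (2 * x))
      (2 * Real.arctan (2 * x) + 2 * (2 * x / (1 + 4 * x ^ 2))) x := by
    intro x
    have h1 : HasDerivAt (fun x : ℝ => 2 * x) 2 x := by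
      simpa using (hasDerivAt_id x).const_mul 2
    exact (h1.mul h1.arctan).congr_deriv (by field_simp; ring)
  have h := is_const_of_deriv_eq_zero (f := fun x => (∫ y in Ioi (0 : ℝ),
      (1 - Real.cos (2 * x * y)) * (cutoff y / y ^ 2)) - 2 * x * Real.arctan (2 * x))
    (fun x => ((hd x).sub (hd2 x)).differentiableAt)
    (fun x => (((hd x).sub (hd2 x)).congr_deriv (sub_self _)).deriv) x 0
  simp only [mul_zero, zero_mul, Real.cos_zero, sub_self, integral_zero] at h
  linarith

theorem abs_pi_mul_abs_sub_arctan_le (x : ℝ) :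
    |Real.pi * |x| - 2 * x * Real.arctan (2 * x)| ≤ 1 := by
  wlog hx : 0 ≤ x generalizing x
  · have := this (-x) (by linarith)
    rwa [abs_neg, mul_neg, Real.arctan_neg, neg_mul_neg] at this
  rcases hx.eq_or_lt with rfl | hx
  · simp
  have h1 := Real.arctan_inv_of_pos (x := 2 * x) (by linarith)
  have h2 : Real.arctan (2 * x)⁻¹ ≤ (2 * x)⁻¹ := by
    have h3 := Real.lt_tan (x := Real.arctan (2 * x)⁻¹) ?_ (Real.arctan_lt_pi_div_two _)
    · rw [Real.tan_arctan] at h3; exact h3.le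
    · exact Real.arctan_pos.2 (by positivity)
  have h4 : 0 < Real.arctan (2 * x)⁻¹ := Real.arctan_pos.2 (by positivity)
  have h5 : Real.pi * |x| - 2 * x * Real.arctan (2 * x) = 2 * x * Real.arctan (2 * x)⁻¹ := by
    rw [h1, abs_of_pos hx]; ring
  rw [h5, abs_of_pos (by positivity)]
  calc 2 * x * Real.arctan (2 * x)⁻¹ ≤ 2 * x * (2 * x)⁻¹ := by gcongr
    _ = 1 := by field_simp

section

/-- Exponent of the hyperbolic gamma function on the strip. -/
def gammaExponent (p q U : ℂ) : ℂ := ∫ y in Ioi (0 : ℝ), kerS (fun _ => 1) p q U y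

theorem hypGammaInt_I_mul (p q U : ℂ) :
    hypGammaInt p q (Complex.I * U) = Complex.exp (-gammaExponent p q U) := by
  unfold hypGammaInt gammaExponent
  congr 1
  rw [← integral_const_mul, ← integral_neg]
  refine integral_congr_ae (Filter.Eventually.of_forall fun y => ?_)
  simp only
  have h : Complex.sin (2 * (y : ℂ) * (Complex.I * U)) =
      Complex.sinh (2 * U * y) * Complex.I := by
    rw [← Complex.sin_mul_I]; congr 1; ring
  rw [h]
  unfold kerS
  push_cast
  simp only [div_eq_mul_inv, mul_inv, one_mul]
  generalize (Complex.sinh (p * y))⁻¹ = P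
  generalize (Complex.sinh (q * y))⁻¹ = Q
  linear_combination ((y : ℂ)⁻¹ * (Complex.sinh (2 * U * y) * (2⁻¹ * P * Q) -
    U * (p⁻¹ * q⁻¹ * (y : ℂ)⁻¹))) * Complex.I_mul_I

theorem gammaExponent_neg (p q U : ℂ) : gammaExponent p q (-U) = -gammaExponent p q U := by
  unfold gammaExponent
  rw [← integral_neg]
  refine integral_congr_ae (Filter.Eventually.of_forall fun y => ?_)
  simp only [kerS, mul_neg, neg_mul, Complex.sinh_neg, neg_div]
  ring

section
open Filter Topology Asymptotics

theorem one_sub_one_isBigO :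
    (fun _ : ℝ => (1 : ℝ) - 1) =O[𝓝[>] (0 : ℝ)] (fun y : ℝ => y ^ 2) := by
  simpa using isBigO_zero (fun y : ℝ => y ^ 2) (𝓝[>] (0 : ℝ))

theorem cutoff_sub_one_isBigO :
    (fun y : ℝ => cutoff y - 1) =O[𝓝[>] (0 : ℝ)] (fun y : ℝ => y ^ 2) := by
  refine IsBigO.of_bound 1 ?_
  filter_upwards [self_mem_nhdsWithin] with y hy
  have hy : 0 < y := hy
  rw [Real.norm_of_nonpos (by linarith [@cutoff_le_one y]), Real.norm_of_nonneg (by positivity)]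
  linarith [one_sub_cutoff_le hy]

theorem abs_cutoff_le_one (y : ℝ) (hy : 0 < y) : |cutoff y| ≤ 1 := by
  rw [abs_of_pos (cutoff_pos hy)]; exact cutoff_le_one

theorem measurable_kerS {e : ℝ → ℝ} (he : Measurable e) (p q U : ℂ) :
    Measurable (kerS e p q U) := by
  unfold kerS
  have h : ∀ a : ℂ, Measurable fun y : ℝ => Complex.sinh (a * y) := fun a =>
    Complex.measurable_sinh.comp (by fun_prop)
  exact ((h _).div ((by fun_prop : Measurable fun y : ℝ => (2 * (y : ℂ))).mul
    ((h p).mul (h q)))).sub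
    ((Complex.measurable_ofReal.comp (he.div (by fun_prop))).const_mul _)

theorem measurable_kerC (p q U : ℂ) : Measurable (kerC p q U) := by
  unfold kerC
  have h : ∀ a : ℂ, Measurable fun y : ℝ => Complex.sinh (a * y) := fun a =>
    Complex.measurable_sinh.comp (by fun_prop)
  exact (((h _).pow_const 2).div (Complex.measurable_ofReal.mul
    ((h p).mul (h q)))).sub
    ((Complex.measurable_ofReal.comp
      (Measurable.div (by fun_prop) measurable_id)).const_mul _)

theorem integrableOn_div_one_add_sq (C : ℝ) :
    IntegrableOn (fun y : ℝ => C / (1 + y ^ 2)) (Ioi 0) := by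
  simpa only [div_eq_mul_inv] using (integrable_inv_one_add_sq.const_mul C).integrableOn

theorem integrableOn_of_bound {f : ℝ → ℂ} (hf : Measurable f) {C : ℝ}
    (h : ∀ y > 0, ‖f y‖ ≤ C / (1 + y ^ 2)) : IntegrableOn f (Ioi 0) :=
  Integrable.mono' (integrableOn_div_one_add_sq C) hf.aestronglyMeasurable
    ((ae_restrict_iff' measurableSet_Ioi).2 (Eventually.of_forall h))

theorem integrableOn_kerS_one {p q U : ℂ} (hp0 : 0 < p.re) (hq0 : 0 < q.re)
    (hU : 2 * |U.re| < p.re + q.re) : IntegrableOn (kerS (fun _ => 1) p q U) (Ioi 0) := by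
  obtain ⟨C, hC⟩ := kerS_bound (l := pure ()) (p := fun _ => p) (q := fun _ => q)
    (U := fun _ => U) one_sub_one_isBigO (fun _ _ => by simp) tendsto_const_nhds tendsto_const_nhds
    tendsto_const_nhds hp0 hq0 hU
  exact integrableOn_of_bound (measurable_kerS measurable_const _ _ _) (by simpa using hC)

variable {Λ : Type*} {l : Filter Λ} {p q U W : Λ → ℂ} {p₀ q₀ U₀ W₀ : ℂ}

theorem tendsto_gammaExponent [l.IsCountablyGenerated]
    (hp : Tendsto p l (𝓝 p₀)) (hq : Tendsto q l (𝓝 q₀)) (hU : Tendsto U l (𝓝 U₀))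
    (hp0 : 0 < p₀.re) (hq0 : 0 < q₀.re) (hU0 : 2 * |U₀.re| < p₀.re + q₀.re) :
    Tendsto (fun t => gammaExponent (p t) (q t) (U t)) l (𝓝 (gammaExponent p₀ q₀ U₀)) := by
  obtain ⟨C, hC⟩ := kerS_bound one_sub_one_isBigO (fun _ _ => by simp) hp hq hU hp0 hq0 hU0
  unfold gammaExponent
  refine tendsto_integral_filter_of_dominated_convergence (fun y => C / (1 + y ^ 2))
    (Eventually.of_forall fun t => (measurable_kerS measurable_const _ _ _).aestronglyMeasurable)
    ?_ (integrableOn_div_one_add_sq C) ?_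
  · filter_upwards [hC] with t ht
    exact (ae_restrict_iff' measurableSet_Ioi).2 (Eventually.of_forall ht)
  · refine (ae_restrict_iff' measurableSet_Ioi).2 (Eventually.of_forall fun y hy => ?_)
    have hy : 0 < y := hy
    have hy' : (y : ℂ) ≠ 0 := Complex.ofReal_ne_zero.2 hy.ne'
    have hs : ∀ {a : Λ → ℂ} {a₀ : ℂ}, Tendsto a l (𝓝 a₀) →
        Tendsto (fun t => Complex.sinh (a t * y)) l (𝓝 (Complex.sinh (a₀ * y))) := fun h =>
      (Complex.continuous_sinh.tendsto _).comp (h.mul_const _)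
    have hp0' : p₀ ≠ 0 := fun h => by simp [h] at hp0
    have hq0' : q₀ ≠ 0 := fun h => by simp [h] at hq0
    unfold kerS
    refine Tendsto.sub (Tendsto.div (hs (hU.const_mul 2)) (((hs hp).mul (hs hq)).const_mul _) ?_)
      (Tendsto.mul_const _ (Tendsto.div hU (hp.mul hq) (mul_ne_zero hp0' hq0')))
    exact mul_ne_zero (mul_ne_zero two_ne_zero hy')
      (mul_ne_zero (sinh_mul_ne_zero hp0 hy) (sinh_mul_ne_zero hq0 hy))

theorem differentiableOn_gammaExponent {p q : ℂ} (hp0 : 0 < p.re) (hq0 : 0 < q.re) :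
    DifferentiableOn ℂ (gammaExponent p q) {U | 2 * |U.re| < p.re + q.re} := by
  refine differentiableOn_integral_of_dominated
    (isOpen_lt (by fun_prop) continuous_const)
    (fun z _ => (measurable_kerS measurable_const _ _ _).aestronglyMeasurable)
    (Eventually.of_forall fun y => ?_) fun U₀ hU₀ => ?_
  · unfold kerS; fun_prop
  · obtain ⟨C, hC⟩ := kerS_bound (l := 𝓝 U₀) (p := fun _ => p) (q := fun _ => q)
      (U := fun U => U) one_sub_one_isBigO (fun _ _ => by simp) tendsto_const_nhds
      tendsto_const_nhds tendsto_id hp0 hq0 hU₀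
    obtain ⟨r, hr, h⟩ := Metric.eventually_nhds_iff_ball.1 hC
    exact ⟨fun y => C / (1 + y ^ 2), integrableOn_div_one_add_sq C, r, hr,
      (ae_restrict_iff' measurableSet_Ioi).2 (Eventually.of_forall fun y hy z hz _ => h z hz y hy)⟩

theorem kerS_add_kerS (p q U W : ℂ) (x : ℝ) {y : ℝ} (hy : 0 < y) :
    kerS (fun _ => 1) p q (U + x * Complex.I) y + kerS (fun _ => 1) p q (W - x * Complex.I) y =
      (Real.cos (2 * x * y) * (kerS cutoff p q U y + kerS cutoff p q W y) +
      Real.sin (2 * x * y) * Complex.I * (kerC p q U y - kerC p q W y)) -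
      (U + W) / (p * q) * ((((1 - cutoff y) / y ^ 2 : ℝ) : ℂ) +
        (((1 - Real.cos (2 * x * y)) * (cutoff y / y ^ 2) : ℝ) : ℂ)) +
      Complex.I * ((U ^ 2 - W ^ 2) / (p * q)) *
        ((Real.sin (2 * x * y) * (Real.exp (-y) / y) : ℝ) : ℂ) := by
  have h1 : Complex.sinh (2 * (U + x * Complex.I) * y) =
      Complex.sinh (2 * U * y) * Real.cos (2 * x * y) +
      (1 + 2 * Complex.sinh (U * y) ^ 2) * (Real.sin (2 * x * y) * Complex.I) := by
    rw [show 2 * (U + x * Complex.I) * y = 2 * U * y + (2 * x * y : ℝ) * Complex.I by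
      push_cast; ring, Complex.sinh_add, Complex.sinh_mul_I, Complex.cosh_mul_I,
      show 2 * U * y = 2 * (U * y) by ring, Complex.cosh_two_mul, Complex.cosh_sq]
    push_cast
    ring
  have h2 : Complex.sinh (2 * (W - x * Complex.I) * y) =
      Complex.sinh (2 * W * y) * Real.cos (2 * x * y) -
      (1 + 2 * Complex.sinh (W * y) ^ 2) * (Real.sin (2 * x * y) * Complex.I) := by
    rw [show 2 * (W - x * Complex.I) * y = 2 * W * y - (2 * x * y : ℝ) * Complex.I by
      push_cast; ring, Complex.sinh_sub, Complex.sinh_mul_I, Complex.cosh_mul_I,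
      show 2 * W * y = 2 * (W * y) by ring, Complex.cosh_two_mul, Complex.cosh_sq]
    push_cast
    ring
  have hy' : (y : ℂ) ≠ 0 := Complex.ofReal_ne_zero.2 hy.ne'
  unfold kerS kerC
  rw [h1, h2]
  push_cast
  simp only [div_eq_mul_inv, mul_inv]
  generalize (Complex.sinh (p * y))⁻¹ = P
  generalize (Complex.sinh (q * y))⁻¹ = Q
  field_simp
  ring

theorem gammaExponent_two_point (hp : Tendsto p l (𝓝 p₀)) (hq : Tendsto q l (𝓝 q₀))
    (hU : Tendsto U l (𝓝 U₀)) (hW : Tendsto W l (𝓝 W₀))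
    (hp0 : 0 < p₀.re) (hq0 : 0 < q₀.re) (hU0 : 2 * |U₀.re| < p₀.re + q₀.re)
    (hW0 : 2 * |W₀.re| < p₀.re + q₀.re) :
    ∃ C : ℝ, ∀ᶠ t in l, ∀ x : ℝ, ‖Complex.exp (-gammaExponent (p t) (q t) (U t + x * Complex.I)) *
      Complex.exp (-gammaExponent (p t) (q t) (W t - x * Complex.I))‖ ≤
      C * Real.exp (Real.pi * |x| * ((U t + W t) / (p t * q t)).re) := by
  have hp0' : p₀ ≠ 0 := fun h => by simp [h] at hp0
  have hq0' : q₀ ≠ 0 := fun h => by simp [h] at hq0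
  obtain ⟨C₁, hC₁⟩ := kerS_bound cutoff_sub_one_isBigO abs_cutoff_le_one hp hq hU hp0 hq0 hU0
  obtain ⟨C₂, hC₂⟩ := kerS_bound cutoff_sub_one_isBigO abs_cutoff_le_one hp hq hW hp0 hq0 hW0
  obtain ⟨C₃, hC₃⟩ := kerC_bound hp hq hU hp0 hq0 hU0
  obtain ⟨C₄, hC₄⟩ := kerC_bound hp hq hW hp0 hq0 hW0
  have hT1 : Tendsto (fun t => (U t + W t) / (p t * q t)) l (𝓝 ((U₀ + W₀) / (p₀ * q₀))) :=
    Tendsto.div (hU.add hW) (hp.mul hq) (mul_ne_zero hp0' hq0')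
  have hT2 : Tendsto (fun t => (U t ^ 2 - W t ^ 2) / (p t * q t)) l
      (𝓝 ((U₀ ^ 2 - W₀ ^ 2) / (p₀ * q₀))) :=
    Tendsto.div ((hU.pow 2).sub (hW.pow 2)) (hp.mul hq) (mul_ne_zero hp0' hq0')
  obtain ⟨M₁, hM₁⟩ : ∃ M : ℝ, ∀ᶠ t in l, ‖(U t + W t) / (p t * q t)‖ < M :=
    ⟨_, hT1.norm.eventually_lt_const (lt_add_one _)⟩
  obtain ⟨M₂, hM₂⟩ : ∃ M : ℝ, ∀ᶠ t in l, ‖(U t ^ 2 - W t ^ 2) / (p t * q t)‖ < M :=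
    ⟨_, hT2.norm.eventually_lt_const (lt_add_one _)⟩
  have hUs : ∀ᶠ t in l, 2 * |(U t).re| < (p t).re + (q t).re := by
    have h1 := (((Complex.continuous_re.tendsto _).comp hU).abs).const_mul 2
    have h2 := ((Complex.continuous_re.tendsto _).comp hp).add
      ((Complex.continuous_re.tendsto _).comp hq)
    exact h1.eventually_lt h2 hU0
  have hWs : ∀ᶠ t in l, 2 * |(W t).re| < (p t).re + (q t).re := by
    have h1 := (((Complex.continuous_re.tendsto _).comp hW).abs).const_mul 2
    have h2 := ((Complex.continuous_re.tendsto _).comp hp).add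
      ((Complex.continuous_re.tendsto _).comp hq)
    exact h1.eventually_lt h2 hW0
  have hps : ∀ᶠ t in l, 0 < (p t).re :=
    ((Complex.continuous_re.tendsto _).comp hp).eventually_const_lt hp0
  have hqs : ∀ᶠ t in l, 0 < (q t).re :=
    ((Complex.continuous_re.tendsto _).comp hq).eventually_const_lt hq0
  set c₀ := ∫ y in Ioi (0 : ℝ), (1 - cutoff y) / y ^ 2 with hc₀
  set c₁ := ∫ y in Ioi (0 : ℝ), (C₁ + C₂ + C₃ + C₄) / (1 + y ^ 2) with hc₁
  refine ⟨Real.exp (c₁ + M₁ * (|c₀| + 1) + M₂ * (Real.pi / 2)), ?_⟩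
  filter_upwards [hC₁, hC₂, hC₃, hC₄, hM₁, hM₂, hUs, hWs, hps, hqs] with t h1 h2 h3 h4 h5 h6 h7 h8
    h9 h10 x
  have e1 : ∀ y > (0 : ℝ), kerS (fun _ => 1) (p t) (q t) (U t + x * Complex.I) y +
      kerS (fun _ => 1) (p t) (q t) (W t - x * Complex.I) y = _ := fun y hy =>
    kerS_add_kerS (p t) (q t) (U t) (W t) x hy
  set c := (U t + W t) / (p t * q t) with hc
  set d := (U t ^ 2 - W t ^ 2) / (p t * q t) with hd
  set R : ℝ → ℂ := fun y => Real.cos (2 * x * y) *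
      (kerS cutoff (p t) (q t) (U t) y + kerS cutoff (p t) (q t) (W t) y) +
      Real.sin (2 * x * y) * Complex.I * (kerC (p t) (q t) (U t) y - kerC (p t) (q t) (W t) y)
    with hR
  have hRb : ∀ y > 0, ‖R y‖ ≤ (C₁ + C₂ + C₃ + C₄) / (1 + y ^ 2) := by
    intro y hy
    have k1 : ‖((Real.cos (2 * x * y) : ℝ) : ℂ)‖ ≤ 1 := by
      rw [Complex.norm_real]; exact Real.abs_cos_le_one _
    have k2 : ‖((Real.sin (2 * x * y) : ℝ) : ℂ) * Complex.I‖ ≤ 1 := by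
      rw [norm_mul, Complex.norm_real, Complex.norm_I, mul_one]; exact Real.abs_sin_le_one _
    calc ‖R y‖ ≤ _ := norm_add_le _ _
      _ ≤ 1 * (C₁ / (1 + y ^ 2) + C₂ / (1 + y ^ 2)) + 1 * (C₃ / (1 + y ^ 2) + C₄ / (1 + y ^ 2)) := by
        rw [norm_mul, norm_mul]
        refine add_le_add (mul_le_mul k1 ((norm_add_le _ _).trans (add_le_add (h1 y hy) (h2 y hy)))
          (norm_nonneg _) zero_le_one) (mul_le_mul k2 ((norm_sub_le _ _).trans
          (add_le_add (h3 y hy) (h4 y hy))) (norm_nonneg _) zero_le_one)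
      _ = _ := by ring
  have hRm : Measurable R := by
    have m1 : Measurable fun y : ℝ => ((Real.cos (2 * x * y) : ℝ) : ℂ) := by fun_prop
    have m2 : Measurable fun y : ℝ => ((Real.sin (2 * x * y) : ℝ) : ℂ) * Complex.I := by fun_prop
    exact (m1.mul ((measurable_kerS measurable_cutoff _ _ _).add
      (measurable_kerS measurable_cutoff _ _ _))).add
      (m2.mul ((measurable_kerC _ _ _).sub (measurable_kerC _ _ _)))
  have hRi : IntegrableOn R (Ioi 0) := integrableOn_of_bound hRm hRb
  have i1 : IntegrableOn (fun y => (((1 - cutoff y) / y ^ 2 : ℝ) : ℂ)) (Ioi 0) :=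
    integrableOn_one_sub_cutoff.ofReal
  have i2 : IntegrableOn
      (fun y => (((1 - Real.cos (2 * x * y)) * (cutoff y / y ^ 2) : ℝ) : ℂ)) (Ioi 0) :=
    (integrableOn_one_sub_cos x).ofReal
  have i3 : IntegrableOn
      (fun y => ((Real.sin (2 * x * y) * (Real.exp (-y) / y) : ℝ) : ℂ)) (Ioi 0) :=
    (integrableOn_sin_div x).ofReal
  have eJ : gammaExponent (p t) (q t) (U t + x * Complex.I) +
      gammaExponent (p t) (q t) (W t - x * Complex.I) =
      (∫ y in Ioi (0 : ℝ), R y) - c * ((c₀ : ℂ) + ((2 * x * Real.arctan (2 * x) : ℝ) : ℂ)) +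
      Complex.I * d * ((Real.arctan (2 * x) : ℝ) : ℂ) := by
    unfold gammaExponent
    have i12 : IntegrableOn (fun y => (((1 - cutoff y) / y ^ 2 : ℝ) : ℂ) +
        (((1 - Real.cos (2 * x * y)) * (cutoff y / y ^ 2) : ℝ) : ℂ)) (Ioi 0) := i1.add i2
    have iR : IntegrableOn (fun y => R y - c * ((((1 - cutoff y) / y ^ 2 : ℝ) : ℂ) +
        (((1 - Real.cos (2 * x * y)) * (cutoff y / y ^ 2) : ℝ) : ℂ))) (Ioi 0) :=
      hRi.sub (i12.const_mul c)
    rw [← integral_add (integrableOn_kerS_one h9 h10 (by simpa using h7))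
      (integrableOn_kerS_one h9 h10 (by simpa using h8))]
    calc _ = ∫ y in Ioi (0 : ℝ), ((R y - c * ((((1 - cutoff y) / y ^ 2 : ℝ) : ℂ) +
        (((1 - Real.cos (2 * x * y)) * (cutoff y / y ^ 2) : ℝ) : ℂ))) +
        Complex.I * d * ((Real.sin (2 * x * y) * (Real.exp (-y) / y) : ℝ) : ℂ)) :=
          setIntegral_congr_fun measurableSet_Ioi (fun y hy => e1 y hy)
      _ = _ := by
        rw [integral_add iR (i3.const_mul _), integral_sub hRi (i12.const_mul c),
          integral_const_mul, integral_const_mul, integral_add i1 i2, integral_complex_ofReal,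
          integral_complex_ofReal, integral_complex_ofReal, integral_one_sub_cos,
          integral_sin_div]
  rw [← Complex.exp_add, ← neg_add, eJ, Complex.norm_exp, ← Real.exp_add]
  refine Real.exp_le_exp.2 ?_
  have n1 : ‖∫ y in Ioi (0 : ℝ), R y‖ ≤ c₁ :=
    norm_integral_le_of_norm_le (integrableOn_div_one_add_sq _)
      ((ae_restrict_iff' measurableSet_Ioi).2 (Eventually.of_forall hRb))
  have n2 := (Complex.abs_re_le_norm (∫ y in Ioi (0 : ℝ), R y)).trans n1
  have n3 := (Complex.abs_re_le_norm c).trans h5.le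
  have n4 : |(Complex.I * d).re| ≤ M₂ := by
    refine (Complex.abs_re_le_norm _).trans ?_
    rw [norm_mul, Complex.norm_I, one_mul]; exact h6.le
  have n5 := abs_pi_mul_abs_sub_arctan_le x
  have n6 : |Real.arctan (2 * x)| ≤ Real.pi / 2 :=
    abs_le.2 ⟨(Real.neg_pi_div_two_lt_arctan _).le, (Real.arctan_lt_pi_div_two _).le⟩
  have e2 : (-((∫ y in Ioi (0 : ℝ), R y) -
      c * ((c₀ : ℂ) + ((2 * x * Real.arctan (2 * x) : ℝ) : ℂ)) +
      Complex.I * d * ((Real.arctan (2 * x) : ℝ) : ℂ))).re =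
      -(∫ y in Ioi (0 : ℝ), R y).re + c.re * (c₀ + 2 * x * Real.arctan (2 * x)) -
      (Complex.I * d).re * Real.arctan (2 * x) := by
    rw [← Complex.ofReal_add, Complex.neg_re, Complex.add_re, Complex.sub_re, Complex.re_mul_ofReal,
      Complex.re_mul_ofReal]
    ring
  rw [e2]
  have m1 : -(∫ y in Ioi (0 : ℝ), R y).re ≤ c₁ := (neg_le_abs _).trans n2
  have m2 : c.re * (c₀ - (Real.pi * |x| - 2 * x * Real.arctan (2 * x))) ≤ M₁ * (|c₀| + 1) := by
    refine (le_abs_self _).trans ?_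
    rw [abs_mul]
    exact mul_le_mul n3 ((abs_sub _ _).trans (by gcongr)) (abs_nonneg _)
      ((abs_nonneg _).trans n3)
  have m3 : -((Complex.I * d).re * Real.arctan (2 * x)) ≤ M₂ * (Real.pi / 2) := by
    refine (neg_le_abs _).trans ?_
    rw [abs_mul]
    exact mul_le_mul n4 n6 (abs_nonneg _) ((abs_nonneg _).trans n4)
  nlinarith [m1, m2, m3]

end

end

section

theorem gammaExponent_comm (p q U : ℂ) : gammaExponent p q U = gammaExponent q p U := by
  unfold gammaExponent
  refine integral_congr_ae (Filter.Eventually.of_forall fun y => ?_)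
  simp only [kerS, mul_comm (Complex.sinh (p * y)), mul_comm p q]

/-- `Γ u = G(i(u - ω))`, with the poles of the hyperbolic gamma function moved to `-ℕ p - ℕ q`. -/
structure ShiftedGamma (p q : ℂ) (Γ : ℂ → ℂ) : Prop where
  re_left : 0 < p.re
  re_right : 0 < q.re
  strip : ∀ u : ℂ, 0 < u.re → u.re < (p + q).re →
    Γ u = Complex.exp (-gammaExponent p q (u - (p + q) / 2))
  add_left' : ∀ u : ℂ, Complex.sin (Real.pi * u / q) ≠ 0 →
    Γ (u + p) = 2 * Complex.sin (Real.pi * u / q) * Γ u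
  add_right' : ∀ u : ℂ, Complex.sin (Real.pi * u / p) ≠ 0 →
    Γ (u + q) = 2 * Complex.sin (Real.pi * u / p) * Γ u
  cont : ∀ u : ℂ, 0 < u.re → ContinuousAt Γ u

theorem isClosed_hypGammaPoles {p q : ℂ} (hp : 0 < p.re) (hq : 0 < q.re) {u : ℂ} (hu : 0 < u.re) :
    (hypGammaPoles p q)ᶜ ∈ nhds (Complex.I * (u - (p + q) / 2)) := by
  have ho : IsOpen {z : ℂ | -((p + q) / 2).re < z.im} :=
    isOpen_lt continuous_const Complex.continuous_im
  refine Filter.mem_of_superset (ho.mem_nhds ?_) ?_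
  · simpa using hu
  · rintro z hz ⟨m, n, rfl⟩
    have h1 : 0 ≤ (m : ℝ) * p.re := by positivity
    have h2 : 0 ≤ (n : ℝ) * q.re := by positivity
    simp at hz
    linarith

theorem IsHypGamma.shiftedGamma {p q : ℂ} {G : ℂ → ℂ} (hG : IsHypGamma p q G) (hp : 0 < p.re)
    (hq : 0 < q.re) : ShiftedGamma p q (fun u => G (Complex.I * (u - (p + q) / 2))) := by
  have hp' : p ≠ 0 := fun h => by simp [h] at hp
  have hq' : q ≠ 0 := fun h => by simp [h] at hq
  refine ⟨hp, hq, fun u h1 h2 => ?_, fun u hu => ?_, fun u hu => ?_, fun u hu => ?_⟩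
  · rw [← hypGammaInt_I_mul, hG.strip]
    simp at h2 ⊢
    rw [abs_lt]; constructor <;> linarith
  · have e : Complex.cosh (Real.pi * (Complex.I * (u + p / 2 - (p + q) / 2)) / q) =
        Complex.sin (Real.pi * u / q) := by
      rw [← Complex.cos_sub_pi_div_two, ← Complex.cosh_mul_I]
      congr 1; field_simp; ring
    have := hG.funEqp (Complex.I * (u + p / 2 - (p + q) / 2)) (by rwa [e])
    rw [e] at this
    convert this using 2
    · ring
    · congr 1; ring
  · have e : Complex.cosh (Real.pi * (Complex.I * (u + q / 2 - (p + q) / 2)) / p) =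
        Complex.sin (Real.pi * u / p) := by
      rw [← Complex.cos_sub_pi_div_two, ← Complex.cosh_mul_I]
      congr 1; field_simp; ring
    have := hG.funEqm (Complex.I * (u + q / 2 - (p + q) / 2)) (by rwa [e])
    rw [e] at this
    convert this using 2
    · ring
    · congr 1; ring
  · exact ContinuousAt.comp (f := fun u => Complex.I * (u - (p + q) / 2))
      (hG.cont.continuousAt (isClosed_hypGammaPoles hp hq hu)) (by fun_prop)

namespace ShiftedGamma

variable {p q : ℂ} {Γ : ℂ → ℂ}

theorem symm (h : ShiftedGamma p q Γ) : ShiftedGamma q p Γ :=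
  ⟨h.re_right, h.re_left, fun u h1 h2 => by
    rw [gammaExponent_comm, add_comm q p]; exact h.strip u h1 (by rwa [add_comm p q]),
    h.add_right', h.add_left', h.cont⟩

theorem ne_left (h : ShiftedGamma p q Γ) : p ≠ 0 := fun h' => by
  have := h.re_left; simp [h'] at this

theorem ne_right (h : ShiftedGamma p q Γ) : q ≠ 0 := h.symm.ne_left

theorem eventually_sin_ne_zero {a : ℂ} (ha : a ≠ 0) (u : ℂ) :
    ∀ᶠ z in 𝓝[≠] u, Complex.sin (Real.pi * z / a) ≠ 0 := by
  have hπ : (Real.pi : ℂ) ≠ 0 := Complex.ofReal_ne_zero.2 Real.pi_ne_zero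
  by_cases h : Complex.sin (Real.pi * u / a) = 0
  · have hd : HasDerivAt (fun z : ℂ => Complex.sin (Real.pi * z / a))
        (Complex.cos (Real.pi * u / a) * (Real.pi / a)) u := by
      have h0 : HasDerivAt (fun z : ℂ => Real.pi * z / a) (Real.pi / a) u := by
        simpa using ((hasDerivAt_id u).const_mul (Real.pi : ℂ)).div_const a
      exact h0.csin
    refine hd.eventually_ne (mul_ne_zero (fun hc => ?_) (div_ne_zero hπ ha))
    have := Complex.sin_sq_add_cos_sq (Real.pi * u / a)
    simp [h, hc] at this
  · have : ContinuousAt (fun z : ℂ => Complex.sin (Real.pi * z / a)) u := by fun_prop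
    exact (this.eventually_ne h).filter_mono nhdsWithin_le_nhds

theorem add_left (h : ShiftedGamma p q Γ) {u : ℂ} (hu : 0 < u.re) :
    Γ (u + p) = 2 * Complex.sin (Real.pi * u / q) * Γ u := by
  have c1 : Tendsto (fun z => Γ (z + p)) (𝓝[≠] u) (𝓝 (Γ (u + p))) := by
    have : ContinuousAt (fun z => Γ (z + p)) u :=
      ContinuousAt.comp (f := fun z => z + p) (h.cont _ (by simp; linarith [h.re_left]))
        (by fun_prop)
    exact this.tendsto.mono_left nhdsWithin_le_nhds
  have c2 : Tendsto (fun z => 2 * Complex.sin (Real.pi * z / q) * Γ z) (𝓝[≠] u)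
      (𝓝 (2 * Complex.sin (Real.pi * u / q) * Γ u)) := by
    have : ContinuousAt (fun z => 2 * Complex.sin (Real.pi * z / q) * Γ z) u :=
      ContinuousAt.mul (by fun_prop) (h.cont u hu)
    exact this.tendsto.mono_left nhdsWithin_le_nhds
  refine tendsto_nhds_unique (c1.congr' ?_) c2
  filter_upwards [eventually_sin_ne_zero h.ne_right u] with z hz
  exact h.add_left' z hz

theorem add_right (h : ShiftedGamma p q Γ) {u : ℂ} (hu : 0 < u.re) :
    Γ (u + q) = 2 * Complex.sin (Real.pi * u / p) * Γ u := h.symm.add_left hu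

theorem eq_sub_right (h : ShiftedGamma p q Γ) {u : ℂ} (hu : q.re < u.re) :
    Γ u = 2 * Complex.sin (Real.pi * (u - q) / p) * Γ (u - q) := by
  have := h.add_right (u := u - q) (by simpa using hu)
  rwa [sub_add_cancel] at this

theorem induction_re {q : ℂ} (hq : 0 < q.re) (S : ℝ) (P : ℂ → Prop)
    (h0 : ∀ u : ℂ, 0 < u.re → u.re < S → P u)
    (h1 : ∀ u : ℂ, 0 < u.re → S ≤ u.re → q.re < u.re → P (u - q) → P u) (hS : q.re < S) (u : ℂ)
    (hu : 0 < u.re) : P u := by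
  have key : ∀ m : ℕ, ∀ u : ℂ, 0 < u.re → u.re < S + m * q.re → P u := by
    intro m
    induction m with
    | zero => intro u hu h; exact h0 u hu (by simpa using h)
    | succ m ih =>
      intro u hu h
      push_cast at h
      rcases lt_or_ge u.re S with h' | h'
      · exact h0 u hu h'
      · refine h1 u hu h' (hS.trans_le h') (ih _ ?_ ?_)
        · simp; linarith
        · simp; linarith
  obtain ⟨m, hm⟩ := exists_nat_gt (u.re / q.re)
  refine key m u hu ?_
  rw [div_lt_iff₀ hq] at hm
  linarith

theorem differentiableAt (h : ShiftedGamma p q Γ) {u : ℂ} (hu : 0 < u.re) :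
    DifferentiableAt ℂ Γ u := by
  have hre : ∀ a : ℝ, ∀ v : ℂ, a < v.re → ∀ᶠ z : ℂ in 𝓝 v, a < z.re := fun a v hv =>
    (isOpen_lt continuous_const Complex.continuous_re).mem_nhds hv
  refine induction_re h.re_right ((p + q).re) (fun u => DifferentiableAt ℂ Γ u)
    (fun u h1 h2 => ?_) (fun u h1 h2 h3 h4 => ?_) (by simpa using h.re_left) u hu
  · have hd : DifferentiableAt ℂ (gammaExponent p q) (u - (p + q) / 2) := by
      refine (differentiableOn_gammaExponent h.re_left h.re_right).differentiableAt
        (IsOpen.mem_nhds (isOpen_lt (by fun_prop) continuous_const) ?_)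
      simp only [Set.mem_ofPred_eq]
      simp at h2 ⊢
      have : |u.re - (p.re + q.re) / 2| < (p.re + q.re) / 2 := by
        rw [abs_lt]; constructor <;> linarith
      linarith
    have hd2 : DifferentiableAt ℂ (fun u => Complex.exp (-gammaExponent p q (u - (p + q) / 2))) u :=
      (DifferentiableAt.neg (DifferentiableAt.comp (f := fun u => u - (p + q) / 2) u hd
        (by fun_prop))).cexp
    refine hd2.congr_of_eventuallyEq ?_
    filter_upwards [hre 0 u h1, (isOpen_lt Complex.continuous_re
      continuous_const).mem_nhds h2] with z hz1 hz2
    exact h.strip z hz1 hz2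
  · have hd2 : DifferentiableAt ℂ (fun u => 2 * Complex.sin (Real.pi * (u - q) / p) * Γ (u - q)) u :=
      DifferentiableAt.mul (by fun_prop)
        (DifferentiableAt.comp (f := fun u => u - q) u h4 (by fun_prop))
    refine hd2.congr_of_eventuallyEq ?_
    filter_upwards [hre _ u h3] with z hz
    exact h.eq_sub_right hz

theorem mul_sub_self (h : ShiftedGamma p q Γ) {u : ℂ} (h1 : 0 < u.re) (h2 : u.re < (p + q).re) :
    Γ u * Γ (p + q - u) = 1 := by
  rw [h.strip u h1 h2, h.strip (p + q - u) (by simpa using h2) (by simpa using h1),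
    ← Complex.exp_add, show p + q - u - (p + q) / 2 = -(u - (p + q) / 2) by ring,
    gammaExponent_neg]
  simp

theorem re_div_pos {a : ℂ} (ha : 0 < a.re) : 0 < (1 / a).re := by
  rw [one_div, Complex.inv_re]
  exact div_pos ha (Complex.normSq_pos.2 fun h => by simp [h] at ha)

theorem mul_sub_self_of_forall_ne (h : ShiftedGamma p q Γ) {u : ℂ} (hu : 0 < u.re)
    (hne : ∀ m n : ℕ, u - p - q ≠ m * p + n * q) : Γ u * Γ (p + q - u) = 1 := by
  refine induction_re h.re_right ((p + q).re) (fun u => (∀ m n : ℕ, u - p - q ≠ m * p + n * q) →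
    Γ u * Γ (p + q - u) = 1)
    (fun u h1 h2 _ => h.mul_sub_self h1 h2) (fun u h1 h2 h3 ih hne => ?_)
    (by simpa using h.re_left) u hu hne
  have hs : Complex.sin (Real.pi * (p + q - u) / p) = Complex.sin (Real.pi * (u - q) / p) := by
    rw [← Complex.sin_pi_sub]
    congr 1
    have := h.ne_left
    field_simp; ring
  have hsne : Complex.sin (Real.pi * (p + q - u) / p) ≠ 0 := by
    rw [hs]
    intro h0
    obtain ⟨k, hk⟩ := Complex.sin_eq_zero_iff.1 h0
    have hπ : (Real.pi : ℂ) ≠ 0 := Complex.ofReal_ne_zero.2 Real.pi_ne_zero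
    have := h.ne_left
    have e : u - q = k * p := by
      field_simp at hk
      rw [hk, mul_comm]
    have e' := congrArg Complex.re e
    simp at e' h2
    have hk1 : 1 ≤ (k : ℝ) := by
      have := h.re_left
      by_contra! hlt
      nlinarith
    have hk1 : 1 ≤ k := by exact_mod_cast hk1
    obtain ⟨m, hm⟩ := Int.eq_ofNat_of_zero_le (sub_nonneg.2 hk1)
    refine hne m 0 ?_
    have hm' : (k : ℂ) = m + 1 := by
      have : k = m + 1 := by omega
      rw [this]; push_cast; ring
    rw [hm'] at e
    push_cast
    linear_combination e
  have e1 := h.add_right' _ hsne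
  have e2 := h.eq_sub_right h3
  have e3 := ih fun m n hmn => hne m (n + 1) (by push_cast; linear_combination hmn)
  rw [show p + q - (u - q) = p + q - u + q by ring, e1, hs] at e3
  rw [e2]
  linear_combination e3

theorem forall_ne_of_re_neg (h : ShiftedGamma p q Γ) {u : ℂ} (hu : ((u - p - q) / (p * q)).re < 0)
    (m n : ℕ) : u - p - q ≠ m * p + n * q := by
  intro e
  have hp := h.ne_left
  have hq := h.ne_right
  have : (u - p - q) / (p * q) = m * (1 / q) + n * (1 / p) := by
    rw [e]; field_simp
  rw [this] at hu
  have h1 := (re_div_pos h.re_left).le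
  have h2 := (re_div_pos h.re_right).le
  have h3 : 0 ≤ (m : ℝ) * (1 / q).re := by positivity
  have h4 : 0 ≤ (n : ℝ) * (1 / p).re := by positivity
  rw [Complex.add_re, ← Complex.ofReal_natCast, ← Complex.ofReal_natCast, Complex.re_ofReal_mul,
    Complex.re_ofReal_mul] at hu
  linarith

theorem ne_zero (h : ShiftedGamma p q Γ) {u : ℂ} (hu : 0 < u.re)
    (hu' : ((u - p - q) / (p * q)).re < 0) : Γ u ≠ 0 := fun h0 => by
  have := h.mul_sub_self_of_forall_ne hu (h.forall_ne_of_re_neg hu')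
  simp [h0] at this

theorem left_mul_eq (h : ShiftedGamma p q Γ) : p * Γ q = q * Γ p := by
  have hp := h.ne_left
  have hq := h.ne_right
  have hπ : (Real.pi : ℂ) ≠ 0 := Complex.ofReal_ne_zero.2 Real.pi_ne_zero
  have hsl : ∀ a : ℂ, Tendsto (fun x : ℝ => (x : ℂ)⁻¹ * Complex.sin (Real.pi * x / a)) (𝓝[>] 0)
      (𝓝 (Real.pi / a)) := by
    intro a
    have h0 : HasDerivAt (fun z : ℂ => Real.pi * z / a) (Real.pi / a) ((0 : ℝ) : ℂ) := by
      simpa using ((hasDerivAt_id ((0 : ℝ) : ℂ)).const_mul (Real.pi : ℂ)).div_const a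
    have h1 : HasDerivAt (fun x : ℝ => Complex.sin (Real.pi * x / a)) _ 0 := h0.csin.comp_ofReal
    have h2 := h1.hasDerivWithinAt (s := Ioi 0)
    rw [hasDerivWithinAt_iff_tendsto_slope' (by simp)] at h2
    simp only [Complex.ofReal_zero, mul_zero, zero_div, Complex.cos_zero, one_mul] at h2
    refine h2.congr fun x => ?_
    simp [slope_def_module]
  have hc : ∀ a : ℂ, 0 < a.re → Tendsto (fun x : ℝ => Γ (x + a)) (𝓝[>] 0) (𝓝 (Γ a)) := by
    intro a ha
    have : ContinuousAt (fun x : ℝ => Γ (x + a)) 0 :=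
      ContinuousAt.comp (f := fun x : ℝ => (x : ℂ) + a) (h.cont _ (by simpa using ha))
        (by fun_prop)
    have := this.tendsto
    simp only [Complex.ofReal_zero, zero_add] at this
    exact this.mono_left nhdsWithin_le_nhds
  have l1 := (hsl q).mul (hc q h.re_right)
  have l2 := (hsl p).mul (hc p h.re_left)
  have := tendsto_nhds_unique (l1.congr' ?_) l2
  · field_simp at this
    linear_combination this
  · filter_upwards [self_mem_nhdsWithin] with x hx
    have hx : 0 < ((x : ℂ)).re := by simpa using hx
    rw [h.add_left hx, h.add_right hx]
    ring

theorem sq_left_mul (h : ShiftedGamma p q Γ) : (p * Γ q) ^ 2 = p * q := by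
  have h1 := h.mul_sub_self (u := q) h.re_right (by simpa using h.re_left)
  rw [add_sub_cancel_right] at h1
  rw [sq]
  nth_rw 2 [h.left_mul_eq]
  linear_combination p * q * h1

theorem mul_mem_slitPlane {p q : ℂ} (hp : 0 < p.re) (hq : 0 < q.re) :
    p * q ∈ Complex.slitPlane := by
  rw [Complex.mem_slitPlane_iff]
  by_contra! hc
  obtain ⟨h1, h2⟩ := hc
  simp only [Complex.mul_re, Complex.mul_im] at h1 h2
  have h3 : p.re * q.re ≤ p.im * q.im := by linarith
  have h4 : p.im * q.re = -(p.re * q.im) := by linarith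
  have h5 : 0 < p.re * q.re := by positivity
  have h6 : p.im * q.im * q.re = -(p.re * q.im ^ 2) := by linear_combination q.im * h4
  nlinarith [mul_pos h5 hq, mul_nonneg hp.le (sq_nonneg q.im)]

theorem left_mul_eq_cpow {Γ : ℂ → ℂ → ℂ → ℂ}
    (hΓ : ∀ p q : ℂ, 0 < p.re → 0 < q.re → ShiftedGamma p q (Γ p q)) {p q : ℂ} (hp : 0 < p.re)
    (hq : 0 < q.re) : p * Γ p q q = (p * q) ^ ((1 : ℂ) / 2) := by
  set S : Set ℂ := {p | 0 < p.re} with hS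
  have hst : ∀ p ∈ S, p * Γ p q q = p * Complex.exp (-gammaExponent p q ((q - p) / 2)) := by
    intro p hp
    rw [(hΓ p q hp hq).strip q hq (by simpa using (show 0 < p.re from hp))]
    congr 4; ring
  rw [hst p hp]
  have hq' : q ≠ 0 := fun h => by simp [h] at hq
  refine IsPreconnected.eq_of_sq_eq (S := S)
    (f := fun p => p * Complex.exp (-gammaExponent p q ((q - p) / 2)))
    (g := fun p => (p * q) ^ ((1 : ℂ) / 2)) (convex_halfSpace_re_gt 0).isPreconnected
    (fun p hp => ContinuousAt.continuousWithinAt ?_) (fun p hp => ContinuousAt.continuousWithinAt ?_)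
    (fun p hp => ?_) (fun {p} hp => ?_) (y := q) hq ?_ hp
  · refine continuousAt_id.mul (Complex.continuous_exp.continuousAt.comp (f := fun p =>
      -gammaExponent p q ((q - p) / 2)) (ContinuousAt.neg ?_))
    have hcc : Continuous fun p : ℂ => (q - p) / 2 := by fun_prop
    refine tendsto_gammaExponent (p := fun p => p) (q := fun _ => q)
      (U := fun p => (q - p) / 2) tendsto_id tendsto_const_nhds (hcc.tendsto p) hp hq ?_
    have hp : 0 < p.re := hp
    simp
    have : |q.re - p.re| < p.re + q.re := by rw [abs_lt]; constructor <;> linarith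
    rw [abs_div]; norm_num; linarith
  · exact ContinuousAt.cpow (f := fun p : ℂ => p * q) (by fun_prop) continuousAt_const
      (mul_mem_slitPlane hp hq)
  · simp only [Pi.pow_apply]
    rw [← hst p hp, (hΓ p q hp hq).sq_left_mul, ← Complex.cpow_nat_mul]
    norm_num
  · have hp' : p ≠ 0 := fun h => by have hp : 0 < p.re := hp; simp [h] at hp
    rw [Complex.cpow_def_of_ne_zero (mul_ne_zero hp' hq')]
    exact Complex.exp_ne_zero _
  · have h0 : gammaExponent q q 0 = 0 := by
      have := gammaExponent_neg q q 0
      rw [neg_zero] at this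
      exact self_eq_neg.1 this
    simp only [sub_self, zero_div, h0, neg_zero, Complex.exp_zero, mul_one]
    rw [← sq, ← Complex.cpow_nat_mul']
    · norm_num
    · have := (abs_lt.1 (Complex.abs_arg_lt_pi_div_two_iff.2 (Or.inl hq))).1
      push_cast; linarith
    · have := (abs_lt.1 (Complex.abs_arg_lt_pi_div_two_iff.2 (Or.inl hq))).2
      push_cast; linarith

section
variable {Λ : Type*} {l : Filter Λ} {p q U W : Λ → ℂ} {Γ : Λ → ℂ → ℂ} {p₀ q₀ U₀ W₀ : ℂ}
  {Γ₀ : ℂ → ℂ}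

theorem eventually_re_lt (hU : Tendsto U l (𝓝 U₀)) {W : Λ → ℂ} (hW : Tendsto W l (𝓝 W₀))
    (h : U₀.re < W₀.re) : ∀ᶠ t in l, (U t).re < (W t).re :=
  ((Complex.continuous_re.tendsto _).comp hU).eventually_lt
    ((Complex.continuous_re.tendsto _).comp hW) h

theorem two_point_strip (hΓ : ∀ t, ShiftedGamma (p t) (q t) (Γ t)) (hp : Tendsto p l (𝓝 p₀))
    (hq : Tendsto q l (𝓝 q₀)) (hp0 : 0 < p₀.re) (hq0 : 0 < q₀.re) (hU : Tendsto U l (𝓝 U₀))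
    (hW : Tendsto W l (𝓝 W₀)) (hU0 : 0 < U₀.re) (hW0 : 0 < W₀.re) (hU1 : U₀.re < (p₀ + q₀).re)
    (hW1 : W₀.re < (p₀ + q₀).re) :
    ∃ C : ℝ, ∀ᶠ t in l, ∀ x : ℝ, ‖Γ t (U t + x * Complex.I) * Γ t (W t - x * Complex.I)‖ ≤
      C * Real.exp (Real.pi * |x| * ((U t + W t - p t - q t) / (p t * q t)).re) := by
  have habs : ∀ a b : ℝ, 0 < a → a < b → 2 * |a - b / 2| < b := fun a b h1 h2 => by
    have : |a - b / 2| < b / 2 := by rw [abs_lt]; constructor <;> linarith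
    linarith
  obtain ⟨C, hC⟩ := gammaExponent_two_point (U := fun t => U t - (p t + q t) / 2)
    (W := fun t => W t - (p t + q t) / 2) hp hq (hU.sub ((hp.add hq).div_const 2))
    (hW.sub ((hp.add hq).div_const 2)) hp0 hq0
    (by simp at hU1 ⊢; exact habs _ _ hU0 hU1) (by simp at hW1 ⊢; exact habs _ _ hW0 hW1)
  refine ⟨C, ?_⟩
  filter_upwards [hC, eventually_re_lt hU (hp.add hq) hU1, eventually_re_lt hW (hp.add hq) hW1,
    eventually_re_lt tendsto_const_nhds hU (by simpa using hU0 : (0 : ℂ).re < _),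
    eventually_re_lt tendsto_const_nhds hW (by simpa using hW0 : (0 : ℂ).re < _)] with t h1 h2 h3
    h4 h5 x
  rw [Complex.zero_re] at h4 h5
  rw [(hΓ t).strip _ (by simpa using h4) (by simpa using h2),
    (hΓ t).strip _ (by simpa using h5) (by simpa using h3)]
  convert h1 x using 2
  · congr 1 <;> congr 3 <;> ring
  · congr 4; ring

theorem two_point_bound_of_sub (hΓ : ∀ t, ShiftedGamma (p t) (q t) (Γ t))
    (hp : Tendsto p l (𝓝 p₀))
    (hq : Tendsto q l (𝓝 q₀)) (hp0 : 0 < p₀.re) (hU : Tendsto U l (𝓝 U₀))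
    (hU1 : q₀.re < U₀.re)
    (ih : ∃ C : ℝ, ∀ᶠ t in l, ∀ x : ℝ,
      ‖Γ t (U t - q t + x * Complex.I) * Γ t (W t - x * Complex.I)‖ ≤
      C * Real.exp (Real.pi * |x| * ((U t - q t + W t - p t - q t) / (p t * q t)).re)) :
    ∃ C : ℝ, ∀ᶠ t in l, ∀ x : ℝ, ‖Γ t (U t + x * Complex.I) * Γ t (W t - x * Complex.I)‖ ≤
      C * Real.exp (Real.pi * |x| * ((U t + W t - p t - q t) / (p t * q t)).re) := by
  obtain ⟨C, hC⟩ := ih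
  have hp0' : p₀ ≠ 0 := fun h => by simp [h] at hp0
  have hT : Tendsto (fun t => Real.pi * (U t - q t) / p t) l (𝓝 (Real.pi * (U₀ - q₀) / p₀)) :=
    Tendsto.div ((hU.sub hq).const_mul _) hp hp0'
  obtain ⟨M, hM⟩ : ∃ M : ℝ, ∀ᶠ t in l, ‖Real.pi * (U t - q t) / p t‖ < M :=
    ⟨_, hT.norm.eventually_lt_const (lt_add_one _)⟩
  refine ⟨2 * Real.exp M * C, ?_⟩
  filter_upwards [hC, hM, eventually_re_lt hq hU hU1] with t h1 h2 h3 x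
  have hpt := (hΓ t).ne_left
  have hqt := (hΓ t).ne_right
  rw [(hΓ t).eq_sub_right (by simpa using h3),
    show U t + x * Complex.I - q t = U t - q t + x * Complex.I by ring, mul_assoc, norm_mul]
  have hs : ‖2 * Complex.sin (Real.pi * (U t - q t + x * Complex.I) / p t)‖ ≤
      2 * Real.exp M * Real.exp (Real.pi * |x| * (1 / p t).re) := by
    rw [norm_mul, mul_assoc, ← Real.exp_add]
    refine mul_le_mul (by simp) ((norm_sin_le _).trans (Real.exp_le_exp.2 ?_)) (norm_nonneg _)
      zero_le_two
    have e : (Real.pi * (U t - q t + x * Complex.I) / p t) =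
        Real.pi * (U t - q t) / p t + (Real.pi * x : ℝ) * (Complex.I * (1 / p t)) := by
      push_cast; ring
    rw [e, Complex.add_im, Complex.im_ofReal_mul]
    refine (abs_add_le _ _).trans (add_le_add ((Complex.abs_im_le_norm _).trans h2.le) ?_)
    have : (Complex.I * (1 / p t)).im = (1 / p t).re := by simp
    rw [this, abs_mul, abs_mul, abs_of_pos Real.pi_pos, abs_of_pos (re_div_pos (hΓ t).re_left)]
  refine (mul_le_mul hs (h1 x) (norm_nonneg _) (by positivity)).trans (le_of_eq ?_)
  have e : ((U t + W t - p t - q t) / (p t * q t)) =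
      (1 / p t) + ((U t - q t + W t - p t - q t) / (p t * q t)) := by field_simp; ring
  rw [e, Complex.add_re, mul_add, Real.exp_add]
  ring

theorem two_point_swap
    (ih : ∃ C : ℝ, ∀ᶠ t in l, ∀ x : ℝ,
      ‖Γ t (W t + x * Complex.I) * Γ t (U t - x * Complex.I)‖ ≤
      C * Real.exp (Real.pi * |x| * ((W t + U t - p t - q t) / (p t * q t)).re)) :
    ∃ C : ℝ, ∀ᶠ t in l, ∀ x : ℝ, ‖Γ t (U t + x * Complex.I) * Γ t (W t - x * Complex.I)‖ ≤
      C * Real.exp (Real.pi * |x| * ((U t + W t - p t - q t) / (p t * q t)).re) := by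
  obtain ⟨C, hC⟩ := ih
  refine ⟨C, hC.mono fun t ht x => ?_⟩
  have := ht (-x)
  rw [abs_neg, mul_comm (Γ t _), add_comm (W t) (U t)] at this
  convert this using 5 <;> · push_cast; ring

theorem induction_re_tendsto (hq : Tendsto q l (𝓝 q₀)) (hq0 : 0 < q₀.re) (S : ℝ)
    (P : (Λ → ℂ) → Prop)
    (h0 : ∀ (U : Λ → ℂ) (U₀ : ℂ), Tendsto U l (𝓝 U₀) → 0 < U₀.re → U₀.re < S → P U)
    (h1 : ∀ (U : Λ → ℂ) (U₀ : ℂ), Tendsto U l (𝓝 U₀) → q₀.re < U₀.re →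
      P (fun t => U t - q t) → P U) (hS : q₀.re < S) (hU : Tendsto U l (𝓝 U₀))
    (hU0 : 0 < U₀.re) : P U := by
  refine induction_re hq0 S (fun U₀ => ∀ U : Λ → ℂ, Tendsto U l (𝓝 U₀) → P U)
    (fun U₀ a b U hU => h0 U U₀ hU a b)
    (fun U₀ a b c ih U hU => h1 U U₀ hU c (ih _ (hU.sub hq))) hS U₀ hU0 U hU

theorem two_point_bound (hΓ : ∀ t, ShiftedGamma (p t) (q t) (Γ t)) (hp : Tendsto p l (𝓝 p₀))
    (hq : Tendsto q l (𝓝 q₀)) (hp0 : 0 < p₀.re) (hq0 : 0 < q₀.re) (hU : Tendsto U l (𝓝 U₀))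
    (hW : Tendsto W l (𝓝 W₀)) (hU0 : 0 < U₀.re) (hW0 : 0 < W₀.re) :
    ∃ C : ℝ, ∀ᶠ t in l, ∀ x : ℝ, ‖Γ t (U t + x * Complex.I) * Γ t (W t - x * Complex.I)‖ ≤
      C * Real.exp (Real.pi * |x| * ((U t + W t - p t - q t) / (p t * q t)).re) := by
  have hS : q₀.re < (p₀ + q₀).re := by simpa using hp0
  refine induction_re_tendsto hq hq0 (p₀ + q₀).re (fun U => ∃ C : ℝ, ∀ᶠ t in l, ∀ x : ℝ,
    ‖Γ t (U t + x * Complex.I) * Γ t (W t - x * Complex.I)‖ ≤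
      C * Real.exp (Real.pi * |x| * ((U t + W t - p t - q t) / (p t * q t)).re))
    (fun U U₀ hU hU0 hU1 => ?_)
    (fun U U₀ hU hU1 ih => two_point_bound_of_sub hΓ hp hq hp0 hU hU1 ih) hS
    hU hU0
  refine induction_re_tendsto hq hq0 (p₀ + q₀).re (fun W => ∃ C : ℝ, ∀ᶠ t in l, ∀ x : ℝ,
    ‖Γ t (U t + x * Complex.I) * Γ t (W t - x * Complex.I)‖ ≤
      C * Real.exp (Real.pi * |x| * ((U t + W t - p t - q t) / (p t * q t)).re))
    (fun W W₀ hW hW0 hW1 => two_point_strip hΓ hp hq hp0 hq0 hU hW hU0 hW0 hU1 hW1)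
    (fun W W₀ hW hW1 ih => two_point_swap (two_point_bound_of_sub hΓ hp hq hp0 hW hW1
      (two_point_swap ih))) hS hW hW0

theorem tendsto_of_tendsto [l.IsCountablyGenerated] (hΓ : ∀ t, ShiftedGamma (p t) (q t) (Γ t))
    (hΓ₀ : ShiftedGamma p₀ q₀ Γ₀) (hp : Tendsto p l (𝓝 p₀))
    (hq : Tendsto q l (𝓝 q₀)) (hU : Tendsto U l (𝓝 U₀)) (hU0 : 0 < U₀.re) :
    Tendsto (fun t => Γ t (U t)) l (𝓝 (Γ₀ U₀)) := by
  have hp0 := hΓ₀.re_left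
  have hq0 := hΓ₀.re_right
  have hS : q₀.re < (p₀ + q₀).re := by simpa using hp0
  refine induction_re hq0 (p₀ + q₀).re (fun U₀ => ∀ U : Λ → ℂ, Tendsto U l (𝓝 U₀) →
    Tendsto (fun t => Γ t (U t)) l (𝓝 (Γ₀ U₀)))
    (fun U₀ hU0 hU1 U hU => ?_) (fun U₀ hU0 hU1 hU2 ih U hU => ?_) hS U₀ hU0 U hU
  · rw [hΓ₀.strip U₀ hU0 hU1]
    have := (Complex.continuous_exp.tendsto _).comp (tendsto_gammaExponent hp hq
      (hU.sub ((hp.add hq).div_const 2)) hp0 hq0 (U₀ := U₀ - (p₀ + q₀) / 2) (by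
        simp at hU1 ⊢
        have : |U₀.re - (p₀.re + q₀.re) / 2| < (p₀.re + q₀.re) / 2 := by
          rw [abs_lt]; constructor <;> linarith
        linarith)).neg
    refine this.congr' ?_
    filter_upwards [eventually_re_lt hU (hp.add hq) hU1,
      eventually_re_lt tendsto_const_nhds hU (by simpa using hU0 : (0 : ℂ).re < _)] with t h2 h4
    rw [Complex.zero_re] at h4
    exact ((hΓ t).strip _ h4 h2).symm
  · rw [hΓ₀.eq_sub_right hU2]
    have hT : Tendsto (fun t => Real.pi * (U t - q t) / p t) l (𝓝 (Real.pi * (U₀ - q₀) / p₀)) :=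
      Tendsto.div ((hU.sub hq).const_mul _) hp hΓ₀.ne_left
    refine ((((Complex.continuous_sin.tendsto _).comp hT).const_mul 2).mul
      (ih _ (hU.sub hq))).congr' ?_
    filter_upwards [eventually_re_lt hq hU hU2] with t ht
    exact ((hΓ t).eq_sub_right ht).symm

end

end ShiftedGamma

end

section

theorem prod_pairs_succAbove {M : Type*} [CommMonoid M] {n : ℕ} (F : Fin (n + 1) × Fin (n + 1) → M)
    (hF : ∀ i j, F (i, j) = F (j, i)) (j : Fin (n + 1)) :
    ∏ p ∈ Finset.univ.filter (fun p : Fin (n + 1) × Fin (n + 1) => p.1 < p.2), F p =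
      (∏ l, F (j, j.succAbove l)) *
        ∏ p ∈ Finset.univ.filter (fun p : Fin n × Fin n => p.1 < p.2),
          F (j.succAbove p.1, j.succAbove p.2) := by
  rw [Finset.prod_filter, Finset.prod_filter, Fintype.prod_prod_type, Fintype.prod_prod_type,
    Fin.prod_univ_succAbove _ j, Fin.prod_univ_succAbove _ j]
  simp only [lt_self_iff_false, if_false, one_mul]
  simp_rw [Fin.prod_univ_succAbove _ j]
  rw [Finset.prod_mul_distrib, ← mul_assoc, ← Finset.prod_mul_distrib]
  congr 1
  · refine Finset.prod_congr rfl fun l _ => ?_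
    rcases lt_or_gt_of_ne (Fin.succAbove_ne j l) with h | h
    · rw [if_neg h.not_gt, if_pos h, one_mul, hF]
    · rw [if_pos h, if_neg h.not_gt, mul_one]
  · simp only [Fin.succAbove_lt_succAbove_iff]

theorem prod_pairs_const {M : Type*} [CommMonoid M] (n : ℕ) (c : M) :
    ∏ _p ∈ Finset.univ.filter (fun p : Fin n × Fin n => p.1 < p.2), c =
      ∏ j ∈ Finset.range n, c ^ j := by
  induction n with
  | zero => simp
  | succ n ih =>
    rw [prod_pairs_succAbove (fun _ => c) (fun _ _ => rfl) 0, ih, Finset.prod_range_succ]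
    simp [mul_comm]

/-- Single-variable factor of the Weyl-group average. -/
def shortFactor (A B x : ℂ) : ℂ := (1 - A * x) * (1 - B * x) / (1 - x ^ 2)

/-- Two-variable factor of the Weyl-group average. -/
def longFactor (t x : ℂ) : ℂ := (1 - t * x) / (1 - x)

theorem shortFactor_add_shortFactor {n : ℕ} (y : Fin n → ℂ) (X A B t : ℂ) (hX : X ≠ 0)
    (hX2 : X ^ 2 ≠ 1) (hy0 : ∀ i, y i ≠ 0) (hinj : Function.Injective y)
    (h1 : ∀ i, X * y i ≠ 1) (h2 : ∀ i, X ≠ y i) :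
    shortFactor A B X * ∏ i, longFactor t (X * y i) +
      shortFactor A B X⁻¹ * ∏ i, longFactor t (X⁻¹ * y i) =
    1 - A * B * t ^ n - (1 - t) * ∑ j, (y j - A) * (y j - B) *
      (∏ i, if i = j then 1 else longFactor t (y i / y j)) /
        ((1 - X * y j) * (1 - X⁻¹ * y j)) := by
  set v : Fin (n + 3) → ℂ := Fin.cons X (Fin.cons X⁻¹ (Fin.cons 0 y)) with hv
  have hXX : X ≠ X⁻¹ := fun h => hX2 (by
    field_simp at h
    exact h)
  have hXy : ∀ i, X⁻¹ ≠ y i := fun i h => h1 i (by rw [← h, mul_inv_cancel₀ hX])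
  have hvinj : Function.Injective v := by
    rw [hv, Fin.cons_injective_iff, Fin.cons_injective_iff, Fin.cons_injective_iff]
    refine ⟨?_, ?_, ?_, hinj⟩
    · rintro ⟨i, hi⟩
      refine Fin.cases (fun hi => hXX hi.symm) (fun i => Fin.cases (fun hi => hX hi.symm)
        (fun i hi => h2 i hi.symm) i) i hi
    · rintro ⟨i, hi⟩
      refine Fin.cases (fun hi => inv_ne_zero hX hi.symm) (fun i hi => hXy i hi.symm) i hi
    · rintro ⟨i, hi⟩
      exact hy0 i hi
  set Q : Polynomial ℂ := ∏ i, (Polynomial.X - Polynomial.C (t * y i)) with hQ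
  set P : Polynomial ℂ := (Polynomial.X - Polynomial.C A) * (Polynomial.X - Polynomial.C B) * Q
    with hP
  have hQm : Q.Monic := Polynomial.monic_prod_of_monic _ _ fun i _ => Polynomial.monic_X_sub_C _
  have hPm : P.Monic := ((Polynomial.monic_X_sub_C A).mul (Polynomial.monic_X_sub_C B)).mul hQm
  have hQd : Q.natDegree = n := by
    rw [hQ, Polynomial.natDegree_prod_of_monic _ _ fun i _ => Polynomial.monic_X_sub_C _]
    simp only [Polynomial.natDegree_X_sub_C]
    simp
  have hPd : P.natDegree = n + 2 := by
    rw [hP, ((Polynomial.monic_X_sub_C A).mul (Polynomial.monic_X_sub_C B)).natDegree_mul hQm,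
      (Polynomial.monic_X_sub_C A).natDegree_mul (Polynomial.monic_X_sub_C B), hQd]
    simp; ring
  have key := Lagrange.leadingCoeff_eq_sum (s := Finset.univ) (v := v) hvinj.injOn (P := P) (by
    rw [Polynomial.degree_eq_natDegree hPm.ne_zero, hPd]
    simp; norm_cast)
  rw [hPm.leadingCoeff] at key
  have herase : ∀ i, ∏ j ∈ Finset.univ.erase i, (v i - v j) =
      ∏ j, if j = i then 1 else v i - v j := by
    intro i
    rw [← Finset.prod_erase_mul _ _ (Finset.mem_univ i), if_pos rfl, mul_one]
    exact Finset.prod_congr rfl fun j hj => by rw [if_neg (Finset.ne_of_mem_erase hj)]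
  have hPe : ∀ z, P.eval z = (z - A) * (z - B) * ∏ i, (z - t * y i) := by
    intro z; simp [hP, hQ, Polynomial.eval_prod]
  simp only [herase, hPe] at key
  simp only [Fin.sum_univ_succ, Fin.prod_univ_succ, hv, Fin.cons_zero, Fin.cons_succ,
    Fin.succ_ne_zero, Fin.succ_inj, if_true, if_false, (Fin.succ_ne_zero _).symm, one_mul] at key
  have e0 : shortFactor A B X * ∏ i, longFactor t (X * y i) =
      (X⁻¹ - A) * (X⁻¹ - B) * (∏ i, (X⁻¹ - t * y i)) /
        ((X⁻¹ - X) * ((X⁻¹ - 0) * ∏ i, (X⁻¹ - y i))) := by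
    have : ∀ i, longFactor t (X * y i) = (X⁻¹ - t * y i) / (X⁻¹ - y i) := by
      intro i
      unfold longFactor
      have := sub_ne_zero.2 (hXy i)
      have := sub_ne_zero.2 (h1 i).symm
      rw [div_eq_div_iff this (by assumption)]
      field_simp
    rw [Finset.prod_congr rfl fun i _ => this i, Finset.prod_div_distrib]
    unfold shortFactor
    have a1 := sub_ne_zero.2 hX2.symm
    have a2 : X⁻¹ - X ≠ 0 := sub_ne_zero.2 hXX.symm
    have a3 : ∏ i, (X⁻¹ - y i) ≠ 0 := Finset.prod_ne_zero_iff.2 fun i _ => sub_ne_zero.2 (hXy i)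
    have a4 : (1 - A * X) * (1 - B * X) / (1 - X ^ 2) =
        (X⁻¹ - A) * (X⁻¹ - B) / ((X⁻¹ - X) * X⁻¹) := by
      have : X⁻¹ - X = (1 - X ^ 2) / X := by field_simp
      rw [this]; field_simp
    rw [a4, sub_zero, div_mul_div_comm]
    ring
  have e1 : shortFactor A B X⁻¹ * ∏ i, longFactor t (X⁻¹ * y i) =
      (X - A) * (X - B) * (∏ i, (X - t * y i)) /
        ((X - X⁻¹) * ((X - 0) * ∏ i, (X - y i))) := by
    have : ∀ i, longFactor t (X⁻¹ * y i) = (X - t * y i) / (X - y i) := by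
      intro i
      unfold longFactor
      have := sub_ne_zero.2 (h2 i)
      have : 1 - X⁻¹ * y i = (X - y i) / X := by field_simp
      rw [this]; field_simp
    rw [Finset.prod_congr rfl fun i _ => this i, Finset.prod_div_distrib]
    unfold shortFactor
    have a1 := sub_ne_zero.2 hX2
    have a3 : ∏ i, (X - y i) ≠ 0 := Finset.prod_ne_zero_iff.2 fun i _ => sub_ne_zero.2 (h2 i)
    have a4 : (1 - A * X⁻¹) * (1 - B * X⁻¹) / (1 - X⁻¹ ^ 2) =
        (X - A) * (X - B) / ((X - X⁻¹) * X) := by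
      have : X - X⁻¹ = (X ^ 2 - 1) / X := by field_simp
      have h' : 1 - X⁻¹ ^ 2 = (X ^ 2 - 1) / X ^ 2 := by field_simp
      rw [this, h']; field_simp
    rw [a4, sub_zero, div_mul_div_comm]
    ring
  have e2 : A * B * t ^ n = (0 - A) * (0 - B) * (∏ i, (0 - t * y i)) /
      ((0 - X) * ((0 - X⁻¹) * ∏ i, (0 - y i))) := by
    have a3 : ∏ i, y i ≠ 0 := Finset.prod_ne_zero_iff.2 fun i _ => hy0 i
    simp only [zero_sub, ← mul_neg, Finset.prod_mul_distrib, Finset.prod_const, Finset.card_univ,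
      Fintype.card_fin]
    have a4 : ∏ i, -y i ≠ 0 := Finset.prod_ne_zero_iff.2 fun i _ => neg_ne_zero.2 (hy0 i)
    field_simp
  have e3 : ∀ j, (1 - t) * ((y j - A) * (y j - B) *
      (∏ i, if i = j then 1 else longFactor t (y i / y j)) /
        ((1 - X * y j) * (1 - X⁻¹ * y j))) = (y j - A) * (y j - B) * (∏ i, (y j - t * y i)) /
        ((y j - X) * ((y j - X⁻¹) * ((y j - 0) *
          ∏ i, if i = j then 1 else y j - y i))) := by
    intro j
    have b1 : (∏ i, if i = j then 1 else longFactor t (y i / y j)) =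
        (∏ i, if i = j then 1 else (y j - t * y i)) / ∏ i, if i = j then 1 else (y j - y i) := by
      rw [← Finset.prod_div_distrib]
      refine Finset.prod_congr rfl fun i _ => ?_
      split_ifs with h
      · simp
      · have := sub_ne_zero.2 (fun h' => h (hinj h').symm : y j ≠ y i)
        have hj := hy0 j
        unfold longFactor
        have : 1 - y i / y j = (y j - y i) / y j := by field_simp
        rw [this]; field_simp
    have b2 : ∏ i, (y j - t * y i) = (1 - t) * y j * ∏ i, if i = j then 1 else (y j - t * y i) := by
      rw [← Finset.prod_erase_mul _ _ (Finset.mem_univ j),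
        ← Finset.prod_erase_mul _ (fun i => if i = j then 1 else (y j - t * y i))
        (Finset.mem_univ j), if_pos rfl, mul_one,
        Finset.prod_congr rfl fun i hi => if_neg (Finset.ne_of_mem_erase hi)]
      ring
    have b3 : (∏ i, if i = j then 1 else (y j - y i)) ≠ 0 := by
      refine Finset.prod_ne_zero_iff.2 fun i _ => ?_
      split_ifs with h
      · exact one_ne_zero
      · exact sub_ne_zero.2 (fun h' => h (hinj h').symm)
    rw [b1, b2, sub_zero]
    have b4 : (1 - X * y j) * (1 - X⁻¹ * y j) = (y j - X) * (y j - X⁻¹) := by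
      field_simp; ring
    have b5 := sub_ne_zero.2 (h2 j).symm
    have b6 := sub_ne_zero.2 (hXy j).symm
    have b7 := hy0 j
    rw [b4]
    generalize y j - X⁻¹ = Z at *
    field_simp
  rw [e0, e1, e2, Finset.mul_sum, Finset.sum_congr rfl fun j _ => e3 j]
  linear_combination -key

theorem alternating_term {n : ℕ} (y : Fin n → ℂ) (X A B t : ℂ) (hX : X ≠ 0) (j : Fin n)
    (hy0 : ∀ i, y i ≠ 0) :
    (∏ i, shortFactor A B (Function.update y j (y j)⁻¹ i)) *
      (∏ p ∈ Finset.univ.filter (fun p : Fin n × Fin n => p.1 < p.2),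
        longFactor t (Function.update y j (y j)⁻¹ p.1 * Function.update y j (y j)⁻¹ p.2)) *
      (((y j)⁻¹ - A) * ((y j)⁻¹ - B) *
      (∏ i, if i = j then 1 else longFactor t (Function.update y j (y j)⁻¹ i / (y j)⁻¹)) /
        ((1 - X * (y j)⁻¹) * (1 - X⁻¹ * (y j)⁻¹))) =
    -((∏ i, shortFactor A B (y i)) *
      (∏ p ∈ Finset.univ.filter (fun p : Fin n × Fin n => p.1 < p.2), longFactor t (y p.1 * y p.2)) *
      ((y j - A) * (y j - B) *
      (∏ i, if i = j then 1 else longFactor t (y i / y j)) /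
        ((1 - X * y j) * (1 - X⁻¹ * y j)))) := by
  obtain _ | n := n
  · exact j.elim0
  rw [prod_pairs_succAbove (fun p => longFactor t (Function.update y j (y j)⁻¹ p.1 *
    Function.update y j (y j)⁻¹ p.2)) (fun i k => by simp only [mul_comm]) j,
    prod_pairs_succAbove (fun p => longFactor t (y p.1 * y p.2))
      (fun i k => by simp only [mul_comm]) j]
  simp only [Fin.prod_univ_succAbove _ j, Function.update_self, if_true, Fin.succAbove_ne, if_false,
    ne_eq, not_false_eq_true, Function.update_of_ne, one_mul]
  have hj := hy0 j
  simp only [div_inv_eq_mul, div_eq_mul_inv (y _) (y j), mul_comm (y j)⁻¹ (y (j.succAbove _)),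
    mul_comm (y j) (y (j.succAbove _))]
  generalize (∏ i, longFactor t (y (j.succAbove i) * y j)) = L₁
  generalize (∏ i, longFactor t (y (j.succAbove i) * (y j)⁻¹)) = L₂
  have e : shortFactor A B (y j)⁻¹ * ((y j)⁻¹ - A) * ((y j)⁻¹ - B) /
        ((1 - X * (y j)⁻¹) * (1 - X⁻¹ * (y j)⁻¹)) =
      -(shortFactor A B (y j) * (y j - A) * (y j - B) / ((1 - X * y j) * (1 - X⁻¹ * y j))) := by
    unfold shortFactor
    generalize y j = z at hj
    have d1 : (1 - X * z⁻¹) * (1 - X⁻¹ * z⁻¹) = (1 - X * z) * (1 - X⁻¹ * z) / z ^ 2 := by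
      field_simp; ring
    have d2 : 1 - z⁻¹ ^ 2 = -(1 - z ^ 2) / z ^ 2 := by field_simp; ring
    rw [d1, d2]
    generalize (1 - X * z) * (1 - X⁻¹ * z) = D
    generalize 1 - z ^ 2 = E
    field_simp
  linear_combination (∏ i, shortFactor A B (y (j.succAbove i))) * L₂ * L₁ *
    (∏ p ∈ Finset.univ.filter (fun p : Fin n × Fin n => p.1 < p.2),
      longFactor t (y (j.succAbove p.1) * y (j.succAbove p.2))) * e

/-- Sign change of the exponents of `x` selected by `σ`. -/
def signInv {n : ℕ} (σ : Fin n → Bool) (x : Fin n → ℂ) (i : Fin n) : ℂ :=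
  if σ i then (x i)⁻¹ else x i

theorem sum_signInv {n : ℕ} (x : Fin n → ℂ) (A B t : ℂ) (h0 : ∀ i, x i ≠ 0)
    (hsq : ∀ i, x i ^ 2 ≠ 1) (hmul : ∀ i j, i ≠ j → x i * x j ≠ 1)
    (hne : ∀ i j, i ≠ j → x i ≠ x j) :
    ∑ σ : Fin n → Bool, (∏ i, shortFactor A B (signInv σ x i)) *
      ∏ p ∈ Finset.univ.filter (fun p : Fin n × Fin n => p.1 < p.2),
        longFactor t (signInv σ x p.1 * signInv σ x p.2) =
      ∏ j ∈ Finset.range n, (1 - A * B * t ^ j) := by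
  induction n with
  | zero => simp
  | succ n ih =>
    rw [← (Fin.insertNthEquiv (fun _ => Bool) 0).sum_comp, Fintype.sum_prod_type, Fintype.sum_bool,
      ← Finset.sum_add_distrib, Finset.prod_range_succ]
    have hs0 : ∀ (b : Bool) (σ : Fin n → Bool), signInv (Fin.cons b σ : Fin (n + 1) → Bool) x 0 =
        if b then (x 0)⁻¹ else x 0 := fun b σ => rfl
    have hss : ∀ (b : Bool) (σ : Fin n → Bool) i,
        signInv (Fin.cons b σ : Fin (n + 1) → Bool) x (Fin.succ i) =
        signInv σ (fun i => x i.succ) i := fun b σ i => rfl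
    have hce : ∀ (b : Bool) (σ : Fin n → Bool), (Fin.consEquiv fun _ => Bool) (b, σ) =
        Fin.cons b σ := fun _ _ => rfl
    simp only [Fin.insertNthEquiv_zero, hce]
    have hsplit : ∀ (b : Bool) (σ : Fin n → Bool),
        (∏ p ∈ Finset.univ.filter (fun p : Fin (n + 1) × Fin (n + 1) => p.1 < p.2),
        longFactor t (signInv (Fin.cons b σ : Fin (n + 1) → Bool) x p.1 *
          signInv (Fin.cons b σ : Fin (n + 1) → Bool) x p.2)) =
        (∏ i, longFactor t ((if b then (x 0)⁻¹ else x 0) * signInv σ (fun i => x i.succ) i)) *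
        ∏ p ∈ Finset.univ.filter (fun p : Fin n × Fin n => p.1 < p.2),
        longFactor t (signInv σ (fun i => x i.succ) p.1 * signInv σ (fun i => x i.succ) p.2) := by
      intro b σ
      rw [prod_pairs_succAbove (fun p => longFactor t (signInv (Fin.cons b σ : Fin (n + 1) → Bool)
        x p.1 * signInv (Fin.cons b σ : Fin (n + 1) → Bool) x p.2))
        (fun i k => by simp only [mul_comm]) 0]
      simp only [Fin.zero_succAbove, hs0, hss]
    simp only [hsplit, Fin.prod_univ_succ, hs0, hss, if_true, Bool.false_eq_true, if_false]
    set x' : Fin n → ℂ := fun i => x i.succ with hx'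
    set W : (Fin n → Bool) → ℂ := fun σ => (∏ i, shortFactor A B (signInv σ x' i)) *
      ∏ p ∈ Finset.univ.filter (fun p : Fin n × Fin n => p.1 < p.2),
        longFactor t (signInv σ x' p.1 * signInv σ x' p.2) with hW
    set R : (Fin n → Bool) → Fin n → ℂ := fun σ j => (signInv σ x' j - A) * (signInv σ x' j - B) *
      (∏ i, if i = j then 1 else longFactor t (signInv σ x' i / signInv σ x' j)) /
        ((1 - x 0 * signInv σ x' j) * (1 - (x 0)⁻¹ * signInv σ x' j)) with hR
    have hs' : ∀ i, (i : Fin n).succ ≠ 0 := Fin.succ_ne_zero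
    have hcases : ∀ (σ : Fin n → Bool) i, signInv σ x' i = x' i ∨ signInv σ x' i = (x' i)⁻¹ := by
      intro σ i
      unfold signInv
      split_ifs <;> simp
    have hpair : ∀ σ : Fin n → Bool, shortFactor A B (x 0) *
        ∏ i, longFactor t (x 0 * signInv σ x' i) +
        shortFactor A B (x 0)⁻¹ * ∏ i, longFactor t ((x 0)⁻¹ * signInv σ x' i) =
        1 - A * B * t ^ n - (1 - t) * ∑ j, R σ j := by
      intro σ
      refine shortFactor_add_shortFactor _ _ _ _ _ (h0 0) (hsq 0) (fun i => ?_) (fun i k hik => ?_)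
        (fun i hi => ?_) (fun i hi => ?_)
      · rcases hcases σ i with h | h <;> rw [h]
        · exact h0 _
        · exact inv_ne_zero (h0 _)
      · by_contra hne'
        have h3 := hne _ _ (fun h => hne' (Fin.succ_injective _ h))
        have h4 := hmul _ _ (fun h => hne' (Fin.succ_injective _ h))
        have hk := h0 k.succ
        have hi := h0 i.succ
        rcases hcases σ i with h | h <;> rcases hcases σ k with h' | h' <;> rw [h, h'] at hik
        · exact h3 hik
        · exact h4 (by rw [show x i.succ = x' i from rfl, hik]; exact inv_mul_cancel₀ hk)
        · exact h4 (by rw [show x k.succ = x' k from rfl, ← hik]; exact mul_inv_cancel₀ hi)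
        · exact h3 (inv_injective hik)
      · have hi' := h0 i.succ
        rcases hcases σ i with h | h <;> rw [h] at hi
        · exact hmul _ _ (hs' i).symm hi
        · refine hne _ _ (hs' i).symm ?_
          have := mul_inv_cancel₀ hi'
          exact mul_right_cancel₀ (inv_ne_zero hi') (hi.trans this.symm)
      · have hi' := h0 i.succ
        rcases hcases σ i with h | h <;> rw [h] at hi
        · exact hne _ _ (hs' i).symm hi
        · exact hmul _ _ (hs' i).symm (by rw [hi]; exact inv_mul_cancel₀ hi')
    have hzero : ∀ j, ∑ σ, W σ * R σ j = 0 := by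
      intro j
      refine Finset.sum_involution (fun σ _ => Function.update σ j (!σ j)) ?_ ?_ ?_ ?_
      · intro σ _
        have hup : signInv (Function.update σ j (!σ j)) x' =
            Function.update (signInv σ x') j (signInv σ x' j)⁻¹ := by
          ext i
          by_cases hij : i = j
          · subst hij
            simp only [signInv, Function.update_self]
            cases σ i <;> simp
          · simp only [signInv, Function.update_of_ne hij]
        have := alternating_term (signInv σ x') (x 0) A B t (h0 0) j (fun i => by
          rcases hcases σ i with h | h <;> rw [h]
          · exact h0 _
          · exact inv_ne_zero (h0 _))
        simp only [hW, hR, hup, Function.update_self]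
        linear_combination this
      · intro σ _ _ h
        have := congrFun h j
        simp at this
      · intro σ _; simp
      · intro σ _; simp
    have hsum : ∑ σ, W σ * ∑ j, R σ j = 0 := by
      simp_rw [Finset.mul_sum]
      rw [Finset.sum_comm]
      exact Finset.sum_eq_zero fun j _ => hzero j
    have ih' := ih x' (fun i => h0 _) (fun i => hsq _)
      (fun i j h => hmul _ _ fun h' => h (Fin.succ_injective _ h'))
      (fun i j h => hne _ _ fun h' => h (Fin.succ_injective _ h'))
    rw [← ih']
    calc _ = ∑ σ, (W σ * (1 - A * B * t ^ n) - (1 - t) * (W σ * ∑ j, R σ j)) := by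
          refine Finset.sum_congr rfl fun σ _ => ?_
          simp only [hW]
          linear_combination (∏ i, shortFactor A B (signInv σ x' i)) *
            (∏ p ∈ Finset.univ.filter (fun p : Fin n × Fin n => p.1 < p.2),
              longFactor t (signInv σ x' p.1 * signInv σ x' p.2)) * hpair σ
      _ = _ := by
          rw [Finset.sum_sub_distrib, ← Finset.mul_sum, hsum, mul_zero, sub_zero, Finset.sum_mul]

/-- `2 sin(π u / q)`. -/
def sn (q u : ℂ) : ℂ := 2 * Complex.sin (Real.pi * u / q)

theorem sn_eq (q u : ℂ) : sn q u = Complex.I * (Complex.exp (Real.pi * u / q * Complex.I))⁻¹ *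
    (1 - Complex.exp (Real.pi * u / q * Complex.I) ^ 2) := by
  unfold sn
  rw [Complex.sin, neg_mul, Complex.exp_neg]
  have := Complex.exp_ne_zero (Real.pi * u / q * Complex.I)
  field_simp

theorem exp_sq_ne_one {q u : ℂ} (h : sn q u ≠ 0) :
    Complex.exp (Real.pi * u / q * Complex.I) ^ 2 ≠ 1 := fun h' => h (by
  rw [sn_eq, h', sub_self, mul_zero])

theorem exp_phase_add (q u v : ℂ) : Complex.exp (Real.pi * (u + v) / q * Complex.I) =
    Complex.exp (Real.pi * u / q * Complex.I) * Complex.exp (Real.pi * v / q * Complex.I) := by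
  rw [← Complex.exp_add]; congr 1; ring

theorem exp_phase_neg (q u : ℂ) : Complex.exp (Real.pi * (-u) / q * Complex.I) =
    (Complex.exp (Real.pi * u / q * Complex.I))⁻¹ := by
  rw [← Complex.exp_neg]; congr 1; ring

/-- Sign change of the entries of `ζ` selected by `σ`. -/
def signFlip {R : Type*} [Neg R] {n : ℕ} (σ : Fin n → Bool) (ζ : Fin n → R) (i : Fin n) : R :=
  if σ i then -ζ i else ζ i

/-- Weyl-chamber coefficient of the difference operator. -/
def weylCoeff {n : ℕ} (q a b k : ℂ) (ζ : Fin n → ℂ) : ℂ :=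
  (∏ i, sn q (a + ζ i) * sn q (b + ζ i) / sn q (2 * ζ i)) *
    ∏ p ∈ Finset.univ.filter (fun p : Fin n × Fin n => p.1 < p.2),
      sn q (k + (ζ p.1 + ζ p.2)) / sn q (ζ p.1 + ζ p.2)

theorem sum_weylCoeff {n : ℕ} (q a b k : ℂ) (ζ : Fin n → ℂ)
    (hsq : ∀ i, sn q (2 * ζ i) ≠ 0) (hadd : ∀ i j, i ≠ j → sn q (ζ i + ζ j) ≠ 0)
    (hsub : ∀ i j, i ≠ j → sn q (ζ i - ζ j) ≠ 0) :
    ∑ σ : Fin n → Bool, weylCoeff q a b k (signFlip σ ζ) =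
      ∏ j ∈ Finset.range n, sn q (a + b + j * k) := by
  set E : ℂ → ℂ := fun u => Complex.exp (Real.pi * u / q * Complex.I) with hE
  have hE0 : ∀ u, E u ≠ 0 := fun u => Complex.exp_ne_zero _
  have hEa : ∀ u v, E (u + v) = E u * E v := exp_phase_add q
  have hEn : ∀ u, E (-u) = (E u)⁻¹ := exp_phase_neg q
  have hsn : ∀ u, sn q u = Complex.I * (E u)⁻¹ * (1 - E u ^ 2) := sn_eq q
  have hE2 : ∀ u, E (2 * u) = E u ^ 2 := fun u => by rw [two_mul, hEa, sq]
  have key := sum_signInv (fun i => E (ζ i) ^ 2) (E a ^ 2) (E b ^ 2) (E k ^ 2)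
    (fun i => pow_ne_zero _ (hE0 _))
    (fun i => by rw [← hE2]; exact exp_sq_ne_one (hsq i))
    (fun i j h => by rw [← mul_pow, ← hEa]; exact exp_sq_ne_one (hadd i j h))
    (fun i j h h' => by
      refine exp_sq_ne_one (hsub i j h) ?_
      change E (ζ i - ζ j) ^ 2 = 1
      rw [sub_eq_add_neg, hEa, hEn, mul_pow, h', ← mul_pow, mul_inv_cancel₀ (hE0 _), one_pow])
  have hflip : ∀ (σ : Fin n → Bool) i, signInv σ (fun i => E (ζ i) ^ 2) i =
      E (signFlip σ ζ i) ^ 2 := by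
    intro σ i
    unfold signInv signFlip
    split_ifs
    · rw [hEn, inv_pow]
    · rfl
  have hs : ∀ z, sn q (a + z) * sn q (b + z) / sn q (2 * z) =
      Complex.I * (E (a + b))⁻¹ * shortFactor (E a ^ 2) (E b ^ 2) (E z ^ 2) := by
    intro z
    simp only [hsn, hEa, hE2, shortFactor, mul_pow]
    have h1 := hE0 a
    have h2 := hE0 b
    have h3 := hE0 z
    have hI := Complex.I_ne_zero
    generalize hD : 1 - (E z ^ 2) ^ 2 = D
    field_simp
  have hl : ∀ z, sn q (k + z) / sn q z = (E k)⁻¹ * longFactor (E k ^ 2) (E z ^ 2) := by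
    intro z
    simp only [hsn, hEa, longFactor, mul_pow]
    have h1 := hE0 k
    have h3 := hE0 z
    have hI := Complex.I_ne_zero
    generalize hD : 1 - E z ^ 2 = D
    field_simp
  have hEj : ∀ j : ℕ, E (j * k) = E k ^ j := fun j => by
    simp only [hE]
    rw [← Complex.exp_nat_mul]; congr 1; ring
  have hr : ∀ j : ℕ, sn q (a + b + j * k) = Complex.I * (E (a + b))⁻¹ * ((E k)⁻¹ ^ j *
      (1 - E a ^ 2 * E b ^ 2 * (E k ^ 2) ^ j)) := by
    intro j
    rw [hsn, hEa (a + b), hEj, hEa]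
    have h1 := hE0 a
    have h2 := hE0 b
    have h3 := pow_ne_zero j (hE0 k)
    rw [inv_pow, ← pow_mul, mul_comm 2 j, pow_mul]
    generalize E k ^ j = K at *
    field_simp
  simp only [weylCoeff, hs, hl, hr, Finset.prod_mul_distrib, prod_pairs_const]
  simp only [Finset.prod_const, Finset.card_univ, Fintype.card_fin, Finset.card_range]
  rw [← key]
  simp only [hflip]
  rw [Finset.mul_sum, Finset.mul_sum]
  refine Finset.sum_congr rfl fun σ _ => ?_
  simp only [signFlip, hEa, mul_pow]
  ring

end

section

/-- Uniform exponential bound `f t x = O(exp (π |x| r t))` along the filter `l`. -/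
def ExpBd {Λ : Type*} (l : Filter Λ) (f : Λ → ℝ → ℂ) (r : Λ → ℝ) : Prop :=
  ∃ C : ℝ, ∀ᶠ t in l, ∀ x : ℝ, ‖f t x‖ ≤ C * Real.exp (Real.pi * |x| * r t)

namespace ExpBd

variable {Λ : Type*} {l : Filter Λ} {f g h : Λ → ℝ → ℂ} {r s : Λ → ℝ}

theorem mul (hf : ExpBd l f r) (hg : ExpBd l g s) :
    ExpBd l (fun t x => f t x * g t x) (fun t => r t + s t) := by
  obtain ⟨C, hC⟩ := hf
  obtain ⟨D, hD⟩ := hg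
  refine ⟨C * D, ?_⟩
  filter_upwards [hC, hD] with t h1 h2 x
  rw [norm_mul, mul_add, Real.exp_add]
  calc _ ≤ (C * Real.exp (Real.pi * |x| * r t)) * (D * Real.exp (Real.pi * |x| * s t)) :=
        mul_le_mul (h1 x) (h2 x) (norm_nonneg _) ((norm_nonneg _).trans (h1 x))
    _ = _ := by ring

theorem neg (hf : ExpBd l f r) : ExpBd l (fun t x => -f t x) r := by
  simpa only [ExpBd, norm_neg] using hf

theorem congr_rate (hf : ExpBd l f r) (hrs : ∀ᶠ t in l, r t = s t) : ExpBd l f s := by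
  obtain ⟨C, hC⟩ := hf
  refine ⟨C, ?_⟩
  filter_upwards [hC, hrs] with t h1 h2 x
  rw [← h2]
  exact h1 x

theorem exists_decay (hf : ExpBd l f r) {r₀ : ℝ} (hr : Tendsto r l (𝓝 r₀)) (hr0 : r₀ < 0) :
    ∃ C c : ℝ, 0 ≤ C ∧ 0 < c ∧ ∀ᶠ t in l, ∀ x : ℝ, ‖f t x‖ ≤ C * Real.exp (-c * |x|) := by
  obtain ⟨C, hC⟩ := hf
  refine ⟨max C 0, Real.pi * (-r₀ / 2), le_max_right _ _,
    mul_pos Real.pi_pos (by linarith), ?_⟩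
  filter_upwards [hC, hr.eventually_lt_const (show r₀ < r₀ / 2 by linarith)] with t h1 h2 x
  refine (h1 x).trans (mul_le_mul (le_max_left _ _) (Real.exp_le_exp.2 ?_) (Real.exp_nonneg _)
    (le_max_right _ _))
  have := mul_nonneg Real.pi_pos.le (abs_nonneg x)
  nlinarith

theorem dominate {u : Λ → ℝ} {r₀ s₀ u₀ : ℝ} (hf : ExpBd l f r) (hg : ExpBd l g s)
    (hh : ExpBd l h u) (hr : Tendsto r l (𝓝 r₀)) (hr0 : r₀ < 0) (hs : Tendsto s l (𝓝 s₀))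
    (hs0 : s₀ < 0) (hu : Tendsto u l (𝓝 u₀)) (hu0 : u₀ < 0) :
    ∃ C c : ℝ, 0 < c ∧ ∀ᶠ t in l, ∀ x, ‖f t x‖ ≤ C * Real.exp (-c * |x|) ∧
      ‖g t x‖ ≤ C ∧ ‖h t x‖ ≤ C := by
  obtain ⟨C₁, c₁, hC₁, hc₁, h₁⟩ := hf.exists_decay hr hr0
  obtain ⟨C₂, c₂, hC₂, hc₂, h₂⟩ := hg.exists_decay hs hs0
  obtain ⟨C₃, c₃, hC₃, hc₃, h₃⟩ := hh.exists_decay hu hu0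
  refine ⟨C₁ + C₂ + C₃, c₁, hc₁, ?_⟩
  have key : ∀ {C c x : ℝ}, 0 ≤ C → 0 < c → C * Real.exp (-c * |x|) ≤ C := fun hC hc =>
    mul_le_of_le_one_right hC (Real.exp_le_one_iff.2
      (mul_nonpos_of_nonpos_of_nonneg (neg_nonpos.2 hc.le) (abs_nonneg _)))
  filter_upwards [h₁, h₂, h₃] with t h1 h2 h3 x
  refine ⟨(h1 x).trans (mul_le_mul_of_nonneg_right (by linarith) (Real.exp_nonneg _)),
    ((h2 x).trans (key hC₂ hc₂)).trans (by linarith),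
    ((h3 x).trans (key hC₃ hc₃)).trans (by linarith)⟩

theorem sn {p z : Λ → ℂ} {p₀ z₀ : ℂ} (hp : Tendsto p l (𝓝 p₀)) (hp0 : 0 < p₀.re)
    (hz : Tendsto z l (𝓝 z₀)) {m : ℝ} (hm : 0 ≤ m) :
    ExpBd l (fun t x => sn (p t) (z t + m * (x * Complex.I))) (fun t => m * (1 / p t).re) := by
  have hp1 : p₀ ≠ 0 := fun h => by simp [h] at hp0
  have hT : Tendsto (fun t => ‖z t / p t‖) l (𝓝 ‖z₀ / p₀‖) :=
    (Tendsto.div hz hp hp1).norm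
  refine ⟨2 * Real.exp (Real.pi * (‖z₀ / p₀‖ + 1)), ?_⟩
  filter_upwards [hT.eventually_lt_const (lt_add_one _),
    ((Complex.continuous_re.tendsto _).comp hp).eventually_const_lt hp0] with t h1 h2 x
  have h3 : 0 < (1 / p t).re := ShiftedGamma.re_div_pos h2
  rw [_root_.sn, norm_mul, mul_assoc, ← Real.exp_add]
  refine mul_le_mul (by simp) ((norm_sin_le _).trans (Real.exp_le_exp.2 ?_)) (norm_nonneg _)
    (by norm_num)
  have e : (Real.pi * (z t + m * (x * Complex.I)) / p t).im =
      Real.pi * (z t / p t).im + Real.pi * x * (m * (1 / p t).re) := by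
    rw [show (Real.pi * (z t + m * (x * Complex.I)) / p t : ℂ) =
      ((Real.pi : ℝ) : ℂ) * (z t / p t) +
        ((Real.pi * x * m : ℝ) : ℂ) * ((1 / p t) * Complex.I) by push_cast; ring]
    rw [Complex.add_im, Complex.im_ofReal_mul, Complex.im_ofReal_mul, Complex.mul_I_im]
    ring
  rw [e]
  refine (abs_add_le _ _).trans ?_
  rw [abs_mul, abs_mul, abs_mul, abs_of_pos Real.pi_pos, abs_of_nonneg (mul_nonneg hm h3.le)]
  have := (Complex.abs_im_le_norm (z t / p t)).trans h1.le
  nlinarith [mul_le_mul_of_nonneg_left this Real.pi_pos.le]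

end ExpBd

/-- The pair of shifted gamma functions attached to one short parameter. -/
def gPair (Γ : ℂ → ℂ) (U W ζ : ℂ) : ℂ := Γ (U + ζ) * Γ (W - ζ)

theorem ExpBd.gPair {Λ : Type*} {l : Filter Λ} {p q U W : Λ → ℂ} {Γ : Λ → ℂ → ℂ}
    {p₀ q₀ U₀ W₀ : ℂ} (hΓ : ∀ t, ShiftedGamma (p t) (q t) (Γ t)) (hp : Tendsto p l (𝓝 p₀))
    (hq : Tendsto q l (𝓝 q₀)) (hp0 : 0 < p₀.re) (hq0 : 0 < q₀.re) (hU : Tendsto U l (𝓝 U₀))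
    (hW : Tendsto W l (𝓝 W₀)) (hU0 : 0 < U₀.re) (hW0 : 0 < W₀.re) :
    ExpBd l (fun t x => gPair (Γ t) (U t) (W t) (x * Complex.I))
      (fun t => ((U t + W t - p t - q t) / (p t * q t)).re) :=
  ShiftedGamma.two_point_bound hΓ hp hq hp0 hq0 hU hW hU0 hW0

/-- Short root weight. -/
def hW (p q : ℂ) (Γ : ℂ → ℂ) (a b c d ζ : ℂ) : ℂ :=
  -(sn p (2 * ζ) * sn q (2 * ζ)) *
    (gPair Γ a a ζ * gPair Γ b b ζ * (gPair Γ c c ζ * gPair Γ d d ζ))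

/-- Long root weight. -/
def lW (p q : ℂ) (Γ : ℂ → ℂ) (k x : ℂ) : ℂ := -(sn p x * sn q x) * gPair Γ k k x

/-- Short root weight for the shifted contour. -/
def hC (p : ℂ) (Γ : ℂ → ℂ) (a b c d z ζ : ℂ) : ℂ :=
  -sn p (2 * z + 2 * ζ) *
    (gPair Γ (a + p + z) (a - z) ζ * gPair Γ (b + p + z) (b - z) ζ *
      (gPair Γ (c + z) (c - z) ζ * gPair Γ (d + z) (d - z) ζ))

/-- Long root weight for the shifted contour. -/
def qC (p : ℂ) (Γ : ℂ → ℂ) (k z x : ℂ) : ℂ :=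
  -sn p (2 * z + x) * gPair Γ (k + p + 2 * z) (k - 2 * z) x

/-- The hyperbolic Koornwinder-type integral. -/
def koornwinder (n : ℕ) (p q : ℂ) (Γ : ℂ → ℂ) (k a b c d : ℂ) : ℂ :=
  ∫ v : Fin n → ℝ, wt (fun x => hW p q Γ a b c d (x * Complex.I))
    (fun x => lW p q Γ k (x * Complex.I)) (fun x => lW p q Γ k (x * Complex.I)) v

section bounds

variable {Λ : Type*} {l : Filter Λ} {p q k a b c d z : Λ → ℂ} {Γ : Λ → ℂ → ℂ}
  {p₀ q₀ k₀ a₀ b₀ c₀ d₀ z₀ : ℂ}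

theorem re_one_div_add {p q w : ℂ} (hp : p ≠ 0) (hq : q ≠ 0) :
    ((w - p - q) / (p * q)).re = (w / (p * q)).re - (1 / p).re - (1 / q).re := by
  rw [← Complex.sub_re, ← Complex.sub_re]
  congr 1
  field_simp
  ring

theorem expBd_hW (hΓ : ∀ t, ShiftedGamma (p t) (q t) (Γ t)) (hp : Tendsto p l (𝓝 p₀))
    (hq : Tendsto q l (𝓝 q₀)) (hp0 : 0 < p₀.re) (hq0 : 0 < q₀.re)
    (ha : Tendsto a l (𝓝 a₀)) (hb : Tendsto b l (𝓝 b₀)) (hc : Tendsto c l (𝓝 c₀))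
    (hd : Tendsto d l (𝓝 d₀)) (ha0 : 0 < a₀.re) (hb0 : 0 < b₀.re) (hc0 : 0 < c₀.re)
    (hd0 : 0 < d₀.re) :
    ExpBd l (fun t x => hW (p t) (q t) (Γ t) (a t) (b t) (c t) (d t) (x * Complex.I))
      (fun t => 2 * ((a t + b t + c t + d t - p t - q t) / (p t * q t)).re) := by
  have hs : ∀ {p : Λ → ℂ} {p₀ : ℂ}, Tendsto p l (𝓝 p₀) → 0 < p₀.re →
      ExpBd l (fun t x => sn (p t) (2 * (x * Complex.I))) (fun t => 2 * (1 / p t).re) := by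
    intro p p₀ hp hp0
    simpa using ExpBd.sn hp hp0 (tendsto_const_nhds (x := (0 : ℂ))) (m := 2) (by norm_num)
  have hg : ∀ {a : Λ → ℂ} {a₀ : ℂ}, Tendsto a l (𝓝 a₀) → 0 < a₀.re →
      ExpBd l (fun t x => gPair (Γ t) (a t) (a t) (x * Complex.I))
        (fun t => ((a t + a t - p t - q t) / (p t * q t)).re) := fun ha ha0 =>
    ExpBd.gPair hΓ hp hq hp0 hq0 ha ha ha0 ha0
  refine (((hs hp hp0).mul (hs hq hq0)).neg.mul
    (((hg ha ha0).mul (hg hb hb0)).mul ((hg hc hc0).mul (hg hd hd0)))).congr_rate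
    (Eventually.of_forall fun t => ?_)
  simp only [re_one_div_add (hΓ t).ne_left (hΓ t).ne_right, add_div, Complex.add_re]
  ring

theorem expBd_lW (hΓ : ∀ t, ShiftedGamma (p t) (q t) (Γ t)) (hp : Tendsto p l (𝓝 p₀))
    (hq : Tendsto q l (𝓝 q₀)) (hp0 : 0 < p₀.re) (hq0 : 0 < q₀.re)
    (hk : Tendsto k l (𝓝 k₀)) (hk0 : 0 < k₀.re) :
    ExpBd l (fun t x => lW (p t) (q t) (Γ t) (k t) (x * Complex.I))
      (fun t => 2 * (k t / (p t * q t)).re) := by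
  have hs : ∀ {p : Λ → ℂ} {p₀ : ℂ}, Tendsto p l (𝓝 p₀) → 0 < p₀.re →
      ExpBd l (fun t x => sn (p t) (x * Complex.I)) (fun t => (1 / p t).re) := by
    intro p p₀ hp hp0
    simpa using ExpBd.sn hp hp0 (tendsto_const_nhds (x := (0 : ℂ))) (m := 1) (by norm_num)
  refine (((hs hp hp0).mul (hs hq hq0)).neg.mul
    (ExpBd.gPair hΓ hp hq hp0 hq0 hk hk hk0 hk0)).congr_rate (Eventually.of_forall fun t => ?_)
  simp only [re_one_div_add (hΓ t).ne_left (hΓ t).ne_right, add_div, Complex.add_re]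
  ring

theorem expBd_hC (hΓ : ∀ t, ShiftedGamma (p t) (q t) (Γ t)) (hp : Tendsto p l (𝓝 p₀))
    (hq : Tendsto q l (𝓝 q₀)) (hp0 : 0 < p₀.re) (hq0 : 0 < q₀.re)
    (ha : Tendsto a l (𝓝 a₀)) (hb : Tendsto b l (𝓝 b₀)) (hc : Tendsto c l (𝓝 c₀))
    (hd : Tendsto d l (𝓝 d₀)) (hz : Tendsto z l (𝓝 z₀)) (ha0 : z₀.re < a₀.re)
    (hb0 : z₀.re < b₀.re) (hc0 : z₀.re < c₀.re) (hd0 : z₀.re < d₀.re)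
    (ha1 : 0 < (a₀ + p₀ + z₀).re) (hb1 : 0 < (b₀ + p₀ + z₀).re) (hc1 : 0 < (c₀ + z₀).re)
    (hd1 : 0 < (d₀ + z₀).re) :
    ExpBd l (fun t x => hC (p t) (Γ t) (a t) (b t) (c t) (d t) (z t) (x * Complex.I))
      (fun t => 2 * ((a t + b t + c t + d t - p t - q t) / (p t * q t)).re) := by
  have hs : ExpBd l (fun t x => sn (p t) (2 * z t + 2 * (x * Complex.I)))
      (fun t => 2 * (1 / p t).re) := by
    simpa using ExpBd.sn hp hp0 (hz.const_mul 2) (m := 2) (by norm_num)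
  have hsub : ∀ {a₀ : ℂ}, z₀.re < a₀.re → 0 < (a₀ - z₀).re := fun h => by
    rw [Complex.sub_re]; linarith
  refine (hs.neg.mul
    (((ExpBd.gPair hΓ hp hq hp0 hq0 ((ha.add hp).add hz) (ha.sub hz) ha1 (hsub ha0)).mul
      (ExpBd.gPair hΓ hp hq hp0 hq0 ((hb.add hp).add hz) (hb.sub hz) hb1 (hsub hb0))).mul
      ((ExpBd.gPair hΓ hp hq hp0 hq0 (hc.add hz) (hc.sub hz) hc1 (hsub hc0)).mul
      (ExpBd.gPair hΓ hp hq hp0 hq0 (hd.add hz) (hd.sub hz) hd1 (hsub hd0))))).congr_rate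
    (Eventually.of_forall fun t => ?_)
  have e : (p t / (p t * q t)).re = (1 / q t).re := by
    rw [div_mul_cancel_left₀ (hΓ t).ne_left, one_div]
  have e' : (q t / (p t * q t)).re = (1 / p t).re := by
    rw [div_mul_cancel_right₀ (hΓ t).ne_right, one_div]
  simp only [add_div, Complex.add_re, sub_div, Complex.sub_re, e, e']
  ring

theorem expBd_qC (hΓ : ∀ t, ShiftedGamma (p t) (q t) (Γ t)) (hp : Tendsto p l (𝓝 p₀))
    (hq : Tendsto q l (𝓝 q₀)) (hp0 : 0 < p₀.re) (hq0 : 0 < q₀.re)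
    (hk : Tendsto k l (𝓝 k₀)) (hz : Tendsto z l (𝓝 z₀)) (hk0 : 0 < (k₀ - 2 * z₀).re)
    (hk1 : 0 < (k₀ + p₀ + 2 * z₀).re) :
    ExpBd l (fun t x => qC (p t) (Γ t) (k t) (z t) (x * Complex.I))
      (fun t => 2 * (k t / (p t * q t)).re) := by
  have hs : ExpBd l (fun t x => sn (p t) (2 * z t + x * Complex.I))
      (fun t => (1 / p t).re) := by
    simpa using ExpBd.sn hp hp0 (hz.const_mul 2) (m := 1) (by norm_num)
  refine (hs.neg.mul (ExpBd.gPair hΓ hp hq hp0 hq0 ((hk.add hp).add (hz.const_mul 2))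
    (hk.sub (hz.const_mul 2)) hk1 hk0)).congr_rate (Eventually.of_forall fun t => ?_)
  have e : (p t / (p t * q t)).re = (1 / q t).re := by
    rw [div_mul_cancel_left₀ (hΓ t).ne_left, one_div]
  have e' : (q t / (p t * q t)).re = (1 / p t).re := by
    rw [div_mul_cancel_right₀ (hΓ t).ne_right, one_div]
  simp only [add_div, Complex.add_re, sub_div, Complex.sub_re, e, e']
  ring

end bounds

end

section

theorem ae_linear_notMem {n : ℕ} (L : (Fin n → ℝ) →ₗ[ℝ] ℝ) (hL : L ≠ 0) {S : Set ℝ}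
    (hS : S.Countable) : ∀ᵐ v : Fin n → ℝ, L v ∉ S :=
  (ae_comp_linearMap_mem_iff L volume volume (LinearMap.surjective hL)
    hS.measurableSet.compl).2 (by simpa [ae_iff] using hS.measure_zero volume)

theorem ae_notMem_countable {n : ℕ} {S : Set ℝ} (hS : S.Countable) :
    ∀ᵐ v : Fin n → ℝ, (∀ i, v i ∉ S) ∧
      (∀ i j, i ≠ j → v i + v j ∉ S) ∧ ∀ i j, i ≠ j → v i - v j ∉ S := by
  have key : ∀ (L : (Fin n → ℝ) →ₗ[ℝ] ℝ) (i : Fin n), L (Pi.single i 1) ≠ 0 →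
      ∀ᵐ v : Fin n → ℝ, L v ∉ S := fun L i hi =>
    ae_linear_notMem L (fun h => hi (by rw [h]; rfl)) hS
  refine (ae_all_iff.2 fun i => key (LinearMap.proj i) i (by simp)).and ((ae_all_iff.2 fun i =>
    ae_all_iff.2 fun j => ?_).and (ae_all_iff.2 fun i => ae_all_iff.2 fun j => ?_))
  · by_cases hij : i = j
    · exact Eventually.of_forall fun v h => absurd hij h
    · filter_upwards [key ((LinearMap.proj i : (Fin n → ℝ) →ₗ[ℝ] ℝ) +
        LinearMap.proj j) i
        (by simp [Ne.symm hij])] with v hv _ using hv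
  · by_cases hij : i = j
    · exact Eventually.of_forall fun v h => absurd hij h
    · filter_upwards [key ((LinearMap.proj i : (Fin n → ℝ) →ₗ[ℝ] ℝ) -
        LinearMap.proj j) i
        (by simp [Ne.symm hij])] with v hv _ using hv

/-- Parameter domain of convergence. -/
structure KoornwinderDom (p q k a b c d : ℂ) : Prop where
  ha : 0 < a.re
  hb : 0 < b.re
  hc : 0 < c.re
  hd : 0 < d.re
  hk : 0 < k.re
  hk' : (k / (p * q)).re < 0
  hs : ((a + b + c + d - p - q) / (p * q)).re < 0

theorem differentiable_sn (q : ℂ) : Differentiable ℂ (sn q) := by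
  unfold sn
  fun_prop

theorem sn_neg (q x : ℂ) : sn q (-x) = -sn q x := by
  unfold sn
  rw [mul_neg, neg_div, Complex.sin_neg, mul_neg]

theorem sn_sub_self {q : ℂ} (hq : q ≠ 0) (x : ℂ) : sn q (x - q) = -sn q x := by
  unfold sn
  rw [mul_sub, sub_div, mul_div_assoc _ q, div_self hq, mul_one, Complex.sin_sub_pi, mul_neg]

theorem sn_mul_I_ne_zero {q : ℂ} (hq : 0 < q.re) {x : ℝ} (hx : x ≠ 0) :
    sn q (x * Complex.I) ≠ 0 := by
  have hq0 : q ≠ 0 := fun h => by simp [h] at hq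
  unfold sn
  refine mul_ne_zero two_ne_zero fun h => ?_
  obtain ⟨m, hm⟩ := Complex.sin_eq_zero_iff.1 h
  have hpi : (Real.pi : ℂ) ≠ 0 := Complex.ofReal_ne_zero.2 Real.pi_ne_zero
  rw [div_eq_iff hq0] at hm
  have h1 : (x : ℂ) * Complex.I = m * q := mul_left_cancel₀ hpi (by rw [hm]; ring)
  have h2 := congrArg Complex.re h1
  rw [Complex.re_ofReal_mul, Complex.I_re, mul_zero, ← Complex.ofReal_intCast,
    Complex.re_ofReal_mul] at h2
  rcases mul_eq_zero.1 h2.symm with h3 | h3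
  · rw [Int.cast_eq_zero] at h3
    simp [h3] at h1
    exact hx h1
  · exact hq.ne' h3

theorem gPair_neg (Γ : ℂ → ℂ) (U W ζ : ℂ) : gPair Γ U W (-ζ) = gPair Γ W U ζ := by
  unfold gPair
  rw [sub_neg_eq_add, mul_comm, ← sub_eq_add_neg]

theorem hW_neg (p q : ℂ) (Γ : ℂ → ℂ) (a b c d ζ : ℂ) :
    hW p q Γ a b c d (-ζ) = hW p q Γ a b c d ζ := by
  unfold hW
  simp only [gPair_neg, mul_neg, sn_neg, neg_mul, neg_neg]

theorem lW_neg (p q : ℂ) (Γ : ℂ → ℂ) (k x : ℂ) : lW p q Γ k (-x) = lW p q Γ k x := by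
  unfold lW
  simp only [gPair_neg, mul_neg, sn_neg, neg_mul, neg_neg]

theorem koornwinder_swap_mid (n : ℕ) (p q : ℂ) (Γ : ℂ → ℂ) (k a b c d : ℂ) :
    koornwinder n p q Γ k a b c d = koornwinder n p q Γ k a c b d := by
  unfold koornwinder hW
  simp only [mul_mul_mul_comm (gPair Γ a a _)]

theorem koornwinder_swap_pairs (n : ℕ) (p q : ℂ) (Γ : ℂ → ℂ) (k a b c d : ℂ) :
    koornwinder n p q Γ k a b c d = koornwinder n p q Γ k c d a b := by
  unfold koornwinder hW
  simp only [mul_comm (gPair Γ a a _ * _)]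

theorem koornwinder_comm (n : ℕ) (p q : ℂ) (Γ : ℂ → ℂ) (k a b c d : ℂ) :
    koornwinder n p q Γ k a b c d = koornwinder n q p Γ k a b c d := by
  unfold koornwinder hW lW
  simp only [mul_comm (sn p _)]

namespace ShiftedGamma

variable {p q : ℂ} {Γ : ℂ → ℂ}

theorem differentiableAt_gPair (h : ShiftedGamma p q Γ) {U W Z : ℂ → ℂ} {z : ℂ}
    (hU : DifferentiableAt ℂ U z) (hW : DifferentiableAt ℂ W z) (hZ : DifferentiableAt ℂ Z z)
    (h1 : 0 < (U z + Z z).re) (h2 : 0 < (W z - Z z).re) :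
    DifferentiableAt ℂ (fun z => gPair Γ (U z) (W z) (Z z)) z :=
  ((h.differentiableAt h1).comp z (hU.add hZ)).mul ((h.differentiableAt h2).comp z (hW.sub hZ))

theorem differentiableAt_hW (h : ShiftedGamma p q Γ) {a b c d Z : ℂ → ℂ} {z : ℂ}
    (ha : DifferentiableAt ℂ a z) (hb : DifferentiableAt ℂ b z) (hc : DifferentiableAt ℂ c z)
    (hd : DifferentiableAt ℂ d z) (hZ : DifferentiableAt ℂ Z z) (hZ0 : (Z z).re = 0)
    (ha0 : 0 < (a z).re) (hb0 : 0 < (b z).re) (hc0 : 0 < (c z).re) (hd0 : 0 < (d z).re) :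
    DifferentiableAt ℂ (fun z => hW p q Γ (a z) (b z) (c z) (d z) (Z z)) z := by
  have hg : ∀ {a : ℂ → ℂ}, DifferentiableAt ℂ a z → 0 < (a z).re →
      DifferentiableAt ℂ (fun z => gPair Γ (a z) (a z) (Z z)) z := fun ha ha0 =>
    h.differentiableAt_gPair ha ha hZ (by simpa [hZ0] using ha0) (by simpa [hZ0] using ha0)
  have hs : ∀ r : ℂ, DifferentiableAt ℂ (fun z => sn r (2 * Z z)) z := fun r =>
    (differentiable_sn r _).comp z (hZ.const_mul 2)
  exact ((hs p).mul (hs q)).neg.mul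
    (((hg ha ha0).mul (hg hb hb0)).mul ((hg hc hc0).mul (hg hd hd0)))

theorem continuous_hW (h : ShiftedGamma p q Γ) {a b c d : ℂ}
    (ha0 : 0 < a.re) (hb0 : 0 < b.re) (hc0 : 0 < c.re) (hd0 : 0 < d.re) :
    Continuous fun x : ℝ => hW p q Γ a b c d (x * Complex.I) := by
  refine continuous_iff_continuousAt.2 fun x => ?_
  exact (h.differentiableAt_hW (a := fun _ => a) (b := fun _ => b) (c := fun _ => c)
    (d := fun _ => d) (Z := fun ζ => ζ) (z := x * Complex.I) (by fun_prop) (by fun_prop)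
    (by fun_prop) (by fun_prop) (by fun_prop) (by simp) ha0 hb0 hc0 hd0).continuousAt.comp
    (f := fun x : ℝ => (x : ℂ) * Complex.I) (by fun_prop)

theorem differentiableAt_lW (h : ShiftedGamma p q Γ) {k Z : ℂ → ℂ} {z : ℂ}
    (hk : DifferentiableAt ℂ k z) (hZ : DifferentiableAt ℂ Z z) (hZ0 : (Z z).re = 0)
    (hk0 : 0 < (k z).re) :
    DifferentiableAt ℂ (fun z => lW p q Γ (k z) (Z z)) z := by
  have hs : ∀ r : ℂ, DifferentiableAt ℂ (fun z => sn r (Z z)) z := fun r =>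
    (differentiable_sn r _).comp z hZ
  exact ((hs p).mul (hs q)).neg.mul
    (h.differentiableAt_gPair hk hk hZ (by simpa [hZ0] using hk0) (by simpa [hZ0] using hk0))

theorem continuous_lW (h : ShiftedGamma p q Γ) {k : ℂ} (hk0 : 0 < k.re) :
    Continuous fun x : ℝ => lW p q Γ k (x * Complex.I) := by
  refine continuous_iff_continuousAt.2 fun x => ?_
  exact (h.differentiableAt_lW (k := fun _ => k) (Z := fun ζ => ζ) (z := x * Complex.I)
    (by fun_prop) (by fun_prop) (by simp) hk0).continuousAt.comp
    (f := fun x : ℝ => (x : ℂ) * Complex.I) (by fun_prop)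

theorem differentiableAt_hC (h : ShiftedGamma p q Γ) {a b c d : ℂ} {y Z : ℂ → ℂ} {z : ℂ}
    (hy : DifferentiableAt ℂ y z) (hZ : DifferentiableAt ℂ Z z) (hZ0 : (Z z).re = 0)
    (ha0 : (y z).re < a.re) (hb0 : (y z).re < b.re) (hc0 : (y z).re < c.re)
    (hd0 : (y z).re < d.re) (ha1 : 0 < (a + p + y z).re) (hb1 : 0 < (b + p + y z).re)
    (hc1 : 0 < (c + y z).re) (hd1 : 0 < (d + y z).re) :
    DifferentiableAt ℂ (fun z => hC p Γ a b c d (y z) (Z z)) z := by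
  have hg : ∀ {a e : ℂ}, (y z).re < a.re → 0 < (e + y z).re →
      DifferentiableAt ℂ (fun z => gPair Γ (e + y z) (a - y z) (Z z)) z := fun ha0 ha1 =>
    h.differentiableAt_gPair (hy.const_add _) (hy.const_sub _) hZ
      (by simpa [hZ0] using ha1) (by simpa [hZ0] using ha0)
  have hs : DifferentiableAt ℂ (fun z => sn p (2 * y z + 2 * Z z)) z :=
    (differentiable_sn p _).comp z ((hy.const_mul 2).add (hZ.const_mul 2))
  exact hs.neg.mul
    (((hg ha0 ha1).mul (hg hb0 hb1)).mul ((hg hc0 hc1).mul (hg hd0 hd1)))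

theorem differentiableAt_qC (h : ShiftedGamma p q Γ) {k : ℂ} {y Z : ℂ → ℂ} {z : ℂ}
    (hy : DifferentiableAt ℂ y z) (hZ : DifferentiableAt ℂ Z z) (hZ0 : (Z z).re = 0)
    (hk0 : 0 < (k - 2 * y z).re) (hk1 : 0 < (k + p + 2 * y z).re) :
    DifferentiableAt ℂ (fun z => qC p Γ k (y z) (Z z)) z := by
  have hs : DifferentiableAt ℂ (fun z => sn p (2 * y z + Z z)) z :=
    (differentiable_sn p _).comp z ((hy.const_mul 2).add hZ)
  exact hs.neg.mul (h.differentiableAt_gPair ((hy.const_mul 2).const_add _)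
    ((hy.const_mul 2).const_sub _) hZ (by simpa [hZ0] using hk1) (by simpa [hZ0] using hk0))

theorem continuous_hC (h : ShiftedGamma p q Γ) {a b c d z : ℂ}
    (ha0 : z.re < a.re) (hb0 : z.re < b.re) (hc0 : z.re < c.re)
    (hd0 : z.re < d.re) (ha1 : 0 < (a + p + z).re) (hb1 : 0 < (b + p + z).re)
    (hc1 : 0 < (c + z).re) (hd1 : 0 < (d + z).re) :
    Continuous fun x : ℝ => hC p Γ a b c d z (x * Complex.I) := by
  refine continuous_iff_continuousAt.2 fun x => ?_
  exact (h.differentiableAt_hC (y := fun _ => z) (Z := fun ζ => ζ) (z := x * Complex.I)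
    (by fun_prop) (by fun_prop) (by simp) ha0 hb0 hc0 hd0 ha1 hb1 hc1 hd1).continuousAt.comp
    (f := fun x : ℝ => (x : ℂ) * Complex.I) (by fun_prop)

theorem continuous_qC (h : ShiftedGamma p q Γ) {k z : ℂ}
    (hk0 : 0 < (k - 2 * z).re) (hk1 : 0 < (k + p + 2 * z).re) :
    Continuous fun x : ℝ => qC p Γ k z (x * Complex.I) := by
  refine continuous_iff_continuousAt.2 fun x => ?_
  exact (h.differentiableAt_qC (y := fun _ => z) (Z := fun ζ => ζ) (z := x * Complex.I)
    (by fun_prop) (by fun_prop) (by simp) hk0 hk1).continuousAt.comp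
    (f := fun x : ℝ => (x : ℂ) * Complex.I) (by fun_prop)

end ShiftedGamma

section families

variable {Λ : Type*} {l : Filter Λ} {p q k a b c d : Λ → ℂ} {Γ : Λ → ℂ → ℂ}
  {p₀ q₀ k₀ a₀ b₀ c₀ d₀ : ℂ} {Γ₀ : ℂ → ℂ}

theorem tendsto_two_mul_re {f g : Λ → ℂ} {f₀ g₀ : ℂ} (hf : Tendsto f l (𝓝 f₀))
    (hg : Tendsto g l (𝓝 g₀)) (h0 : g₀ ≠ 0) :
    Tendsto (fun t => 2 * (f t / g t).re) l (𝓝 (2 * (f₀ / g₀).re)) :=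
  ((Complex.continuous_re.tendsto _).comp (Tendsto.div hf hg h0)).const_mul 2

theorem koornwinder_dominate (hΓ : ∀ t, ShiftedGamma (p t) (q t) (Γ t)) (hp : Tendsto p l (𝓝 p₀))
    (hq : Tendsto q l (𝓝 q₀)) (hp0 : 0 < p₀.re) (hq0 : 0 < q₀.re) (hk : Tendsto k l (𝓝 k₀))
    (ha : Tendsto a l (𝓝 a₀)) (hb : Tendsto b l (𝓝 b₀)) (hc : Tendsto c l (𝓝 c₀))
    (hd : Tendsto d l (𝓝 d₀)) (h : KoornwinderDom p₀ q₀ k₀ a₀ b₀ c₀ d₀) :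
    ∃ C e : ℝ, 0 < e ∧ ∀ᶠ t in l, ∀ x : ℝ,
      ‖hW (p t) (q t) (Γ t) (a t) (b t) (c t) (d t) (x * Complex.I)‖ ≤ C * Real.exp (-e * |x|) ∧
      ‖lW (p t) (q t) (Γ t) (k t) (x * Complex.I)‖ ≤ C ∧
      ‖lW (p t) (q t) (Γ t) (k t) (x * Complex.I)‖ ≤ C := by
  have hpq : p₀ * q₀ ≠ 0 := mul_ne_zero (fun h => by simp [h] at hp0) (fun h => by simp [h] at hq0)
  have hl := expBd_lW hΓ hp hq hp0 hq0 hk h.hk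
  have hl' := tendsto_two_mul_re hk (hp.mul hq) hpq
  have hk' := h.hk'
  have hs' := h.hs
  exact (expBd_hW hΓ hp hq hp0 hq0 ha hb hc hd h.ha h.hb h.hc h.hd).dominate hl hl
    (tendsto_two_mul_re (((((ha.add hb).add hc).add hd).sub hp).sub hq) (hp.mul hq) hpq)
    (by linarith) hl' (by linarith) hl' (by linarith)

theorem tendsto_koornwinder [l.IsCountablyGenerated] (n : ℕ)
    (hΓ : ∀ t, ShiftedGamma (p t) (q t) (Γ t)) (hΓ₀ : ShiftedGamma p₀ q₀ Γ₀)
    (hp : Tendsto p l (𝓝 p₀)) (hq : Tendsto q l (𝓝 q₀)) (hk : Tendsto k l (𝓝 k₀))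
    (ha : Tendsto a l (𝓝 a₀)) (hb : Tendsto b l (𝓝 b₀)) (hc : Tendsto c l (𝓝 c₀))
    (hd : Tendsto d l (𝓝 d₀)) (h : KoornwinderDom p₀ q₀ k₀ a₀ b₀ c₀ d₀) :
    Tendsto (fun t => koornwinder n (p t) (q t) (Γ t) (k t) (a t) (b t) (c t) (d t)) l
      (𝓝 (koornwinder n p₀ q₀ Γ₀ k₀ a₀ b₀ c₀ d₀)) := by
  have hre : ∀ {a : Λ → ℂ} {a₀ : ℂ}, Tendsto a l (𝓝 a₀) → 0 < a₀.re → ∀ᶠ t in l, 0 < (a t).re :=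
    fun ha ha0 => ((Complex.continuous_re.tendsto _).comp ha).eventually_const_lt ha0
  have hg : ∀ {a : Λ → ℂ} {a₀ : ℂ}, Tendsto a l (𝓝 a₀) → 0 < a₀.re → ∀ x : ℝ,
      Tendsto (fun t => gPair (Γ t) (a t) (a t) (x * Complex.I)) l
        (𝓝 (gPair Γ₀ a₀ a₀ (x * Complex.I))) := fun ha ha0 x =>
    (ShiftedGamma.tendsto_of_tendsto hΓ hΓ₀ hp hq (ha.add_const _) (by simpa using ha0)).mul
      (ShiftedGamma.tendsto_of_tendsto hΓ hΓ₀ hp hq (ha.sub_const _) (by simpa using ha0))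
  have hsn : ∀ {p : Λ → ℂ} {p₀ : ℂ}, Tendsto p l (𝓝 p₀) → p₀ ≠ 0 → ∀ y : ℂ,
      Tendsto (fun t => sn (p t) y) l (𝓝 (sn p₀ y)) := fun hp hp0 y =>
    ((Complex.continuous_sin.tendsto _).comp
      (Tendsto.div tendsto_const_nhds hp hp0)).const_mul 2
  have hl : ∀ x : ℝ, Tendsto (fun t => lW (p t) (q t) (Γ t) (k t) (x * Complex.I)) l
      (𝓝 (lW p₀ q₀ Γ₀ k₀ (x * Complex.I))) := fun x =>
    ((hsn hp hΓ₀.ne_left _).mul (hsn hq hΓ₀.ne_right _)).neg.mul (hg hk h.hk x)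
  refine tendsto_integral_wt ?_ (fun x => ?_) hl hl
    (koornwinder_dominate hΓ hp hq hΓ₀.re_left hΓ₀.re_right hk ha hb hc hd h)
  · filter_upwards [hre ha h.ha, hre hb h.hb, hre hc h.hc, hre hd h.hd, hre hk h.hk]
      with t h1 h2 h3 h4 h5
    exact ⟨((hΓ t).continuous_hW h1 h2 h3 h4).measurable, ((hΓ t).continuous_lW h5).measurable,
      ((hΓ t).continuous_lW h5).measurable⟩
  · exact ((hsn hp hΓ₀.ne_left _).mul (hsn hq hΓ₀.ne_right _)).neg.mul
      (((hg ha h.ha x).mul (hg hb h.hb x)).mul ((hg hc h.hc x).mul (hg hd h.hd x)))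

end families

section fixed

variable {p q : ℂ} {Γ : ℂ → ℂ}

theorem integrable_koornwinder (hΓ : ShiftedGamma p q Γ) (n : ℕ) {k a b c d : ℂ}
    (h : KoornwinderDom p q k a b c d) :
    Integrable (wt (fun x => hW p q Γ a b c d (x * Complex.I))
      (fun x => lW p q Γ k (x * Complex.I)) (fun x => lW p q Γ k (x * Complex.I)) :
      (Fin n → ℝ) → ℂ) := by
  obtain ⟨C, e, he, hb⟩ := koornwinder_dominate (l := (pure () : Filter Unit))
    (p := fun _ => p) (q := fun _ => q) (k := fun _ => k) (a := fun _ => a) (b := fun _ => b)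
    (c := fun _ => c) (d := fun _ => d) (Γ := fun _ => Γ) (fun _ => hΓ) tendsto_const_nhds
    tendsto_const_nhds hΓ.re_left hΓ.re_right tendsto_const_nhds tendsto_const_nhds
    tendsto_const_nhds tendsto_const_nhds tendsto_const_nhds h
  rw [eventually_pure] at hb
  exact integrable_wt he (hΓ.continuous_hW h.ha h.hb h.hc h.hd) (hΓ.continuous_lW h.hk)
    (hΓ.continuous_lW h.hk) (fun x => (hb x).1) (fun x => (hb x).2.1) (fun x => (hb x).2.2)

theorem differentiableOn_koornwinder (hΓ : ShiftedGamma p q Γ) (n : ℕ) {k : ℂ} {a b c d : ℂ → ℂ}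
    {U : Set ℂ} (hU : IsOpen U) (ha : Differentiable ℂ a) (hb : Differentiable ℂ b)
    (hc : Differentiable ℂ c) (hd : Differentiable ℂ d)
    (h : ∀ z ∈ U, KoornwinderDom p q k (a z) (b z) (c z) (d z)) :
    DifferentiableOn ℂ (fun z => koornwinder n p q Γ k (a z) (b z) (c z) (d z)) U :=
  differentiableOn_integral_wt hU
    (fun z hz => hΓ.continuous_hW (h z hz).ha (h z hz).hb (h z hz).hc (h z hz).hd)
    (fun z hz => hΓ.continuous_lW (h z hz).hk) (fun z hz => hΓ.continuous_lW (h z hz).hk)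
    (fun x z hz => (hΓ.differentiableAt_hW (ha z) (hb z) (hc z) (hd z)
      (differentiableAt_const _) (by simp) (h z hz).ha (h z hz).hb (h z hz).hc
      (h z hz).hd).differentiableWithinAt)
    (fun x => differentiableOn_const _) (fun x => differentiableOn_const _)
    (fun z hz => koornwinder_dominate (l := 𝓝 z) (p := fun _ => p) (q := fun _ => q)
      (k := fun _ => k) (Γ := fun _ => Γ) (fun _ => hΓ) tendsto_const_nhds
      tendsto_const_nhds hΓ.re_left hΓ.re_right tendsto_const_nhds (ha z).continuousAt
      (hb z).continuousAt (hc z).continuousAt (hd z).continuousAt (h z hz))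

end fixed

end

section

/-- Integral over the contour shifted by `z`. -/
def contour (n : ℕ) (p q : ℂ) (Γ : ℂ → ℂ) (k a b c d z : ℂ) : ℂ :=
  ∫ v : Fin n → ℝ, wt (fun x => hC p Γ a b c d z (x * Complex.I))
    (fun x => qC p Γ k z (x * Complex.I)) (fun x => lW p q Γ k (x * Complex.I)) v

/-- Conditions on `z` ensuring that the shifted contour stays in the domain. -/
structure ContourDom (p k a b c d z : ℂ) : Prop where
  ha : z.re < a.re
  hb : z.re < b.re
  hc : z.re < c.re
  hd : z.re < d.re
  ha' : 0 < (a + p + z).re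
  hb' : 0 < (b + p + z).re
  hc' : 0 < (c + z).re
  hd' : 0 < (d + z).re
  hk : 0 < (k - 2 * z).re
  hk' : 0 < (k + p + 2 * z).re

section

variable {p q k a b c d : ℂ} {Γ : ℂ → ℂ}

theorem contour_dominate (hΓ : ShiftedGamma p q Γ) (h : KoornwinderDom p q k a b c d) {z : ℂ}
    (hz : ContourDom p k a b c d z) :
    ∃ C e : ℝ, 0 < e ∧ ∀ᶠ z in 𝓝 z, ∀ x : ℝ,
      ‖hC p Γ a b c d z (x * Complex.I)‖ ≤ C * Real.exp (-e * |x|) ∧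
      ‖qC p Γ k z (x * Complex.I)‖ ≤ C ∧ ‖lW p q Γ k (x * Complex.I)‖ ≤ C := by
  have hpq : p * q ≠ 0 := mul_ne_zero hΓ.ne_left hΓ.ne_right
  have hk' := h.hk'
  have hs' := h.hs
  exact (expBd_hC (l := 𝓝 z) (p := fun _ => p) (q := fun _ => q) (Γ := fun _ => Γ)
      (a := fun _ => a) (b := fun _ => b) (c := fun _ => c) (d := fun _ => d) (z := fun z => z)
      (fun _ => hΓ) tendsto_const_nhds
      tendsto_const_nhds hΓ.re_left hΓ.re_right tendsto_const_nhds tendsto_const_nhds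
      tendsto_const_nhds tendsto_const_nhds tendsto_id hz.ha hz.hb hz.hc hz.hd hz.ha' hz.hb'
      hz.hc' hz.hd').dominate
    (expBd_qC (l := 𝓝 z) (p := fun _ => p) (q := fun _ => q) (Γ := fun _ => Γ)
      (k := fun _ => k) (z := fun z => z)
      (fun _ => hΓ) tendsto_const_nhds tendsto_const_nhds hΓ.re_left hΓ.re_right
      tendsto_const_nhds tendsto_id hz.hk hz.hk')
    (expBd_lW (l := 𝓝 z) (p := fun _ => p) (q := fun _ => q) (Γ := fun _ => Γ)
      (k := fun _ => k) (fun _ => hΓ) tendsto_const_nhds tendsto_const_nhds hΓ.re_left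
      hΓ.re_right tendsto_const_nhds h.hk)
    tendsto_const_nhds (by linarith) tendsto_const_nhds (by linarith)
    tendsto_const_nhds (by linarith)

theorem differentiableOn_contour (hΓ : ShiftedGamma p q Γ) (n : ℕ)
    (h : KoornwinderDom p q k a b c d) {U : Set ℂ} (hU : IsOpen U)
    (hz : ∀ z ∈ U, ContourDom p k a b c d z) :
    DifferentiableOn ℂ (contour n p q Γ k a b c d) U :=
  differentiableOn_integral_wt hU
    (fun z hzU => hΓ.continuous_hC (hz z hzU).ha (hz z hzU).hb (hz z hzU).hc (hz z hzU).hd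
      (hz z hzU).ha' (hz z hzU).hb' (hz z hzU).hc' (hz z hzU).hd')
    (fun z hzU => hΓ.continuous_qC (hz z hzU).hk (hz z hzU).hk')
    (fun _ _ => hΓ.continuous_lW h.hk)
    (fun x z hzU => (hΓ.differentiableAt_hC differentiableAt_id (differentiableAt_const _)
      (by simp) (hz z hzU).ha (hz z hzU).hb (hz z hzU).hc (hz z hzU).hd (hz z hzU).ha'
      (hz z hzU).hb' (hz z hzU).hc' (hz z hzU).hd').differentiableWithinAt)
    (fun x z hzU => (hΓ.differentiableAt_qC differentiableAt_id (differentiableAt_const _)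
      (by simp) (hz z hzU).hk (hz z hzU).hk').differentiableWithinAt)
    (fun x => differentiableOn_const _)
    (fun z hzU => contour_dominate hΓ h (hz z hzU))

theorem contour_add_mul_I (n : ℕ) (z : ℂ) (s : ℝ) :
    contour n p q Γ k a b c d (z + s * Complex.I) = contour n p q Γ k a b c d z := by
  unfold contour
  symm
  rw [← integral_add_right_eq_self _ (fun _ => s : Fin n → ℝ)]
  refine integral_congr_ae (Eventually.of_forall fun v => ?_)
  have e1 : ∀ x : ℝ, hC p Γ a b c d (z + s * Complex.I) (x * Complex.I) =
      hC p Γ a b c d z ((x + s : ℝ) * Complex.I) := fun x => by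
    simp only [hC, gPair]
    push_cast
    ring_nf
  have e2 : ∀ x : ℝ, qC p Γ k (z + s * Complex.I) (x * Complex.I) =
      qC p Γ k z ((x + 2 * s : ℝ) * Complex.I) := fun x => by
    simp only [qC, gPair]
    push_cast
    ring_nf
  simp only [wt, Pi.add_apply, e1, e2]
  congr 1
  refine Finset.prod_congr rfl fun (x : Fin n × Fin n) _ => ?_
  rw [show v x.1 + s + (v x.2 + s) = v x.1 + v x.2 + 2 * s by ring, add_sub_add_right_eq_sub]

theorem deriv_contour_eq_zero (hΓ : ShiftedGamma p q Γ) (n : ℕ)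
    (h : KoornwinderDom p q k a b c d) {U : Set ℂ} (hU : IsOpen U)
    (hz : ∀ z ∈ U, ContourDom p k a b c d z) {z : ℂ} (hzU : z ∈ U) :
    deriv (contour n p q Γ k a b c d) z = 0 := by
  have h1 : HasDerivAt (contour n p q Γ k a b c d) (deriv (contour n p q Γ k a b c d) z)
      (z + ((0 : ℝ) : ℂ) * Complex.I) := by
    simpa using ((differentiableOn_contour hΓ n h hU hz).differentiableAt
      (hU.mem_nhds hzU)).hasDerivAt
  have h2 : HasDerivAt (fun s : ℝ => z + (s : ℂ) * Complex.I) Complex.I 0 := by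
    simpa using ((Complex.ofRealCLM.hasDerivAt (x := (0 : ℝ))).mul_const Complex.I).const_add z
  have h3 := h1.comp (0 : ℝ) h2
  have h4 : contour n p q Γ k a b c d ∘ (fun s : ℝ => z + (s : ℂ) * Complex.I) =
      fun _ => contour n p q Γ k a b c d z := funext fun s => contour_add_mul_I n z s
  rw [h4] at h3
  have h5 := h3.unique (hasDerivAt_const (0 : ℝ) (contour n p q Γ k a b c d z))
  exact (mul_eq_zero.1 h5).resolve_right Complex.I_ne_zero

theorem contour_zero_eq (hΓ : ShiftedGamma p q Γ) (n : ℕ)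
    (h : KoornwinderDom p q k a b c d) (hc : p.re / 2 < c.re) (hd : p.re / 2 < d.re) :
    contour n p q Γ k a b c d 0 = contour n p q Γ k a b c d (-p / 2) := by
  have hp := hΓ.re_left
  obtain ⟨δ, hδ, hδa, hδb, hδc, hδd, hδk⟩ : ∃ δ : ℝ, 0 < δ ∧ δ < a.re ∧ δ < b.re ∧
      δ < c.re - p.re / 2 ∧ δ < d.re - p.re / 2 ∧ 2 * δ < k.re := by
    have h0 : 0 < min (min a.re b.re) (min (min (c.re - p.re / 2) (d.re - p.re / 2))
        (k.re / 2)) := lt_min (lt_min h.ha h.hb) (lt_min (lt_min (by linarith) (by linarith))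
          (by linarith [h.hk]))
    obtain ⟨δ, h1, h2⟩ := exists_between h0
    simp only [lt_min_iff] at h2
    exact ⟨δ, h1, h2.1.1, h2.1.2, h2.2.1.1, h2.2.1.2, by linarith [h2.2.2]⟩
  set U : Set ℂ := Complex.re ⁻¹' Ioo (-p.re / 2 - δ) δ with hUdef
  have hU : IsOpen U := isOpen_Ioo.preimage Complex.continuous_re
  have hUc : IsPreconnected U :=
    ((convex_Ioo _ _).linear_preimage Complex.reLm).isPreconnected
  have hz : ∀ z ∈ U, ContourDom p k a b c d z := by
    rintro z ⟨h1, h2⟩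
    constructor <;> (try simp only [Complex.add_re, Complex.sub_re, Complex.mul_re,
      Complex.re_ofNat, Complex.im_ofNat]) <;> linarith
  refine hU.is_const_of_deriv_eq_zero hUc (differentiableOn_contour hΓ n h hU hz)
    (fun z hzU => deriv_contour_eq_zero hΓ n h hU hz hzU) ?_ ?_
  · simp only [hUdef, mem_preimage, Complex.zero_re, mem_Ioo]
    constructor <;> linarith
  · have : (-p / 2).re = -p.re / 2 := by simp
    simp only [hUdef, mem_preimage, this, mem_Ioo]
    constructor <;> linarith

theorem contour_neg_half (hp : p ≠ 0) (n : ℕ) :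
    contour n p q Γ k a b c d (-p / 2) =
      contour n p q Γ k (c - p / 2) (d - p / 2) (a + p / 2) (b + p / 2) 0 := by
  unfold contour
  rw [← integral_neg_eq_self]
  refine integral_congr_ae (Eventually.of_forall fun v => ?_)
  have e1 : ∀ x : ℝ, hC p Γ a b c d (-p / 2) ((-x : ℝ) * Complex.I) =
      hC p Γ (c - p / 2) (d - p / 2) (a + p / 2) (b + p / 2) 0 (x * Complex.I) := fun x => by
    have hs : -sn p (2 * (-p / 2) + 2 * ((-x : ℝ) * Complex.I)) =
        -sn p (2 * 0 + 2 * (x * Complex.I)) := by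
      rw [show (2 * (-p / 2) + 2 * ((-x : ℝ) * Complex.I) : ℂ) = -(2 * (x * Complex.I)) - p by
        push_cast; ring, sn_sub_self hp, sn_neg]
      simp
    rw [hC, hs, hC]
    simp only [gPair]
    push_cast
    ring_nf
  have e2 : ∀ x : ℝ, qC p Γ k (-p / 2) ((-x : ℝ) * Complex.I) =
      qC p Γ k 0 (x * Complex.I) := fun x => by
    have hs : -sn p (2 * (-p / 2) + (-x : ℝ) * Complex.I) =
        -sn p (2 * 0 + x * Complex.I) := by
      rw [show (2 * (-p / 2) + (-x : ℝ) * Complex.I : ℂ) = -(x * Complex.I) - p by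
        push_cast; ring, sn_sub_self hp, sn_neg]
      simp
    rw [qC, hs, qC]
    simp only [gPair]
    push_cast
    ring_nf
  have e3 : ∀ x : ℝ, lW p q Γ k ((-x : ℝ) * Complex.I) = lW p q Γ k (x * Complex.I) := fun x => by
    rw [Complex.ofReal_neg, neg_mul, lW_neg]
  simp only [wt, Pi.neg_apply]
  simp only [← neg_add, neg_sub_neg, e1, e2]
  congr 1
  refine Finset.prod_congr rfl fun x _ => ?_
  rw [← neg_sub, e3]

theorem measurePreserving_signFlip {n : ℕ} (σ : Fin n → Bool) :
    MeasurePreserving (signFlip σ : (Fin n → ℝ) → Fin n → ℝ) := by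
  refine volume_preserving_pi (f := fun i (x : ℝ) => if σ i then -x else x) fun i => ?_
  by_cases h : σ i = true
  · simpa [h] using Measure.measurePreserving_neg (volume : Measure ℝ)
  · simp only [h]
    exact MeasurePreserving.id (volume : Measure ℝ)

theorem koornwinder_weight_signFlip {n : ℕ} (σ : Fin n → Bool) (v : Fin n → ℝ) {h ℓ : ℝ → ℂ}
    (hh : ∀ x, h (-x) = h x) (hℓ : ∀ x, ℓ (-x) = ℓ x) :
    wt h ℓ ℓ (signFlip σ v) = wt h ℓ ℓ v := by
  unfold wt signFlip
  congr 1
  · refine Finset.prod_congr rfl fun i _ => ?_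
    split_ifs <;> simp only [hh]
  · refine Finset.prod_congr rfl fun x _ => ?_
    rcases σ x.1 <;> rcases σ x.2 <;> simp only [if_true, Bool.false_eq_true, if_false]
    · rw [sub_neg_eq_add, ← sub_eq_add_neg, mul_comm]
    · rw [neg_add_eq_sub, ← neg_sub, hℓ, ← neg_add', hℓ, mul_comm]
    · rw [← neg_add, hℓ, neg_sub_neg, ← neg_sub, hℓ]

theorem contour_integrand_eq (hΓ : ShiftedGamma p q Γ) {n : ℕ}
    (h : KoornwinderDom p q k a b c d) {v : Fin n → ℝ} (h0 : ∀ i, v i ≠ 0)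
    (hadd : ∀ i j, i ≠ j → v i + v j ≠ 0) :
    wt (fun x => hC p Γ a b c d 0 (x * Complex.I)) (fun x => qC p Γ k 0 (x * Complex.I))
      (fun x => lW p q Γ k (x * Complex.I)) v =
    weylCoeff q a b k (fun i => v i * Complex.I) *
      wt (fun x => hW p q Γ a b c d (x * Complex.I)) (fun x => lW p q Γ k (x * Complex.I))
        (fun x => lW p q Γ k (x * Complex.I)) v := by
  have hq := hΓ.re_right
  have hre : ∀ {a : ℂ} (x : ℝ), 0 < a.re → 0 < (a + x * Complex.I).re := fun x ha => by
    simpa using ha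
  have e1 : ∀ x : ℝ, x ≠ 0 → hC p Γ a b c d 0 (x * Complex.I) =
      sn q (a + x * Complex.I) * sn q (b + x * Complex.I) / sn q (2 * (x * Complex.I)) *
        hW p q Γ a b c d (x * Complex.I) := fun x hx => by
    have h2 : sn q (2 * (x * Complex.I)) ≠ 0 := by
      have := sn_mul_I_ne_zero hq (mul_ne_zero two_ne_zero hx)
      rwa [Complex.ofReal_mul, mul_assoc] at this
    have g : ∀ {a : ℂ}, 0 < a.re → gPair Γ (a + p + 0) (a - 0) (x * Complex.I) =
        sn q (a + x * Complex.I) * gPair Γ a a (x * Complex.I) := fun ha => by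
      rw [gPair, gPair, sub_zero, add_zero, add_right_comm, hΓ.add_left (hre x ha), sn, mul_assoc]
    rw [hC, hW, g h.ha, g h.hb, div_mul_eq_mul_div, eq_div_iff h2]
    simp only [mul_zero, zero_add, add_zero, sub_zero]
    ring
  have e2 : ∀ x : ℝ, x ≠ 0 → qC p Γ k 0 (x * Complex.I) =
      sn q (k + x * Complex.I) / sn q (x * Complex.I) * lW p q Γ k (x * Complex.I) :=
    fun x hx => by
    have h2 := sn_mul_I_ne_zero hq hx
    rw [qC, lW, gPair, gPair, mul_zero, sub_zero, add_zero, zero_add, add_right_comm,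
      hΓ.add_left (hre x h.hk), div_mul_eq_mul_div, eq_div_iff h2]
    unfold sn
    ring
  unfold wt weylCoeff
  rw [mul_mul_mul_comm, ← Finset.prod_mul_distrib, ← Finset.prod_mul_distrib]
  congr 1
  · exact Finset.prod_congr rfl fun i _ => e1 _ (h0 i)
  · refine Finset.prod_congr rfl fun x hx => ?_
    simp only []
    rw [e2 _ (hadd _ _ (Finset.mem_filter.1 hx).2.ne), Complex.ofReal_add, add_mul, mul_assoc]

theorem two_pow_mul_contour (hΓ : ShiftedGamma p q Γ) (n : ℕ)
    (h : KoornwinderDom p q k a b c d) :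
    2 ^ n * contour n p q Γ k a b c d 0 =
      (∏ j ∈ Finset.range n, sn q (a + b + j * k)) * koornwinder n p q Γ k a b c d := by
  have hp := hΓ.re_left
  have hq := hΓ.re_right
  set f : (Fin n → ℝ) → ℂ := wt (fun x => hC p Γ a b c d 0 (x * Complex.I))
    (fun x => qC p Γ k 0 (x * Complex.I)) (fun x => lW p q Γ k (x * Complex.I)) with hf
  have hdom : ContourDom p k a b c d 0 := by
    have := h.ha; have := h.hb; have := h.hc; have := h.hd; have := h.hk
    constructor <;> simp <;> linarith
  obtain ⟨C, e, he, hbd⟩ := contour_dominate hΓ h hdom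
  have hbd := hbd.self_of_nhds
  have hfi : Integrable f := integrable_wt he (hΓ.continuous_hC hdom.ha hdom.hb hdom.hc hdom.hd
      hdom.ha' hdom.hb' hdom.hc' hdom.hd') (hΓ.continuous_qC hdom.hk hdom.hk')
      (hΓ.continuous_lW h.hk) (fun x => (hbd x).1) (fun x => (hbd x).2.1) (fun x => (hbd x).2.2)
  have hflip : ∀ σ : Fin n → Bool, Integrable (fun v => f (signFlip σ v)) := fun σ =>
    (measurePreserving_signFlip σ).integrable_comp_of_integrable hfi
  have hinv : ∀ σ : Fin n → Bool, ∫ v, f (signFlip σ v) = ∫ v, f v := fun σ => by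
    have hm := measurePreserving_signFlip σ
    have := integral_map (μ := volume) (f := f) hm.measurable.aemeasurable
      (by rw [hm.map_eq]; exact hfi.aestronglyMeasurable)
    rw [← this, hm.map_eq]
  have hsum : ∫ v, ∑ σ : Fin n → Bool, f (signFlip σ v) = 2 ^ n * ∫ v, f v := by
    rw [integral_finsetSum _ fun σ _ => hflip σ, Finset.sum_congr rfl fun σ _ => hinv σ]
    simp
  change 2 ^ n * ∫ v, f v = _
  rw [← hsum, koornwinder, ← integral_const_mul]
  refine integral_congr_ae ?_
  filter_upwards [ae_notMem_countable (n := n) (countable_singleton (0 : ℝ))] with v hv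
  simp only [mem_singleton_iff] at hv
  obtain ⟨h0, hadd, hsub⟩ := hv
  have hs0 : ∀ (σ : Fin n → Bool) i, signFlip σ v i ≠ 0 := fun σ i => by
    unfold signFlip
    split_ifs
    · exact neg_ne_zero.2 (h0 i)
    · exact h0 i
  have hs1 : ∀ (σ : Fin n → Bool) i j, i ≠ j → signFlip σ v i + signFlip σ v j ≠ 0 :=
    fun σ i j hij => by
    unfold signFlip
    split_ifs
    · rw [← neg_add]; exact neg_ne_zero.2 (hadd i j hij)
    · rw [neg_add_eq_sub]; exact hsub j i hij.symm
    · exact hsub i j hij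
    · exact hadd i j hij
  have hcast : ∀ σ : Fin n → Bool, (fun i => ((signFlip σ v i : ℝ) : ℂ) * Complex.I) =
      signFlip σ (fun i => (v i : ℂ) * Complex.I) := fun σ => funext fun i => by
    unfold signFlip
    split_ifs <;> simp
  have hl : ∀ x : ℝ, lW p q Γ k ((-x : ℝ) * Complex.I) = lW p q Γ k (x * Complex.I) := fun x => by
    rw [Complex.ofReal_neg, neg_mul, lW_neg]
  have hh : ∀ x : ℝ, hW p q Γ a b c d ((-x : ℝ) * Complex.I) =
      hW p q Γ a b c d (x * Complex.I) := fun x => by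
    rw [Complex.ofReal_neg, neg_mul, hW_neg]
  have hterm : ∀ σ : Fin n → Bool, f (signFlip σ v) =
      weylCoeff q a b k (signFlip σ fun i => (v i : ℂ) * Complex.I) *
      wt (fun x => hW p q Γ a b c d (x * Complex.I)) (fun x => lW p q Γ k (x * Complex.I))
        (fun x => lW p q Γ k (x * Complex.I)) v := fun σ => by
    rw [hf, contour_integrand_eq hΓ h (hs0 σ) (hs1 σ), hcast,
      koornwinder_weight_signFlip σ v hh hl]
  rw [Finset.sum_congr rfl fun σ _ => hterm σ, ← Finset.sum_mul, sum_weylCoeff]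
  · intro i
    have := sn_mul_I_ne_zero hq (mul_ne_zero two_ne_zero (h0 i))
    rwa [Complex.ofReal_mul, mul_assoc] at this
  · intro i j hij
    have := sn_mul_I_ne_zero hq (hadd i j hij)
    rwa [Complex.ofReal_add, add_mul] at this
  · intro i j hij
    have := sn_mul_I_ne_zero hq (hsub i j hij)
    rwa [Complex.ofReal_sub, sub_mul] at this

theorem koornwinder_shift (hΓ : ShiftedGamma p q Γ) (n : ℕ)
    (h : KoornwinderDom p q k a b c d) (hc : p.re / 2 < c.re) (hd : p.re / 2 < d.re) :
    (∏ j ∈ Finset.range n, sn q (a + b + j * k)) * koornwinder n p q Γ k a b c d =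
      (∏ j ∈ Finset.range n, sn q (c + d - p + j * k)) *
        koornwinder n p q Γ k (a + p / 2) (b + p / 2) (c - p / 2) (d - p / 2) := by
  have hp := hΓ.re_left
  have hp2 : (p / 2).re = p.re / 2 := by simp
  have h' : KoornwinderDom p q k (c - p / 2) (d - p / 2) (a + p / 2) (b + p / 2) := by
    refine ⟨?_, ?_, ?_, ?_, h.hk, h.hk', ?_⟩
    · rw [Complex.sub_re, hp2]; linarith
    · rw [Complex.sub_re, hp2]; linarith
    · rw [Complex.add_re, hp2]; linarith [h.ha]
    · rw [Complex.add_re, hp2]; linarith [h.hb]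
    · convert h.hs using 3
      ring
  rw [← two_pow_mul_contour hΓ n h, contour_zero_eq hΓ n h hc hd, contour_neg_half hΓ.ne_left,
    two_pow_mul_contour hΓ n h', koornwinder_swap_pairs]
  congr 1
  refine Finset.prod_congr rfl fun j _ => ?_
  congr 1
  ring

end

end

section

theorem eq_of_two_periods_aux {R : ℂ → ℂ} {w₁ w₂ : ℂ} (hw : w₁.re * w₂.im - w₁.im * w₂.re ≠ 0)
    {V : Set ℂ} (hR : DifferentiableOn ℂ R V) (hV : Metric.closedBall 0 (‖w₁‖ + ‖w₂‖) ⊆ V)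
    (h₁ : ∀ s, s ∈ Metric.closedBall (0 : ℂ) (‖w₁‖ + ‖w₂‖) →
      s + w₁ ∈ Metric.closedBall (0 : ℂ) (‖w₁‖ + ‖w₂‖) → R (s + w₁) = R s)
    (h₂ : ∀ s, s ∈ Metric.closedBall (0 : ℂ) (‖w₁‖ + ‖w₂‖) →
      s + w₂ ∈ Metric.closedBall (0 : ℂ) (‖w₁‖ + ‖w₂‖) → R (s + w₂) = R s) :
    ∀ᶠ s in 𝓝 0, R s = R 0 := by
  set D := w₁.re * w₂.im - w₁.im * w₂.re with hD
  set X : ℂ →L[ℝ] ℝ := (w₂.im / D) • Complex.reCLM - (w₂.re / D) • Complex.imCLM with hX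
  set Y : ℂ →L[ℝ] ℝ := (w₁.re / D) • Complex.imCLM - (w₁.im / D) • Complex.reCLM with hY
  have hXs : ∀ s, X s = w₂.im / D * s.re - w₂.re / D * s.im := fun s => rfl
  have hYs : ∀ s, Y s = w₁.re / D * s.im - w₁.im / D * s.re := fun s => rfl
  have X1 : X w₁ = 1 := by
    rw [hXs]; field_simp; rw [hD]; ring
  have X2 : X w₂ = 0 := by rw [hXs]; ring
  have Y1 : Y w₁ = 0 := by rw [hYs]; ring
  have Y2 : Y w₂ = 1 := by
    rw [hYs]; field_simp; rw [hD]
  have hdec : ∀ s, s = X s • w₁ + Y s • w₂ := fun s => by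
    refine Complex.ext ?_ ?_ <;> simp only [hXs, hYs, Complex.add_re, Complex.add_im,
      Complex.real_smul, Complex.re_ofReal_mul, Complex.im_ofReal_mul] <;> field_simp <;>
      rw [hD] <;> ring
  set B : Set ℂ := {s | |X s| ≤ 1 ∧ |Y s| ≤ 1} with hB
  have hBball : B ⊆ Metric.closedBall 0 (‖w₁‖ + ‖w₂‖) := by
    rintro s ⟨hs1, hs2⟩
    rw [mem_closedBall_zero_iff, hdec s]
    refine (norm_add_le _ _).trans (add_le_add ?_ ?_)
    · rw [norm_smul]
      exact mul_le_of_le_one_left (norm_nonneg _) hs1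
    · rw [norm_smul]
      exact mul_le_of_le_one_left (norm_nonneg _) hs2
  have hBc : IsCompact B := Metric.isCompact_of_isClosed_isBounded
    ((isClosed_le (X.continuous.abs) continuous_const).inter
      (isClosed_le (Y.continuous.abs) continuous_const))
    (Metric.isBounded_closedBall.subset hBball)
  set O : Set ℂ := X ⁻¹' Ioo (-1) 1 ∩ Y ⁻¹' Ioo (-1) 1 with hO
  have hOo : IsOpen O := (isOpen_Ioo.preimage X.continuous).inter (isOpen_Ioo.preimage Y.continuous)
  have hOc : IsPreconnected O := (((convex_Ioo (-1 : ℝ) 1).linear_preimage X.toLinearMap).inter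
    ((convex_Ioo (-1 : ℝ) 1).linear_preimage Y.toLinearMap)).isPreconnected
  have hOB : O ⊆ B := fun s hs => ⟨abs_le.2 ⟨hs.1.1.le, hs.1.2.le⟩, abs_le.2 ⟨hs.2.1.le, hs.2.2.le⟩⟩
  have h0 : (0 : ℂ) ∈ O := by simp [hO]
  obtain ⟨s₀, hs₀, hmax⟩ := hBc.exists_isMaxOn ⟨0, hOB h0⟩
    (hR.continuousOn.mono (hBball.trans hV)).norm
  have step : ∀ {Z Z' : ℂ →L[ℝ] ℝ} {w : ℂ}, Z w = 1 → Z' w = 0 →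
      (∀ s, |Z s| ≤ 1 → |Z' s| ≤ 1 → s ∈ B) → (∀ s, s ∈ Metric.closedBall (0 : ℂ) (‖w₁‖ + ‖w₂‖) →
      s + w ∈ Metric.closedBall (0 : ℂ) (‖w₁‖ + ‖w₂‖) → R (s + w) = R s) →
      ∀ s, |Z s| ≤ 1 → |Z' s| ≤ 1 → ∃ s', R s' = R s ∧ |Z s'| < 1 ∧ Z' s' = Z' s := by
    intro Z Z' w hZ hZ' hZB hper s h1 h2
    rcases le_or_gt 1 (|Z s|) with h | h
    · rcases le_total 0 (Z s) with h3 | h3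
      · have e : Z (s - w) = 0 := by
          rw [map_sub, hZ, ← abs_of_nonneg h3, le_antisymm h1 h, sub_self]
        have e' : Z' (s - w) = Z' s := by rw [map_sub, hZ', sub_zero]
        refine ⟨s - w, ?_, by rw [e]; simp, e'⟩
        have := hper (s - w) (hBball (hZB _ (by rw [e]; simp) (by rw [e']; exact h2)))
          (by rw [sub_add_cancel]; exact hBball (hZB _ h1 h2))
        rw [← this, sub_add_cancel]
      · have e : Z (s + w) = 0 := by
          rw [map_add, hZ, ← neg_neg (Z s), ← abs_of_nonpos h3, le_antisymm h1 h, neg_add_cancel]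
        have e' : Z' (s + w) = Z' s := by rw [map_add, hZ', add_zero]
        exact ⟨s + w, hper s (hBball (hZB _ h1 h2))
          (hBball (hZB _ (by rw [e]; simp) (by rw [e']; exact h2))), by rw [e]; simp, e'⟩
    · exact ⟨s, rfl, h, rfl⟩
  obtain ⟨s₁, e1, hx1, hy1⟩ := step X1 Y1 (fun s h h' => ⟨h, h'⟩) h₁ s₀ hs₀.1 hs₀.2
  obtain ⟨s₂, e2, hy2, hx2⟩ := step Y2 X2 (fun s h h' => ⟨h', h⟩) h₂ s₁
    (by rw [hy1]; exact hs₀.2) hx1.le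
  have hs₂ : s₂ ∈ O := ⟨abs_lt.1 (by rw [hx2]; exact hx1), abs_lt.1 hy2⟩
  have hconst := Complex.eqOn_of_isPreconnected_of_isMaxOn_norm hOc hOo
    (hR.mono ((hOB.trans hBball).trans hV)) hs₂ (fun s hs => by
      have := hmax (hOB hs)
      simp only [mem_ofPred_eq] at this
      show ‖R s‖ ≤ ‖R s₂‖
      rw [e2, e1]
      exact this)
  filter_upwards [hOo.mem_nhds h0] with s hs
  exact (hconst hs).trans (hconst h0).symm

theorem eq_of_two_periods {f g : ℂ → ℂ} {w₁ w₂ : ℂ}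
    (hw : w₁.re * w₂.im - w₁.im * w₂.re ≠ 0) {S : Set ℂ} (hS : IsOpen S) (hSc : IsPreconnected S)
    (hf : DifferentiableOn ℂ f S) (hg : DifferentiableOn ℂ g S)
    (hBS : Metric.closedBall 0 (‖w₁‖ + ‖w₂‖) ⊆ S)
    (hg0 : ∀ s ∈ Metric.closedBall (0 : ℂ) (‖w₁‖ + ‖w₂‖), g s ≠ 0)
    (h₁ : ∀ s, s ∈ Metric.closedBall (0 : ℂ) (‖w₁‖ + ‖w₂‖) →
      s + w₁ ∈ Metric.closedBall (0 : ℂ) (‖w₁‖ + ‖w₂‖) → f (s + w₁) * g s = f s * g (s + w₁))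
    (h₂ : ∀ s, s ∈ Metric.closedBall (0 : ℂ) (‖w₁‖ + ‖w₂‖) →
      s + w₂ ∈ Metric.closedBall (0 : ℂ) (‖w₁‖ + ‖w₂‖) → f (s + w₂) * g s = f s * g (s + w₂))
    {s : ℂ} (hs : s ∈ S) : f s * g 0 = f 0 * g s := by
  have hz : (0 : ℂ) ∈ Metric.closedBall (0 : ℂ) (‖w₁‖ + ‖w₂‖) := by simp; positivity
  have hV : DifferentiableOn ℂ (fun s => f s / g s) (S ∩ {s | g s ≠ 0}) :=
    (hf.mono inter_subset_left).fun_div (hg.mono inter_subset_left) fun s hs => hs.2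
  have hev := eq_of_two_periods_aux hw hV (fun s hs => ⟨hBS hs, hg0 s hs⟩)
    (fun s h h' => by rw [div_eq_div_iff (hg0 _ h') (hg0 _ h)]; exact h₁ s h h')
    (fun s h h' => by rw [div_eq_div_iff (hg0 _ h') (hg0 _ h)]; exact h₂ s h h')
  have hev' : ∀ᶠ s in 𝓝 (0 : ℂ), f s * g 0 = f 0 * g s := by
    have hne : ∀ᶠ s in 𝓝 (0 : ℂ), g s ≠ 0 :=
      ((hg.differentiableAt (hS.mem_nhds (hBS hz))).continuousAt).eventually_ne (hg0 0 hz)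
    filter_upwards [hev, hne] with s h1 h2
    exact (div_eq_div_iff h2 (hg0 0 hz)).1 h1
  exact AnalyticOnNhd.eqOn_of_preconnected_of_eventuallyEq
    ((hf.mul_const _).analyticOnNhd hS) ((hg.const_mul _).analyticOnNhd hS) hSc (hBS hz) hev' hs

/-- Cone of parameters on which the shifted gamma function has neither zeros nor poles. -/
structure InCone (p q u : ℂ) : Prop where
  pos : 0 < u.re
  neg : (u / (p * q)).re < 0

/-- Closed form of the Koornwinder-type integral. -/
def koornwinderValue (n : ℕ) (p q : ℂ) (Γ : ℂ → ℂ) (k a b c d : ℂ) : ℂ :=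
  2 ^ n * (n.factorial : ℂ) * ((p * q) ^ ((1 : ℂ) / 2)) ^ n *
    ∏ j ∈ Finset.range n, Γ ((j + 1) * k) / Γ k *
      (Γ (a + b + j * k) * Γ (c + d + j * k) * (Γ (a + c + j * k) * Γ (b + d + j * k) *
        (Γ (a + d + j * k) * Γ (b + c + j * k))) / Γ (a + b + c + d + (2 * n - j - 2) * k))

theorem koornwinderValue_swap_mid (n : ℕ) (p q : ℂ) (Γ : ℂ → ℂ) (k a b c d : ℂ) :
    koornwinderValue n p q Γ k a b c d = koornwinderValue n p q Γ k a c b d := by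
  unfold koornwinderValue
  congr 1
  refine Finset.prod_congr rfl fun j _ => ?_
  rw [add_comm c b, add_right_comm a c b]
  ring

theorem koornwinderValue_comm (n : ℕ) (p q : ℂ) (Γ : ℂ → ℂ) (k a b c d : ℂ) :
    koornwinderValue n p q Γ k a b c d = koornwinderValue n q p Γ k a b c d := by
  unfold koornwinderValue
  rw [mul_comm p q]

namespace InCone

variable {p q u v : ℂ}

theorem add (hu : InCone p q u) (hv : InCone p q v) : InCone p q (u + v) :=
  ⟨by rw [Complex.add_re]; exact add_pos hu.pos hv.pos,
    by rw [add_div, Complex.add_re]; exact add_neg hu.neg hv.neg⟩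

theorem add_nat_mul (hu : InCone p q u) (hv : InCone p q v) (j : ℕ) : InCone p q (u + j * v) := by
  induction j with
  | zero => simpa using hu
  | succ j ih => simpa [add_mul, ← add_assoc] using ih.add hv

theorem nat_succ_mul (hv : InCone p q v) (j : ℕ) : InCone p q ((j + 1) * v) := by
  simpa [add_mul, add_comm] using hv.add_nat_mul hv j

theorem comm (hu : InCone p q u) : InCone q p u := ⟨hu.pos, by rw [mul_comm]; exact hu.neg⟩

theorem re_sub_neg (hp : 0 < p.re) (hq : 0 < q.re) (hu : (u / (p * q)).re < 0) :
    ((u - p - q) / (p * q)).re < 0 := by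
  rw [re_one_div_add (fun h => by simp [h] at hp) (fun h => by simp [h] at hq)]
  linarith [ShiftedGamma.re_div_pos hp, ShiftedGamma.re_div_pos hq]

theorem gamma_ne_zero {Γ : ℂ → ℂ} (hΓ : ShiftedGamma p q Γ) (hu : InCone p q u) : Γ u ≠ 0 :=
  hΓ.ne_zero hu.pos (re_sub_neg hΓ.re_left hΓ.re_right hu.neg)

end InCone

theorem two_mul_sub_cast {n j : ℕ} (hj : j < n) :
    (2 * n - j - 2 : ℂ) = ((2 * n - j - 2 : ℕ) : ℂ) := by
  rw [Nat.cast_sub (by omega), Nat.cast_sub (by omega)]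
  push_cast
  ring

section

variable {p q k a b c d : ℂ} {Γ : ℂ → ℂ}

theorem KoornwinderDom.denom (hΓ : ShiftedGamma p q Γ) (h : KoornwinderDom p q k a b c d)
    {n j : ℕ} (hj : j < n) :
    0 < (a + b + c + d + (2 * n - j - 2) * k).re ∧
      ((a + b + c + d + (2 * n - j - 2) * k - p - q) / (p * q)).re < 0 ∧
      Γ (a + b + c + d + (2 * n - j - 2) * k) ≠ 0 := by
  have h1 : 0 < (a + b + c + d + (2 * n - j - 2) * k).re := by
    rw [two_mul_sub_cast hj, Complex.add_re, ← Complex.ofReal_natCast, Complex.re_ofReal_mul]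
    simp only [Complex.add_re]
    have := h.ha; have := h.hb; have := h.hc; have := h.hd
    have := mul_nonneg (Nat.cast_nonneg (α := ℝ) (2 * n - j - 2)) h.hk.le
    linarith
  have h2 : ((a + b + c + d + (2 * n - j - 2) * k - p - q) / (p * q)).re < 0 := by
    rw [show (a + b + c + d + (2 * n - j - 2) * k - p - q) / (p * q) =
      (a + b + c + d - p - q) / (p * q) + ((2 * n - j - 2 : ℕ) : ℝ) * (k / (p * q)) by
        rw [two_mul_sub_cast hj]; push_cast; ring]
    rw [Complex.add_re, Complex.re_ofReal_mul]
    have := mul_nonpos_of_nonneg_of_nonpos (Nat.cast_nonneg (α := ℝ) (2 * n - j - 2)) h.hk'.le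
    linarith [h.hs]
  exact ⟨h1, h2, hΓ.ne_zero h1 h2⟩

theorem KoornwinderDom.inCone (h : KoornwinderDom p q k a b c d) : InCone p q k := ⟨h.hk, h.hk'⟩

theorem KoornwinderDom.of_inCone (hp : 0 < p.re) (hq : 0 < q.re) (hk : InCone p q k)
    (ha : InCone p q a) (hb : InCone p q b) (hc : InCone p q c) (hd : InCone p q d) :
    KoornwinderDom p q k a b c d :=
  ⟨ha.pos, hb.pos, hc.pos, hd.pos, hk.pos, hk.neg,
    InCone.re_sub_neg hp hq (((ha.add hb).add hc).add hd).neg⟩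

theorem re_add_nat_mul_pos {u : ℂ} (hu : 0 < u.re) (hk : 0 < k.re) (j : ℕ) :
    0 < (u + j * k).re := by
  rw [Complex.add_re, ← Complex.ofReal_natCast, Complex.re_ofReal_mul]
  have := mul_nonneg (Nat.cast_nonneg (α := ℝ) j) hk.le
  linarith

theorem koornwinderValue_ne_zero (hΓ : ShiftedGamma p q Γ) (n : ℕ) (hk : InCone p q k)
    (ha : InCone p q a) (hb : InCone p q b) (hc : InCone p q c) (hd : InCone p q d) :
    koornwinderValue n p q Γ k a b c d ≠ 0 := by
  have hpq : p * q ≠ 0 := mul_ne_zero hΓ.ne_left hΓ.ne_right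
  have hD := KoornwinderDom.of_inCone hΓ.re_left hΓ.re_right hk ha hb hc hd
  have g : ∀ {u : ℂ}, InCone p q u → Γ u ≠ 0 := fun hu => hu.gamma_ne_zero hΓ
  have g' : ∀ {u v : ℂ} (j : ℕ), InCone p q u → InCone p q v → Γ (u + v + j * k) ≠ 0 :=
    fun j hu hv => g ((hu.add hv).add_nat_mul hk j)
  refine mul_ne_zero (mul_ne_zero (mul_ne_zero (pow_ne_zero _ two_ne_zero)
    (Nat.cast_ne_zero.2 (Nat.factorial_ne_zero n))) (pow_ne_zero _ ?_))
    (Finset.prod_ne_zero_iff.2 fun j hj => ?_)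
  · rw [Ne, Complex.cpow_eq_zero_iff]
    exact fun h => hpq h.1
  · exact mul_ne_zero (div_ne_zero (g (hk.nat_succ_mul j)) (g hk)) (div_ne_zero
      (mul_ne_zero (mul_ne_zero (g' j ha hb) (g' j hc hd)) (mul_ne_zero (mul_ne_zero (g' j ha hc)
        (g' j hb hd)) (mul_ne_zero (g' j ha hd) (g' j hb hc)))) (hD.denom hΓ
        (Finset.mem_range.1 hj)).2.2)

theorem koornwinderValue_shift (hΓ : ShiftedGamma p q Γ) (n : ℕ) (hk : 0 < k.re)
    (hab : 0 < (a + b).re) (hcd : 0 < (c + d - p).re) :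
    (∏ j ∈ Finset.range n, sn q (a + b + j * k)) * koornwinderValue n p q Γ k a b c d =
      (∏ j ∈ Finset.range n, sn q (c + d - p + j * k)) *
        koornwinderValue n p q Γ k (a + p / 2) (b + p / 2) (c - p / 2) (d - p / 2) := by
  unfold koornwinderValue
  rw [mul_left_comm, mul_left_comm (∏ j ∈ Finset.range n, sn q (c + d - p + j * k)),
    ← Finset.prod_mul_distrib, ← Finset.prod_mul_distrib]
  congr 1
  refine Finset.prod_congr rfl fun j _ => ?_
  have e1 : Γ (a + p / 2 + (b + p / 2) + j * k) = sn q (a + b + j * k) * Γ (a + b + j * k) := by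
    rw [sn, ← hΓ.add_left (re_add_nat_mul_pos hab hk j)]
    congr 1; ring
  have e2 : Γ (c + d + j * k) = sn q (c + d - p + j * k) *
      Γ (c - p / 2 + (d - p / 2) + j * k) := by
    rw [show c - p / 2 + (d - p / 2) + j * k = c + d - p + j * k by ring, sn,
      ← hΓ.add_left (re_add_nat_mul_pos hcd hk j)]
    congr 1; ring
  rw [e1, e2, show a + p / 2 + (c - p / 2) = a + c by ring,
    show b + p / 2 + (d - p / 2) = b + d by ring, show a + p / 2 + (d - p / 2) = a + d by ring,
    show b + p / 2 + (c - p / 2) = b + c by ring,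
    show a + p / 2 + (b + p / 2) + (c - p / 2) + (d - p / 2) = a + b + c + d by ring]
  ring

theorem differentiableOn_koornwinderValue (hΓ : ShiftedGamma p q Γ) (n : ℕ) {a b c d : ℂ → ℂ}
    {U : Set ℂ} (ha : Differentiable ℂ a) (hb : Differentiable ℂ b)
    (hc : Differentiable ℂ c) (hd : Differentiable ℂ d)
    (h : ∀ z ∈ U, KoornwinderDom p q k (a z) (b z) (c z) (d z)) :
    DifferentiableOn ℂ (fun z => koornwinderValue n p q Γ k (a z) (b z) (c z) (d z)) U := by
  intro z hz
  have hz := h z hz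
  refine DifferentiableAt.differentiableWithinAt ?_
  have g : ∀ {a b : ℂ → ℂ} (j : ℕ), Differentiable ℂ a → Differentiable ℂ b → 0 < (a z).re →
      0 < (b z).re → DifferentiableAt ℂ (fun z => Γ (a z + b z + j * k)) z :=
    fun {a b} j ha hb ha0 hb0 => (hΓ.differentiableAt (re_add_nat_mul_pos
      (by rw [Complex.add_re]; exact add_pos ha0 hb0) hz.hk j)).comp z
        (((ha z).add (hb z)).add_const _)
  unfold koornwinderValue
  refine DifferentiableAt.const_mul (DifferentiableAt.fun_finsetProd fun j hj => ?_) _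
  have hj := hz.denom hΓ (Finset.mem_range.1 hj)
  refine DifferentiableAt.const_mul (DifferentiableAt.div (((g j ha hb hz.ha hz.hb).mul
    (g j hc hd hz.hc hz.hd)).mul (((g j ha hc hz.ha hz.hc).mul (g j hb hd hz.hb hz.hd)).mul
    ((g j ha hd hz.ha hz.hd).mul (g j hb hc hz.hb hz.hc)))) ?_ hj.2.2) _
  exact (hΓ.differentiableAt hj.1).comp z
    ((((ha z).add (hb z)).add (hc z)).add (hd z) |>.add_const _)

theorem shift_ratio (hΓ : ShiftedGamma p q Γ) (n : ℕ) (hk : InCone p q k)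
    (ha : InCone p q a) (hb : InCone p q b) (hc : InCone p q c) (hd : InCone p q d)
    (ha' : InCone p q (a + p / 2)) (hb' : InCone p q (b + p / 2)) (hc' : InCone p q (c - p / 2))
    (hd' : InCone p q (d - p / 2)) :
    koornwinder n p q Γ k (a + p / 2) (b + p / 2) (c - p / 2) (d - p / 2) *
        koornwinderValue n p q Γ k a b c d =
      koornwinder n p q Γ k a b c d *
        koornwinderValue n p q Γ k (a + p / 2) (b + p / 2) (c - p / 2) (d - p / 2) := by
  have hp2 : (p / 2).re = p.re / 2 := by simp
  have hD := KoornwinderDom.of_inCone hΓ.re_left hΓ.re_right hk ha hb hc hd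
  have e : c + d - p = c - p / 2 + (d - p / 2) := by ring
  have hcd : InCone p q (c + d - p) := e ▸ hc'.add hd'
  have s1 := koornwinder_shift hΓ n hD
    (by have := hc'.pos; rw [Complex.sub_re, hp2] at this; linarith)
    (by have := hd'.pos; rw [Complex.sub_re, hp2] at this; linarith)
  have s2 := koornwinderValue_shift hΓ n hk.pos (ha.add hb).pos hcd.pos
  have ne : ∀ {u : ℂ}, InCone p q u → InCone p q (u + p) →
      ∏ j ∈ Finset.range n, sn q (u + j * k) ≠ 0 := by
    intro u hu hu'
    refine Finset.prod_ne_zero_iff.2 fun j _ h => ?_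
    have := (hu'.add_nat_mul hk j).gamma_ne_zero hΓ
    rw [add_right_comm, hΓ.add_left (hu.add_nat_mul hk j).pos] at this
    exact this (by rw [← sn, h, zero_mul])
  have n1 := ne (ha.add hb) (by
    rw [show a + b + p = a + p / 2 + (b + p / 2) by ring]; exact ha'.add hb')
  have n2 := ne hcd (by rw [sub_add_cancel]; exact hc.add hd)
  refine mul_left_cancel₀ (mul_ne_zero n1 n2) ?_
  linear_combination (∏ j ∈ Finset.range n, sn q (c + d - p + j * k)) *
    koornwinder n p q Γ k (a + p / 2) (b + p / 2) (c - p / 2) (d - p / 2) * s2 -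
    (∏ j ∈ Finset.range n, sn q (c + d - p + j * k)) *
    koornwinderValue n p q Γ k (a + p / 2) (b + p / 2) (c - p / 2) (d - p / 2) * s1

end

namespace ShiftedGamma

variable {p q k a b c d : ℂ} {Γ : ℂ → ℂ}

theorem symm_koornwinder_ratio (hΓ : ShiftedGamma p q Γ) (n : ℕ) (hk : InCone p q k)
    (hpq : p.re * q.im - p.im * q.re ≠ 0)
    (h : ∀ s : ℂ, ‖s‖ ≤ ‖p / 2‖ + ‖q / 2‖ → InCone p q (a + s) ∧ InCone p q (b + s) ∧
      InCone p q (c + s) ∧ InCone p q (d + s)) {s : ℂ}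
    (hsa : 0 < (a + s).re) (hsb : 0 < (b + s).re) (hsc : 0 < (c - s).re) (hsd : 0 < (d - s).re) :
    koornwinder n p q Γ k (a + s) (b + s) (c - s) (d - s) * koornwinderValue n p q Γ k a b c d =
      koornwinder n p q Γ k a b c d *
        koornwinderValue n p q Γ k (a + s) (b + s) (c - s) (d - s) := by
  set S : Set ℂ := Complex.re ⁻¹' Ioo (max (-a.re) (-b.re)) (min c.re d.re) with hSdef
  have hSo : IsOpen S := isOpen_Ioo.preimage Complex.continuous_re
  have hSc : IsPreconnected S :=
    ((convex_Ioo _ _).linear_preimage Complex.reLm).isPreconnected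
  have hmem : ∀ s, s ∈ S ↔ (0 < (a + s).re ∧ 0 < (b + s).re) ∧ 0 < (c - s).re ∧ 0 < (d - s).re := by
    intro s
    simp only [hSdef, mem_preimage, mem_Ioo, max_lt_iff, lt_min_iff, Complex.add_re,
      Complex.sub_re, sub_pos, neg_lt_iff_pos_add']
  have h0 := h 0 (by rw [norm_zero]; positivity)
  simp only [add_zero] at h0
  have hD := KoornwinderDom.of_inCone hΓ.re_left hΓ.re_right hk h0.1 h0.2.1 h0.2.2.1 h0.2.2.2
  have hDS : ∀ s ∈ S, KoornwinderDom p q k (a + s) (b + s) (c - s) (d - s) := fun s hs => by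
    obtain ⟨⟨h1, h2⟩, h3, h4⟩ := (hmem s).1 hs
    refine ⟨h1, h2, h3, h4, hk.pos, hk.neg, ?_⟩
    convert hD.hs using 3
    ring
  have hball : ∀ s ∈ Metric.closedBall (0 : ℂ) (‖p / 2‖ + ‖q / 2‖), InCone p q (a + s) ∧
      InCone p q (b + s) ∧ InCone p q (c - s) ∧ InCone p q (d - s) := fun s hs => by
    rw [mem_closedBall_zero_iff] at hs
    have h1 := h s hs
    have h2 := h (-s) (by rwa [norm_neg])
    exact ⟨h1.1, h1.2.1, by simpa [sub_eq_add_neg] using h2.2.2.1,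
      by simpa [sub_eq_add_neg] using h2.2.2.2⟩
  have key := eq_of_two_periods (w₁ := p / 2) (w₂ := q / 2) (S := S)
    (f := fun s => koornwinder n p q Γ k (a + s) (b + s) (c - s) (d - s))
    (g := fun s => koornwinderValue n p q Γ k (a + s) (b + s) (c - s) (d - s))
    (by
      intro h
      apply hpq
      simp only [Complex.div_ofNat_re, Complex.div_ofNat_im] at h
      linarith) hSo hSc
    (differentiableOn_koornwinder hΓ n hSo (by fun_prop) (by fun_prop) (by fun_prop) (by fun_prop)
      hDS)
    (differentiableOn_koornwinderValue hΓ n (by fun_prop) (by fun_prop) (by fun_prop)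
      (by fun_prop) hDS)
    (fun s hs => (hmem s).2 ⟨⟨(hball s hs).1.pos, (hball s hs).2.1.pos⟩, (hball s hs).2.2.1.pos,
      (hball s hs).2.2.2.pos⟩)
    (fun s hs => koornwinderValue_ne_zero hΓ n hk (hball s hs).1 (hball s hs).2.1
      (hball s hs).2.2.1 (hball s hs).2.2.2)
    (fun s hs hs' => by
      obtain ⟨h1, h2, h3, h4⟩ := hball s hs
      have h' := hball _ hs'
      simp only [← add_assoc, sub_add_eq_sub_sub] at h' ⊢
      exact shift_ratio hΓ n hk h1 h2 h3 h4 h'.1 h'.2.1 h'.2.2.1 h'.2.2.2)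
    (fun s hs hs' => by
      obtain ⟨h1, h2, h3, h4⟩ := hball s hs
      have h' := hball _ hs'
      simp only [← add_assoc, sub_add_eq_sub_sub] at h' ⊢
      simp only [koornwinder_comm n p q, koornwinderValue_comm n p q]
      exact shift_ratio hΓ.symm n hk.comm h1.comm h2.comm h3.comm h4.comm h'.1.comm h'.2.1.comm
        h'.2.2.1.comm h'.2.2.2.comm)
    ((hmem s).2 ⟨⟨hsa, hsb⟩, hsc, hsd⟩)
  simpa using key

end ShiftedGamma

end

/-- Restriction of the one-body factor to coordinates larger than `|y|`, with the interaction
with the coordinate `y` included. -/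
def innerFactor (h l : ℝ → ℂ) (y x : ℝ) : ℂ :=
  if |y| < |x| then h x * (l (y + x) * l (y - x)) else 0

theorem wt_insertNth {n : ℕ} {h l : ℝ → ℂ} (hl : ∀ x, l (-x) = l x) (i : Fin (n + 1)) (y : ℝ)
    (w : Fin n → ℝ) :
    wt h l l (i.insertNth y w : Fin (n + 1) → ℝ) =
      h y * wt (fun x => h x * (l (y + x) * l (y - x))) l l w := by
  unfold wt
  rw [prod_pairs_succAbove (fun p : Fin (n + 1) × Fin (n + 1) =>
    l ((i.insertNth y w : Fin (n + 1) → ℝ) p.1 + (i.insertNth y w : Fin (n + 1) → ℝ) p.2) *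
      l ((i.insertNth y w : Fin (n + 1) → ℝ) p.1 - (i.insertNth y w : Fin (n + 1) → ℝ) p.2))
    (fun a b => by simp only; rw [add_comm, ← hl (_ - _), neg_sub]) i,
    Fin.prod_univ_succAbove _ i]
  simp only [Fin.insertNth_apply_same, Fin.insertNth_apply_succAbove]
  rw [Finset.prod_mul_distrib (f := fun x => h (w x))]
  ring

theorem wt_innerFactor {n : ℕ} (h l : ℝ → ℂ) (y : ℝ) (w : Fin n → ℝ) :
    wt (innerFactor h l y) l l w =
      if ∀ j, |y| < |w j| then wt (fun x => h x * (l (y + x) * l (y - x))) l l w else 0 := by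
  unfold wt innerFactor
  split_ifs with H
  · simp only [H, if_true]
  · push Not at H
    obtain ⟨j, hj⟩ := H
    rw [Finset.prod_eq_zero (Finset.mem_univ j) (if_neg (not_lt.2 hj)), zero_mul]

theorem integral_wt_succ {n : ℕ} {h l : ℝ → ℂ} (hl : ∀ x, l (-x) = l x)
    (hi : Integrable (wt h l l : (Fin (n + 1) → ℝ) → ℂ)) :
    ∫ v : Fin (n + 1) → ℝ, wt h l l v =
      (n + 1) * ∫ y, h y * ∫ w : Fin n → ℝ, wt (innerFactor h l y) l l w := by
  set A : Fin (n + 1) → Set (Fin (n + 1) → ℝ) := fun i => {v | ∀ j, |v i| < |v (i.succAbove j)|}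
    with hA
  have hAm : ∀ i, MeasurableSet (A i) := fun i => by
    rw [hA]
    simp only [ofPred_forall]
    exact MeasurableSet.iInter fun j => measurableSet_lt (by fun_prop) (by fun_prop)
  have hsum : ∀ᵐ v : Fin (n + 1) → ℝ, wt h l l v = ∑ i, (A i).indicator (wt h l l) v := by
    filter_upwards [ae_notMem_countable (n := n + 1) (countable_singleton (0 : ℝ))] with v hv
    have hne : ∀ i j, i ≠ j → |v i| ≠ |v j| := fun i j hij h => by
      rcases abs_eq_abs.1 h with h | h
      · exact hv.2.2 i j hij (sub_eq_zero.2 h)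
      · exact hv.2.1 i j hij (by rw [h]; simp)
    obtain ⟨i, -, hmin⟩ := Finset.exists_min_image Finset.univ (fun i => |v i|)
      Finset.univ_nonempty
    have hi : v ∈ A i := fun j => lt_of_le_of_ne (hmin _ (Finset.mem_univ _))
      (hne _ _ (Fin.succAbove_ne i j).symm)
    rw [Finset.sum_eq_single_of_mem i (Finset.mem_univ i), indicator_of_mem hi]
    intro j _ hji
    refine indicator_of_notMem (fun hj => ?_) _
    obtain ⟨m, rfl⟩ := Fin.exists_succAbove_eq hji.symm
    exact (hj m).not_ge (hmin _ (Finset.mem_univ _))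
  rw [integral_congr_ae hsum, integral_finsetSum _ fun i _ => hi.indicator (hAm i)]
  have key : ∀ i, ∫ v, (A i).indicator (wt h l l) v =
      ∫ y, h y * ∫ w : Fin n → ℝ, wt (innerFactor h l y) l l w := by
    intro i
    have hmp := (volume_preserving_piFinSuccAbove (fun _ : Fin (n + 1) => ℝ) i).symm
    rw [← hmp.integral_comp', Measure.volume_eq_prod, integral_prod]
    · refine integral_congr_ae (Eventually.of_forall fun y => ?_)
      simp only
      rw [← integral_const_mul]
      refine integral_congr_ae (Eventually.of_forall fun w => ?_)
      change (A i).indicator (wt h l l) (i.insertNth y w : Fin (n + 1) → ℝ) =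
        h y * wt (innerFactor h l y) l l w
      rw [wt_innerFactor, indicator_apply, wt_insertNth hl, mul_ite, mul_zero]
      simp only [hA, mem_ofPred_eq, Fin.insertNth_apply_same, Fin.insertNth_apply_succAbove]
    · have := hmp.integrable_comp_of_integrable (hi.indicator (hAm i))
      rwa [Measure.volume_eq_prod] at this
  rw [Finset.sum_congr rfl fun i _ => key i, Finset.sum_const]
  simp

theorem integral_sq_div_sq : ∫ t : ℝ, t ^ 2 / (1 + t ^ 2) ^ 2 = Real.pi / 2 := by
  have h1 : ∀ t : ℝ, HasDerivAt (fun t => (Real.arctan t - t / (1 + t ^ 2)) / 2)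
      (t ^ 2 / (1 + t ^ 2) ^ 2) t := fun t => by
    have h0 : (1 + t ^ 2) ≠ 0 := by positivity
    refine HasDerivAt.congr_deriv (((Real.hasDerivAt_arctan t).sub ((hasDerivAt_id t).div
      (((hasDerivAt_id t).pow 2).const_add 1) h0)).div_const 2) ?_
    simp only [id, Pi.pow_apply]
    field_simp
    push_cast
    ring
  have h2 : Integrable fun t : ℝ => t ^ 2 / (1 + t ^ 2) ^ 2 := by
    refine integrable_inv_one_add_sq.mono' (Measurable.aestronglyMeasurable (by fun_prop))
      (Eventually.of_forall fun t => ?_)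
    have h0 : 0 < 1 + t ^ 2 := by positivity
    rw [Real.norm_of_nonneg (by positivity), div_le_iff₀ (by positivity), sq (1 + t ^ 2),
      inv_mul_cancel_left₀ h0.ne']
    linarith
  have h3 : ∀ t : ℝ, ‖t / (1 + t ^ 2)‖ ≤ ‖t⁻¹‖ := fun t => by
    by_cases ht : t = 0
    · simp [ht]
    · rw [norm_div, norm_inv, Real.norm_eq_abs, Real.norm_of_nonneg (by positivity),
        div_le_iff₀ (by positivity), ← div_eq_inv_mul, le_div_iff₀ (abs_pos.2 ht), ← sq, sq_abs]
      linarith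
  have h4 : Tendsto (fun t : ℝ => t / (1 + t ^ 2)) atTop (𝓝 0) :=
    squeeze_zero_norm h3 (tendsto_zero_iff_norm_tendsto_zero.1 tendsto_inv_atTop_zero)
  have h5 : Tendsto (fun t : ℝ => t / (1 + t ^ 2)) atBot (𝓝 0) :=
    squeeze_zero_norm h3 (tendsto_zero_iff_norm_tendsto_zero.1 tendsto_inv_atBot_zero)
  rw [integral_of_hasDerivAt_of_tendsto h1 h2
    (((tendsto_nhds_of_tendsto_nhdsWithin Real.tendsto_arctan_atBot).sub h5).div_const 2)
    (((tendsto_nhds_of_tendsto_nhdsWithin Real.tendsto_arctan_atTop).sub h4).div_const 2)]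
  ring

theorem norm_sin_le_mul (z : ℂ) : ‖Complex.sin z‖ ≤ ‖z‖ * Real.exp |z.im| := by
  have hconv : Convex ℝ {w : ℂ | |w.im| ≤ |z.im|} := by
    have : {w : ℂ | |w.im| ≤ |z.im|} = Complex.imLm ⁻¹' Icc (-|z.im|) |z.im| := by
      ext w; simp [abs_le]
    rw [this]
    exact (convex_Icc _ _).linear_preimage _
  have h := hconv.norm_image_sub_le_of_norm_deriv_le (𝕜 := ℂ) (f := Complex.sin)
    (C := Real.exp |z.im|) (x := 0) (y := z)
    (fun w _ => Complex.differentiable_sin w) (fun w hw => by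
      rw [Complex.deriv_sin, ← Complex.sin_add_pi_div_two]
      refine (norm_sin_le _).trans (Real.exp_le_exp.2 ?_)
      rw [show (Real.pi / 2 : ℂ) = ((Real.pi / 2 : ℝ) : ℂ) by push_cast; rfl, Complex.add_im,
        Complex.ofReal_im, add_zero]
      exact hw) (by simp) (by simp)
  simpa [mul_comm] using h

theorem half_norm_le_norm_sin {z : ℂ} (hz : ‖z‖ ≤ 1) : ‖z‖ / 2 ≤ ‖Complex.sin z‖ := by
  have h1 := Complex.sin_bound hz
  have h2 := norm_sub_norm_le z (z - Complex.sin z)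
  have h3 : ‖z - Complex.sin z‖ ≤ ‖z ^ 3 / 6‖ + ‖Complex.sin z - (z - z ^ 3 / 6)‖ := by
    rw [show z - Complex.sin z = z ^ 3 / 6 - (Complex.sin z - (z - z ^ 3 / 6)) by ring]
    exact norm_sub_le _ _
  rw [norm_div, norm_pow, Complex.norm_ofNat] at h3
  rw [sub_sub_cancel] at h2
  have h4 : ‖z‖ ^ 3 ≤ ‖z‖ := pow_le_of_le_one (norm_nonneg _) hz (by norm_num)
  have h5 : ‖z‖ ^ 5 ≤ ‖z‖ := pow_le_of_le_one (norm_nonneg _) hz (by norm_num)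
  linarith [norm_nonneg z]

theorem sinh_abs_im_le_norm_sin (z : ℂ) : Real.sinh |z.im| ≤ ‖Complex.sin z‖ := by
  have key : ∀ w : ℂ, Real.sinh w.im ≤ ‖Complex.sin w‖ := fun w => by
    have := sinh_re_le_norm_sinh (-(w * Complex.I))
    rwa [Complex.sinh_neg, Complex.sinh_mul_I, norm_neg, norm_mul, Complex.norm_I, mul_one,
      Complex.neg_re, Complex.mul_I_re, neg_neg] at this
  rcases abs_cases z.im with ⟨h, -⟩ | ⟨h, -⟩
  · rw [h]; exact key z
  · rw [h, ← Complex.neg_im]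
    exact (key (-z)).trans (by rw [Complex.sin_neg, norm_neg])

theorem sn_arg_im (p : ℂ) (ε x : ℝ) : (Real.pi * (ε + x * Complex.I) / p).im =
    Real.pi * (ε * (1 / p).im + x * (1 / p).re) := by
  rw [show (Real.pi * (ε + x * Complex.I) / p : ℂ) = ((Real.pi * ε : ℝ) : ℂ) * (1 / p) +
    ((Real.pi * x : ℝ) : ℂ) * ((1 / p) * Complex.I) by push_cast; ring, Complex.add_im,
    Complex.im_ofReal_mul, Complex.im_ofReal_mul, Complex.mul_I_im]
  ring

theorem norm_sn_mul_I_le {p : ℂ} (hp : 0 < p.re) (x : ℝ) :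
    ‖sn p (x * Complex.I)‖ ≤ 2 * Real.pi / ‖p‖ * |x| * Real.exp (Real.pi * |x| * (1 / p).re) := by
  have h := norm_sin_le_mul (Real.pi * (x * Complex.I) / p)
  have h1 := sn_arg_im p 0 x
  rw [Complex.ofReal_zero, zero_add, zero_mul, zero_add] at h1
  have h2 := ShiftedGamma.re_div_pos hp
  rw [h1, abs_mul, abs_mul, abs_of_pos Real.pi_pos, abs_of_pos h2, norm_div, norm_mul, norm_mul,
    Complex.norm_I, mul_one, Complex.norm_real, Complex.norm_real, Real.norm_eq_abs,
    Real.norm_eq_abs, abs_of_pos Real.pi_pos] at h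
  rw [sn, norm_mul, Complex.norm_ofNat]
  calc _ ≤ 2 * (Real.pi * |x| / ‖p‖ * Real.exp (Real.pi * (|x| * (1 / p).re))) := by gcongr
    _ = _ := by rw [mul_assoc Real.pi]; ring

theorem exists_le_norm_sn_sq {p : ℂ} (hp : 0 < p.re) : ∃ c > 0, ∀ᶠ ε : ℝ in 𝓝 0, ∀ x : ℝ,
    c * ((ε ^ 2 + x ^ 2) / (1 + x ^ 2)) * Real.exp (2 * (Real.pi * |x| * (1 / p).re)) ≤
      ‖sn p (ε + x * Complex.I)‖ ^ 2 := by
  have hpi := Real.pi_pos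
  have hR := ShiftedGamma.re_div_pos hp
  set R := (1 / p).re
  have hp0 : 0 < ‖p‖ := norm_pos_iff.2 fun h => by simp [h] at hp
  set δ := ‖p‖ / (2 * Real.pi)
  have hδ : 0 < δ := by positivity
  set η := Real.pi * (δ * R) / 2
  have hη : 0 < η := by positivity
  set c₁ := (Real.pi / ‖p‖) ^ 2 * Real.exp (-(2 * (Real.pi * δ * R)))
  have hc₁ : 0 < c₁ := by positivity
  set c₂ := ((1 - Real.exp (-2 * η)) * Real.exp (-1)) ^ 2
  have hc₂ : 0 < c₂ := by
    have : Real.exp (-2 * η) < 1 := Real.exp_lt_one_iff.2 (by linarith)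
    have : 0 < 1 - Real.exp (-2 * η) := by linarith
    positivity
  refine ⟨min c₁ c₂, lt_min hc₁ hc₂, ?_⟩
  have hT : Tendsto (fun ε : ℝ => |Real.pi * (ε * (1 / p).im)|) (𝓝 0) (𝓝 0) := by
    have : Continuous fun ε : ℝ => |Real.pi * (ε * (1 / p).im)| := by fun_prop
    simpa using this.tendsto 0
  have hT' : Tendsto (fun ε : ℝ => |ε|) (𝓝 0) (𝓝 0) := by simpa using continuous_abs.tendsto (0 : ℝ)
  filter_upwards [hT.eventually_lt_const one_pos, hT.eventually_lt_const hη,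
    hT'.eventually_lt_const one_pos, hT'.eventually_lt_const hδ] with ε e1 e2 e3 e4 x
  set z : ℂ := Real.pi * (ε + x * Complex.I) / p with hz
  have hzim : z.im = Real.pi * (ε * (1 / p).im + x * R) := sn_arg_im p ε x
  have hsn : ‖sn p (ε + x * Complex.I)‖ = 2 * ‖Complex.sin z‖ := by simp [sn, hz]
  have hD : 0 ≤ (ε ^ 2 + x ^ 2) / (1 + x ^ 2) := by positivity
  have hE := Real.exp_pos (2 * (Real.pi * |x| * R))
  have hε1 : ε ^ 2 ≤ 1 := by rw [← sq_abs]; nlinarith [abs_nonneg ε]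
  rw [hsn]
  rcases le_or_gt |x| δ with hx | hx
  · have hnorm : ‖z‖ = Real.pi / ‖p‖ * ‖(ε + x * Complex.I : ℂ)‖ := by
      rw [hz, norm_div, norm_mul, Complex.norm_real, Real.norm_of_nonneg hpi.le]; ring
    have hn2 : ‖(ε + x * Complex.I : ℂ)‖ ^ 2 = ε ^ 2 + x ^ 2 := by
      rw [Complex.sq_norm, Complex.normSq_add_mul_I]
    have hz1 : ‖z‖ ≤ 1 := by
      have h3 : ‖(ε + x * Complex.I : ℂ)‖ ≤ 2 * δ := by
        refine (norm_add_le _ _).trans ?_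
        rw [norm_mul, Complex.norm_I, mul_one, Complex.norm_real, Complex.norm_real,
          Real.norm_eq_abs, Real.norm_eq_abs]
        linarith
      calc ‖z‖ ≤ Real.pi / ‖p‖ * (2 * δ) := by rw [hnorm]; gcongr
        _ = 1 := by simp only [δ]; field_simp
    have h4 := half_norm_le_norm_sin hz1
    have h5 : ‖z‖ ^ 2 ≤ (2 * ‖Complex.sin z‖) ^ 2 :=
      pow_le_pow_left₀ (norm_nonneg _) (by linarith) 2
    refine le_trans ?_ h5
    rw [hnorm, mul_pow, hn2]
    have h6 : (ε ^ 2 + x ^ 2) / (1 + x ^ 2) ≤ ε ^ 2 + x ^ 2 :=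
      div_le_self (by positivity) (by nlinarith [sq_nonneg x])
    have h7 : Real.exp (2 * (Real.pi * |x| * R)) ≤ Real.exp (2 * (Real.pi * δ * R)) := by
      gcongr
    calc _ ≤ c₁ * (ε ^ 2 + x ^ 2) * Real.exp (2 * (Real.pi * δ * R)) := by
          gcongr
          exact min_le_left _ _
      _ = _ := by
          simp only [c₁]
          rw [mul_right_comm _ (ε ^ 2 + x ^ 2), mul_assoc _ (Real.exp _) (Real.exp _),
            ← Real.exp_add, neg_add_cancel, Real.exp_zero, mul_one]
  · have h1 : Real.pi * |x| * R - |Real.pi * (ε * (1 / p).im)| ≤ |z.im| := by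
      rw [hzim, mul_add, show Real.pi * |x| * R = |Real.pi * (x * R)| by
        rw [abs_mul, abs_mul, abs_of_pos hpi, abs_of_pos hR, mul_assoc]]
      have := abs_sub_abs_le_abs_sub (Real.pi * (x * R)) (-(Real.pi * (ε * (1 / p).im)))
      rwa [abs_neg, sub_neg_eq_add, add_comm (Real.pi * (x * R))] at this
    have h2 : η ≤ |z.im| := by
      have : Real.pi * (δ * R) ≤ Real.pi * |x| * R := by
        rw [mul_assoc]; gcongr
      have : 2 * η = Real.pi * (δ * R) := by simp only [η]; ring
      linarith
    have h3 := (exp_le_sinh h2).trans (sinh_abs_im_le_norm_sin z)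
    have hw : 0 < 1 - Real.exp (-2 * η) := by
      have : Real.exp (-2 * η) < 1 := Real.exp_lt_one_iff.2 (by linarith)
      linarith
    have h4 : (1 - Real.exp (-2 * η)) * Real.exp (-1) * Real.exp (Real.pi * |x| * R) ≤
        2 * ‖Complex.sin z‖ := by
      have : Real.exp (-1) * Real.exp (Real.pi * |x| * R) ≤ Real.exp |z.im| := by
        rw [← Real.exp_add]; exact Real.exp_le_exp.2 (by linarith)
      rw [mul_assoc]
      have := mul_le_mul_of_nonneg_left this hw.le
      linarith
    have h5 := pow_le_pow_left₀ (by positivity) h4 2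
    refine le_trans ?_ h5
    rw [mul_pow, ← Real.exp_nat_mul]
    have h6 : (ε ^ 2 + x ^ 2) / (1 + x ^ 2) ≤ 1 := by
      rw [div_le_one (by positivity)]; linarith
    push_cast
    gcongr
    calc _ ≤ c₂ * 1 := by
          gcongr
          exact min_le_right _ _
      _ = _ := mul_one _

section

theorem exists_poly_mul_exp_le {c : ℝ} (hc : 0 < c) : ∃ C : ℝ, 0 ≤ C ∧ ∀ x : ℝ,
    (1 + x ^ 2) ^ 2 * Real.exp (-(2 * c) * |x|) ≤ C * Real.exp (-c * |x|) := by
  refine ⟨(1 + 16 / c ^ 2) ^ 2, by positivity, fun x => ?_⟩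
  have h1 : 1 + x ^ 2 ≤ (1 + 16 / c ^ 2) * (c * |x| / 4 + 1) ^ 2 := by
    have h2 : x ^ 2 = 16 / c ^ 2 * (c * |x| / 4) ^ 2 := by
      rw [← sq_abs x]; field_simp; ring
    have h3 : 0 ≤ 16 / c ^ 2 := by positivity
    have h4 : 0 ≤ c * |x| / 4 := by positivity
    nlinarith [mul_nonneg h3 h4, sq_nonneg (c * |x| / 4)]
  have h2 : (1 + x ^ 2) ^ 2 ≤ (1 + 16 / c ^ 2) ^ 2 * Real.exp (c * |x|) := by
    calc (1 + x ^ 2) ^ 2 ≤ ((1 + 16 / c ^ 2) * (c * |x| / 4 + 1) ^ 2) ^ 2 := by gcongr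
      _ ≤ ((1 + 16 / c ^ 2) * Real.exp (c * |x| / 4) ^ 2) ^ 2 := by
          gcongr
          exact Real.add_one_le_exp _
      _ = _ := by
          rw [mul_pow, ← pow_mul, ← Real.exp_nat_mul]
          congr 2
          push_cast
          ring
  calc _ ≤ (1 + 16 / c ^ 2) ^ 2 * Real.exp (c * |x|) * Real.exp (-(2 * c) * |x|) := by gcongr
    _ = _ := by
        rw [mul_assoc, ← Real.exp_add]
        congr 2
        ring

theorem tendsto_sn_mul_div {p : ℂ} (w : ℂ) :
    Tendsto (fun ε : ℝ => sn p (ε * w) / ε) (𝓝[>] 0) (𝓝 (2 * Real.pi * w / p)) := by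
  have h : HasDerivAt (fun ε : ℝ => sn p (ε * w)) (2 * Real.pi * w / p) 0 := by
    have h1 : HasDerivAt (fun ε : ℂ => sn p (ε * w)) (2 * Real.pi * w / p) ((0 : ℝ) : ℂ) := by
      unfold sn
      have h2 : HasDerivAt (fun ε : ℂ => Real.pi * (ε * w) / p) (Real.pi * w / p) ((0 : ℝ) : ℂ) := by
        simpa using (((hasDerivAt_id ((0 : ℝ) : ℂ)).mul_const w).const_mul (Real.pi : ℂ)).div_const p
      refine (h2.csin.const_mul 2).congr_deriv ?_
      simp
      ring
    exact h1.comp_ofReal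
  have h1 := (hasDerivAt_iff_tendsto_slope.1 h).mono_left
    (nhdsWithin_mono 0 (fun x (hx : 0 < x) => hx.ne' : Ioi (0 : ℝ) ⊆ {0}ᶜ))
  refine h1.congr fun ε => ?_
  simp [slope_def_module, sn, div_eq_inv_mul]

namespace ShiftedGamma

variable {p q k A B : ℂ} {Γ : ℂ → ℂ}

theorem gPair_add_right (h : ShiftedGamma p q Γ) {U W ζ : ℂ} (hU : 0 < (U + ζ).re)
    (hW : 0 < (W - ζ).re) :
    gPair Γ (U + q) (W + q) ζ = sn p (U + ζ) * sn p (W - ζ) * gPair Γ U W ζ := by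
  unfold gPair sn
  rw [add_right_comm, add_sub_right_comm, h.add_right hU, h.add_right hW]
  ring

theorem gPair_right_mul (h : ShiftedGamma p q Γ) {ζ : ℂ} (hζ : ζ.re = 0) :
    gPair Γ q q ζ * sn q ζ = sn p ζ := by
  have hp := h.re_left
  have hq := h.re_right
  have h1 := h.mul_sub_self (u := q + ζ) (by simpa [hζ] using hq) (by simpa [hζ] using hp)
  rw [show p + q - (q + ζ) = p - ζ by ring] at h1
  have h2 := h.add_left (u := q - ζ) (by simpa [hζ] using hq)
  have h3 := h.add_right (u := p - ζ) (by simpa [hζ] using hp)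
  rw [← sn, ← neg_sub, sn_neg, sn_sub_self h.ne_right, neg_neg] at h2
  rw [← sn, ← neg_sub ζ p, sn_neg, sn_sub_self h.ne_left, neg_neg] at h3
  rw [neg_sub, show q - ζ + p = p - ζ + q by ring] at h2
  rw [neg_sub, h2] at h3
  unfold gPair
  linear_combination Γ (q + ζ) * h3 + sn p ζ * h1

theorem hW_mul_sq (h : ShiftedGamma p q Γ) {a c d ζ : ℂ} (ha : 0 < (a + ζ).re)
    (ha' : 0 < (a - ζ).re) :
    hW p q Γ a a c d ζ * (sn p (a + ζ) * sn p (a - ζ)) ^ 2 = hW p q Γ (a + q) (a + q) c d ζ := by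
  unfold hW
  rw [h.gPair_add_right ha ha']
  ring

theorem eventually_sn_ne_zero (h : ShiftedGamma p q Γ) :
    ∀ᶠ ε : ℝ in 𝓝[>] 0, ∀ x : ℝ, sn p (ε + x * Complex.I) ≠ 0 ∧ sn p (ε - x * Complex.I) ≠ 0 := by
  obtain ⟨c, hc, hb⟩ := exists_le_norm_sn_sq h.re_left
  filter_upwards [hb.filter_mono nhdsWithin_le_nhds, self_mem_nhdsWithin] with ε h1 (h2 : 0 < ε) x
  have key : ∀ x : ℝ, sn p (ε + x * Complex.I) ≠ 0 := fun x h0 => by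
    have := h1 x
    rw [h0, norm_zero, zero_pow two_ne_zero] at this
    have h3 : 0 < c * ((ε ^ 2 + x ^ 2) / (1 + x ^ 2)) *
      Real.exp (2 * (Real.pi * |x| * (1 / p).re)) := by positivity
    exact absurd this h3.not_ge
  exact ⟨key x, by simpa [sub_eq_add_neg] using key (-x)⟩

theorem exists_norm_lW_le (h : ShiftedGamma p q Γ) (hk : InCone p q k) :
    ∃ C : ℝ, 0 ≤ C ∧ ∀ x : ℝ, ‖lW p q Γ k (x * Complex.I)‖ ≤ C ∧
      ‖lW p q Γ k (x * Complex.I)‖ ≤ C * x ^ 2 := by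
  obtain ⟨C₁, h₁⟩ := expBd_lW (l := (pure () : Filter Unit)) (p := fun _ => p) (q := fun _ => q)
    (k := fun _ => k) (Γ := fun _ => Γ) (fun _ => h) tendsto_const_nhds tendsto_const_nhds
    h.re_left h.re_right tendsto_const_nhds hk.pos
  obtain ⟨C₂, h₂⟩ := ExpBd.gPair (l := (pure () : Filter Unit)) (p := fun _ => p) (q := fun _ => q)
    (U := fun _ => k) (W := fun _ => k) (Γ := fun _ => Γ) (fun _ => h) tendsto_const_nhds
    tendsto_const_nhds h.re_left h.re_right tendsto_const_nhds tendsto_const_nhds hk.pos hk.pos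
  rw [eventually_pure] at h₁ h₂
  have hpi := Real.pi_pos
  have hC₁ : 0 ≤ C₁ := by simpa using (norm_nonneg _).trans (h₁ 0)
  have hC₂ : 0 ≤ C₂ := by simpa using (norm_nonneg _).trans (h₂ 0)
  have hle : ∀ x : ℝ, Real.exp (Real.pi * |x| * (2 * (k / (p * q)).re)) ≤ 1 := fun x => by
    rw [Real.exp_le_one_iff]
    have := mul_nonneg hpi.le (abs_nonneg x)
    nlinarith [hk.neg]
  refine ⟨C₁ + 2 * Real.pi / ‖p‖ * (2 * Real.pi / ‖q‖) * C₂, by positivity, fun x => ⟨?_, ?_⟩⟩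
  · refine (h₁ x).trans ((mul_le_of_le_one_right hC₁ (hle x)).trans ?_)
    exact le_add_of_nonneg_right (by positivity)
  · have e : Real.pi * |x| * ((k + k - p - q) / (p * q)).re = Real.pi * |x| *
        (2 * (k / (p * q)).re) - Real.pi * |x| * (1 / p).re - Real.pi * |x| * (1 / q).re := by
      rw [re_one_div_add h.ne_left h.ne_right, add_div, Complex.add_re]
      ring
    unfold lW
    rw [norm_mul, norm_neg, norm_mul]
    calc _ ≤ 2 * Real.pi / ‖p‖ * |x| * Real.exp (Real.pi * |x| * (1 / p).re) *
          (2 * Real.pi / ‖q‖ * |x| * Real.exp (Real.pi * |x| * (1 / q).re)) *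
          (C₂ * Real.exp (Real.pi * |x| * ((k + k - p - q) / (p * q)).re)) := by
          gcongr
          · exact norm_sn_mul_I_le h.re_left x
          · exact norm_sn_mul_I_le h.re_right x
          · exact h₂ x
      _ = 2 * Real.pi / ‖p‖ * (2 * Real.pi / ‖q‖) * C₂ * x ^ 2 *
          Real.exp (Real.pi * |x| * (2 * (k / (p * q)).re)) := by
          rw [e, Real.exp_sub, Real.exp_sub, ← sq_abs x]
          field_simp
      _ ≤ 2 * Real.pi / ‖p‖ * (2 * Real.pi / ‖q‖) * C₂ * x ^ 2 :=
          mul_le_of_le_one_right (by positivity) (hle x)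
      _ ≤ _ := by
          gcongr
          exact le_add_of_nonneg_left hC₁

theorem exists_norm_hW_pinch_le (h : ShiftedGamma p q Γ) (hA : 0 < A.re) (hB : 0 < B.re)
    (hs : ((A + B - p - q) / (p * q)).re < 0) :
    ∃ C c : ℝ, 0 ≤ C ∧ 0 < c ∧ ∀ᶠ ε : ℝ in 𝓝[>] 0, ∀ x : ℝ,
      ‖hW p q Γ ε ε (A - ε) (B - ε) (x * Complex.I)‖ ≤
        C * (x ^ 2 / (ε ^ 2 + x ^ 2) ^ 2) * Real.exp (-c * |x|) := by
  have hpi := Real.pi_pos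
  have hε : Tendsto (fun ε : ℝ => (ε : ℂ)) (𝓝[>] 0) (𝓝 0) :=
    (Complex.continuous_ofReal.tendsto' 0 0 Complex.ofReal_zero).mono_left nhdsWithin_le_nhds
  have hg : ∀ {a : ℝ → ℂ} {a₀ : ℂ}, Tendsto a (𝓝[>] 0) (𝓝 a₀) → 0 < a₀.re →
      ExpBd (𝓝[>] 0) (fun ε x => gPair Γ (a ε) (a ε) (x * Complex.I))
        (fun ε => ((a ε + a ε - p - q) / (p * q)).re) := fun ha ha0 =>
    ExpBd.gPair (fun _ => h) tendsto_const_nhds tendsto_const_nhds h.re_left h.re_right ha ha ha0 ha0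
  have hgq := hg (a := fun ε => ε + q) (by simpa using hε.add_const q) h.re_right
  obtain ⟨C₁, h₁⟩ := (hgq.mul hgq).mul ((hg (a := fun ε => A - ε)
    (by simpa using hε.const_sub A) hA).mul (hg (a := fun ε => B - ε)
    (by simpa using hε.const_sub B) hB))
  obtain ⟨c₀, hc₀, h₀⟩ := exists_le_norm_sn_sq h.re_left
  set c := -(Real.pi * ((A + B - p - q) / (p * q)).re) with hc
  have hc1 : 0 < c := by rw [hc]; nlinarith
  obtain ⟨C₂, hC₂, h₂⟩ := exists_poly_mul_exp_le hc1
  set K := 2 * Real.pi / ‖p‖ * 2 * (2 * Real.pi / ‖q‖ * 2)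
  have hK : 0 ≤ K := by positivity
  refine ⟨K * max C₁ 0 / c₀ ^ 2 * C₂, c, by positivity, hc1, ?_⟩
  filter_upwards [h₁, h₀.filter_mono nhdsWithin_le_nhds, self_mem_nhdsWithin,
    h.eventually_sn_ne_zero] with ε e1 e0 (hε0 : 0 < ε) en x
  have hR : ∀ x : ℝ, 0 < ((ε : ℂ) + x * Complex.I).re := fun x => by simpa using hε0
  have hR' : ∀ x : ℝ, 0 < ((ε : ℂ) - x * Complex.I).re := fun x => by simpa using hε0
  have key := h.hW_mul_sq (c := A - ε) (d := B - ε) (hR x) (hR' x)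
  set E := Real.exp (2 * (Real.pi * |x| * (1 / p).re)) with hE
  have hE0 : 0 < E := Real.exp_pos _
  set D := (ε ^ 2 + x ^ 2) / (1 + x ^ 2) with hD
  have hD0 : 0 < D := by positivity
  have l1 := e0 x
  have l2 := e0 (-x)
  rw [abs_neg, neg_sq, Complex.ofReal_neg, neg_mul, ← sub_eq_add_neg] at l2
  have low : (c₀ * D * E) ^ 2 ≤ ‖(sn p (ε + x * Complex.I) * sn p (ε - x * Complex.I)) ^ 2‖ := by
    rw [norm_pow, norm_mul, mul_pow ‖_‖, sq (c₀ * D * E)]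
    exact mul_le_mul l1 l2 (by positivity) (by positivity)
  have snb : ∀ {p : ℂ}, 0 < p.re → ‖sn p (2 * (x * Complex.I))‖ ≤ 2 * Real.pi / ‖p‖ * 2 * |x| *
      Real.exp (2 * (Real.pi * |x| * (1 / p).re)) := fun {p} hp => by
    have := norm_sn_mul_I_le hp (2 * x)
    rw [abs_mul, abs_two, Complex.ofReal_mul, Complex.ofReal_ofNat, mul_assoc (2 : ℂ)] at this
    refine this.trans (le_of_eq ?_)
    rw [← mul_assoc _ (2 : ℝ) |x|]
    congr 2
    ring
  have up : ‖hW p q Γ (ε + q) (ε + q) (A - ε) (B - ε) (x * Complex.I)‖ ≤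
      K * max C₁ 0 * x ^ 2 * (Real.exp (-(2 * c) * |x|) * E ^ 2) := by
    unfold hW
    rw [norm_mul, norm_neg, norm_mul]
    have e : Real.exp (2 * (Real.pi * |x| * (1 / p).re)) *
        Real.exp (2 * (Real.pi * |x| * (1 / q).re)) * Real.exp (Real.pi * |x| *
        (((ε + q + (ε + q) - p - q) / (p * q)).re + ((ε + q + (ε + q) - p - q) / (p * q)).re +
        (((A - ε + (A - ε) - p - q) / (p * q)).re + ((B - ε + (B - ε) - p - q) / (p * q)).re))) =
        Real.exp (-(2 * c) * |x|) * E ^ 2 := by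
      have e' : (q / (p * q)).re = (1 / p).re := by
        rw [div_mul_cancel_right₀ h.ne_right, one_div]
      have e'' : (p / (p * q)).re = (1 / q).re := by
        rw [div_mul_cancel_left₀ h.ne_left, one_div]
      rw [hE, ← Real.exp_nat_mul, ← Real.exp_add, ← Real.exp_add, ← Real.exp_add]
      congr 1
      simp only [hc, add_div, sub_div, Complex.add_re, Complex.sub_re, e', e'']
      push_cast
      ring
    calc _ ≤ (2 * Real.pi / ‖p‖ * 2 * |x| * Real.exp (2 * (Real.pi * |x| * (1 / p).re))) *
          (2 * Real.pi / ‖q‖ * 2 * |x| * Real.exp (2 * (Real.pi * |x| * (1 / q).re))) *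
          (max C₁ 0 * Real.exp (Real.pi * |x| *
        (((ε + q + (ε + q) - p - q) / (p * q)).re + ((ε + q + (ε + q) - p - q) / (p * q)).re +
        (((A - ε + (A - ε) - p - q) / (p * q)).re + ((B - ε + (B - ε) - p - q) / (p * q)).re)))) := by
          refine mul_le_mul (mul_le_mul (snb h.re_left) (snb h.re_right) (norm_nonneg _)
            (by positivity)) ((e1 x).trans ?_) (norm_nonneg _) (by positivity)
          gcongr
          exact le_max_left _ _
      _ = _ := by
          rw [← e, ← sq_abs x]
          simp only [K]
          ring
  rw [← key, norm_mul] at up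
  have h3 : ‖hW p q Γ ε ε (A - ε) (B - ε) (x * Complex.I)‖ * (c₀ * D * E) ^ 2 ≤
      K * max C₁ 0 * x ^ 2 * (Real.exp (-(2 * c) * |x|) * E ^ 2) :=
    (mul_le_mul_of_nonneg_left low (norm_nonneg _)).trans up
  rw [← le_div_iff₀ (by positivity)] at h3
  refine h3.trans ?_
  have hne : ε ^ 2 + x ^ 2 ≠ 0 := by positivity
  calc _ = K * max C₁ 0 / c₀ ^ 2 * (x ^ 2 / (ε ^ 2 + x ^ 2) ^ 2) *
        ((1 + x ^ 2) ^ 2 * Real.exp (-(2 * c) * |x|)) := by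
        rw [hD]
        have : (1 + x ^ 2) ≠ 0 := by positivity
        field_simp
    _ ≤ K * max C₁ 0 / c₀ ^ 2 * (x ^ 2 / (ε ^ 2 + x ^ 2) ^ 2) * (C₂ * Real.exp (-c * |x|)) := by
        exact mul_le_mul_of_nonneg_left (h₂ x) (by positivity)
    _ = _ := by ring

end ShiftedGamma

end

section

theorem norm_innerFactor_le {h l : ℝ → ℂ} {C L c δ : ℝ} (hC : 0 ≤ C)
    (hh : ∀ x, ‖h x‖ ≤ C * (x ^ 2 / (δ ^ 2 + x ^ 2) ^ 2) * Real.exp (-c * |x|))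
    (hl : ∀ x, ‖l x‖ ≤ L ∧ ‖l x‖ ≤ L * x ^ 2) (y x : ℝ) :
    ‖innerFactor h l y x‖ ≤ 4 * C * L ^ 2 * Real.exp (-c * |x|) := by
  have hL : 0 ≤ L := (norm_nonneg _).trans (hl 0).1
  unfold innerFactor
  split_ifs with H
  · have hx0 : x ≠ 0 := abs_pos.1 ((abs_nonneg y).trans_lt H)
    have hx : 0 < x ^ 2 := by positivity
    have hyx : (y + x) ^ 2 ≤ 4 * x ^ 2 := by
      have := sq_lt_sq.2 H
      nlinarith [sq_nonneg (y - x)]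
    have h1 : x ^ 2 / (δ ^ 2 + x ^ 2) ^ 2 ≤ 1 / x ^ 2 := by
      rw [div_le_div_iff₀ (by positivity) hx]
      nlinarith [sq_nonneg δ, mul_nonneg (sq_nonneg δ) (sq_nonneg x), sq_nonneg (δ ^ 2)]
    rw [norm_mul, norm_mul]
    calc ‖h x‖ * (‖l (y + x)‖ * ‖l (y - x)‖)
        ≤ C * (1 / x ^ 2) * Real.exp (-c * |x|) * (L * (4 * x ^ 2) * L) := by
          refine mul_le_mul ((hh x).trans ?_) (mul_le_mul ((hl _).2.trans ?_) (hl _).1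
            (norm_nonneg _) (by positivity)) (by positivity) (by positivity)
          · gcongr
          · gcongr
      _ = _ := by field_simp
  · rw [norm_zero]
    positivity

theorem measurable_innerFactor {h l : ℝ → ℂ} (hh : Measurable h) (hl : Measurable l) :
    Measurable fun z : ℝ × ℝ => innerFactor h l z.1 z.2 := by
  unfold innerFactor
  exact Measurable.ite (measurableSet_lt (by fun_prop) (by fun_prop)) (by fun_prop)
    measurable_const

theorem stronglyMeasurable_integral_innerFactor {n : ℕ} {h l : ℝ → ℂ} (hh : Measurable h)
    (hl : Measurable l) :
    StronglyMeasurable fun y : ℝ => ∫ w : Fin n → ℝ, wt (innerFactor h l y) l l w := by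
  refine StronglyMeasurable.integral_prod_right (f := fun (y : ℝ) (w : Fin n → ℝ) =>
    wt (innerFactor h l y) l l w) ?_
  refine Measurable.stronglyMeasurable ?_
  unfold wt
  refine Measurable.mul (Finset.measurable_prod _ fun j _ => ?_) ?_
  · exact (measurable_innerFactor hh hl).comp
      (g := fun z : ℝ × ℝ => innerFactor h l z.1 z.2)
      (f := fun z : ℝ × (Fin n → ℝ) => (z.1, z.2 j)) (by fun_prop)
  · fun_prop

namespace ShiftedGamma

variable {p q k A B : ℂ} {Γ : ℂ → ℂ}

theorem tendsto_gPair {ι : Type*} {l : Filter ι} (h : ShiftedGamma p q Γ) {U W Z : ι → ℂ}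
    {U₀ W₀ Z₀ : ℂ} (hU : Tendsto U l (𝓝 U₀)) (hW : Tendsto W l (𝓝 W₀)) (hZ : Tendsto Z l (𝓝 Z₀))
    (hU0 : 0 < (U₀ + Z₀).re) (hW0 : 0 < (W₀ - Z₀).re) :
    Tendsto (fun t => gPair Γ (U t) (W t) (Z t)) l (𝓝 (gPair Γ U₀ W₀ Z₀)) := by
  unfold gPair
  exact ((h.differentiableAt hU0).continuousAt.tendsto.comp (hU.add hZ)).mul
    ((h.differentiableAt hW0).continuousAt.tendsto.comp (hW.sub hZ))

theorem tendsto_ofReal_pos : Tendsto (fun ε : ℝ => (ε : ℂ)) (𝓝[>] 0) (𝓝 0) :=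
  (Complex.continuous_ofReal.tendsto' 0 0 Complex.ofReal_zero).mono_left nhdsWithin_le_nhds

/-- Gamma factor of the deformed short weight whose double pole at the origin was removed. -/
theorem tendsto_gPair_pinch (h : ShiftedGamma p q Γ) (hA : 0 < A.re) (hB : 0 < B.re) {Z : ℝ → ℂ}
    {Z₀ : ℂ} (hZ : Tendsto Z (𝓝[>] 0) (𝓝 Z₀)) (hZ0 : Z₀.re = 0) :
    Tendsto (fun ε : ℝ => gPair Γ (ε + q) (ε + q) (Z ε) * gPair Γ (ε + q) (ε + q) (Z ε) *
      (gPair Γ (A - ε) (A - ε) (Z ε) * gPair Γ (B - ε) (B - ε) (Z ε))) (𝓝[>] 0)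
      (𝓝 (gPair Γ q q Z₀ * gPair Γ q q Z₀ * (gPair Γ A A Z₀ * gPair Γ B B Z₀))) := by
  have hε := tendsto_ofReal_pos
  have hq : Tendsto (fun ε : ℝ => (ε : ℂ) + q) (𝓝[>] 0) (𝓝 q) := by simpa using hε.add_const q
  have hA' : Tendsto (fun ε : ℝ => A - (ε : ℂ)) (𝓝[>] 0) (𝓝 A) := by simpa using hε.const_sub A
  have hB' : Tendsto (fun ε : ℝ => B - (ε : ℂ)) (𝓝[>] 0) (𝓝 B) := by simpa using hε.const_sub B
  have g : ∀ {a : ℝ → ℂ} {a₀ : ℂ}, Tendsto a (𝓝[>] 0) (𝓝 a₀) → 0 < a₀.re →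
      Tendsto (fun ε => gPair Γ (a ε) (a ε) (Z ε)) (𝓝[>] 0) (𝓝 (gPair Γ a₀ a₀ Z₀)) :=
    fun ha ha0 => h.tendsto_gPair ha ha hZ (by simpa [hZ0] using ha0) (by simpa [hZ0] using ha0)
  exact ((g hq h.re_right).mul (g hq h.re_right)).mul ((g hA' hA).mul (g hB' hB))

theorem tendsto_innerFactor (h : ShiftedGamma p q Γ) (hk : InCone p q k) (hA : 0 < A.re)
    (hB : 0 < B.re) (t x : ℝ) :
    Tendsto (fun ε : ℝ => innerFactor (fun x => hW p q Γ ε ε (A - ε) (B - ε) (x * Complex.I))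
      (fun x => lW p q Γ k (x * Complex.I)) (ε * t) x) (𝓝[>] 0)
      (𝓝 (hW p q Γ k k A B (x * Complex.I))) := by
  have hid : Tendsto (fun ε : ℝ => ε) (𝓝[>] 0) (𝓝 0) := tendsto_id.mono_left nhdsWithin_le_nhds
  by_cases hx : x = 0
  · subst hx
    simp [innerFactor, hW, sn]
  have hs := sn_mul_I_ne_zero h.re_left hx
  have hs' := sn_mul_I_ne_zero h.re_right hx
  have hε := tendsto_ofReal_pos
  have hζ : ((x : ℂ) * Complex.I).re = 0 := by simp
  have hl : Tendsto (fun ε : ℝ => lW p q Γ k ((ε * t + x : ℝ) * Complex.I) *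
      lW p q Γ k ((ε * t - x : ℝ) * Complex.I)) (𝓝[>] 0)
      (𝓝 (lW p q Γ k (x * Complex.I) * lW p q Γ k (x * Complex.I))) := by
    have hc := h.continuous_lW hk.pos
    refine Tendsto.mul ?_ ?_
    · exact (hc.tendsto x).comp (by simpa using (hid.mul_const t).add_const x)
    · rw [← lW_neg p q Γ k (x * Complex.I), ← neg_mul, ← Complex.ofReal_neg]
      exact (hc.tendsto (-x)).comp (by simpa using (hid.mul_const t).sub_const x)
  have hS : ∀ u : ℂ, Tendsto (fun ε : ℝ => sn p (ε + u)) (𝓝[>] 0) (𝓝 (sn p u)) := fun u =>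
    ((differentiable_sn p).continuous.tendsto u).comp (by simpa using hε.add_const u)
  have hden : Tendsto (fun ε : ℝ => (sn p (ε + x * Complex.I) * sn p (ε - x * Complex.I)) ^ 2)
      (𝓝[>] 0) (𝓝 ((sn p (x * Complex.I) * sn p (-(x * Complex.I))) ^ 2)) := by
    simp only [sub_eq_add_neg]
    exact ((hS _).mul (hS _)).pow 2
  have hnum := (h.tendsto_gPair_pinch hA hB (Z := fun _ => x * Complex.I) tendsto_const_nhds
    hζ).const_mul (-(sn p (2 * (x * Complex.I)) * sn q (2 * (x * Complex.I))))
  have hq := h.gPair_right_mul hζ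
  have key := (hnum.div hden (by rw [sn_neg]; simp [hs])).mul hl
  convert key.congr' ?_ using 2
  · have e : gPair Γ q q (x * Complex.I) = sn p (x * Complex.I) / sn q (x * Complex.I) :=
      eq_div_of_mul_eq hs' hq
    unfold hW lW
    rw [sn_neg, e]
    field_simp
  · have h1 : Tendsto (fun ε : ℝ => |ε * t|) (𝓝[>] 0) (𝓝 0) := by
      simpa using (hid.mul_const t).abs
    filter_upwards [h1.eventually_lt_const (abs_pos.2 hx), h.eventually_sn_ne_zero,
      self_mem_nhdsWithin] with ε e1 e2 (e3 : 0 < ε)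
    simp only [innerFactor, e1, if_true, Pi.div_apply]
    congr 1
    rw [div_eq_iff (pow_ne_zero 2 (mul_ne_zero (e2 x).1 (e2 x).2)),
      h.hW_mul_sq (by simpa using e3) (by simpa using e3)]
    rfl

theorem tendsto_sq_mul_hW (h : ShiftedGamma p q Γ) (hA : 0 < A.re) (hB : 0 < B.re) (t : ℝ) :
    Tendsto (fun ε : ℝ => (ε : ℂ) ^ 2 * hW p q Γ ε ε (A - ε) (B - ε) ((ε * t : ℝ) * Complex.I))
      (𝓝[>] 0) (𝓝 (p * q / Real.pi ^ 2 * (Γ A ^ 2 * Γ B ^ 2) *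
        ((t ^ 2 / (1 + t ^ 2) ^ 2 : ℝ) : ℂ))) := by
  have hpi : (Real.pi : ℂ) ≠ 0 := Complex.ofReal_ne_zero.2 Real.pi_ne_zero
  have hid : Tendsto (fun ε : ℝ => ε) (𝓝[>] 0) (𝓝 0) := tendsto_id.mono_left nhdsWithin_le_nhds
  have hp := h.ne_left
  have hq := h.ne_right
  have ht : (1 + (t : ℂ) ^ 2) ≠ 0 := by
    have : (1 + t ^ 2 : ℝ) ≠ 0 := by positivity
    exact_mod_cast this
  have hI : (1 + t * Complex.I) * (1 - t * Complex.I) = 1 + (t : ℂ) ^ 2 := by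
    ring_nf; rw [Complex.I_sq]; ring
  have hZ : Tendsto (fun ε : ℝ => ((ε * t : ℝ) : ℂ) * Complex.I) (𝓝[>] 0) (𝓝 0) := by
    have : Tendsto (fun ε : ℝ => ((ε * t : ℝ) : ℂ)) (𝓝[>] 0) (𝓝 ((0 * t : ℝ) : ℂ)) :=
      (Complex.continuous_ofReal.tendsto _).comp (hid.mul_const t)
    simpa using this.mul_const Complex.I
  have hden := (((tendsto_sn_mul_div (p := p) (1 + t * Complex.I)).mul
    (tendsto_sn_mul_div (p := p) (1 - t * Complex.I))).pow 2)
  have hnum := (((tendsto_sn_mul_div (p := p) (2 * t * Complex.I)).mul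
    (tendsto_sn_mul_div (p := q) (2 * t * Complex.I))).neg).mul
    (h.tendsto_gPair_pinch hA hB hZ (by simp))
  have e1 : 2 * (Real.pi : ℂ) * (1 + t * Complex.I) / p * (2 * Real.pi * (1 - t * Complex.I) / p) =
      4 * Real.pi ^ 2 * (1 + (t : ℂ) ^ 2) / p ^ 2 := by
    rw [← hI]; ring
  have key := hnum.div hden (by
    rw [e1]
    exact pow_ne_zero 2 (div_ne_zero (mul_ne_zero (mul_ne_zero (by norm_num)
      (pow_ne_zero 2 hpi)) ht) (pow_ne_zero 2 hp)))
  convert key.congr' ?_ using 2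
  · rw [e1]
    have hsq := h.sq_left_mul
    unfold gPair
    simp only [add_zero, sub_zero]
    push_cast
    have e2 : Γ q ^ 4 = (p * q) ^ 2 / p ^ 4 := by
      rw [← hsq]; field_simp
    have e3 : Γ q * Γ q * (Γ q * Γ q) = Γ q ^ 4 := by ring
    rw [e3, e2]
    field_simp
    ring_nf
    simp only [Complex.I_sq]
    ring
  · filter_upwards [h.eventually_sn_ne_zero, self_mem_nhdsWithin] with ε e2 (e3 : 0 < ε)
    have e0 : (ε : ℂ) ≠ 0 := Complex.ofReal_ne_zero.2 e3.ne'
    obtain ⟨f1, f2⟩ := e2 (ε * t)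
    have g1 : (ε : ℂ) * (1 + t * Complex.I) = ε + (ε * t : ℝ) * Complex.I := by push_cast; ring
    have g2 : (ε : ℂ) * (1 - t * Complex.I) = ε - (ε * t : ℝ) * Complex.I := by push_cast; ring
    have g3 : (ε : ℂ) * (2 * t * Complex.I) = 2 * ((ε * t : ℝ) * Complex.I) := by push_cast; ring
    have key := h.hW_mul_sq (a := ε) (c := A - ε) (d := B - ε) (ζ := (ε * t : ℝ) * Complex.I)
      (by simpa using e3) (by simpa using e3)
    rw [← eq_div_iff (pow_ne_zero 2 (mul_ne_zero f1 f2))] at key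
    simp only [Pi.div_apply, g1, g2, g3]
    rw [key]
    unfold hW
    field_simp

theorem tendsto_mul_koornwinder_pinch (h : ShiftedGamma p q Γ) (n : ℕ) (hk : InCone p q k)
    (hA : 0 < A.re) (hB : 0 < B.re) (hs : ((A + B - p - q) / (p * q)).re < 0) :
    Tendsto (fun ε : ℝ => (ε : ℂ) * koornwinder (n + 1) p q Γ k ε ε (A - ε) (B - ε)) (𝓝[>] 0)
      (𝓝 ((n + 1) * (p * q / (2 * Real.pi)) * (Γ A ^ 2 * Γ B ^ 2) *
        koornwinder n p q Γ k k k A B)) := by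
  obtain ⟨C, c, hC, hc, hb⟩ := h.exists_norm_hW_pinch_le hA hB hs
  obtain ⟨L, hL, hl⟩ := h.exists_norm_lW_le hk
  have hid : Tendsto (fun ε : ℝ => ε) (𝓝[>] 0) (𝓝 0) := tendsto_id.mono_left nhdsWithin_le_nhds
  set H : ℝ → ℝ → ℂ := fun ε x => hW p q Γ ε ε (A - ε) (B - ε) (x * Complex.I) with hH
  set ℓ : ℝ → ℂ := fun x => lW p q Γ k (x * Complex.I) with hℓ
  set J : ℝ → ℝ → ℂ := fun ε y => ∫ w : Fin n → ℝ, wt (innerFactor (H ε) ℓ y) ℓ ℓ w with hJ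
  set K := 4 * C * L ^ 2 + L with hK
  set M := ∫ v : Fin n → ℝ, (K ^ n * (K * K) ^ (Finset.univ.filter
      (fun p : Fin n × Fin n => p.1 < p.2)).card) * ∏ j, Real.exp (-c * |v j|) with hM
  have hℓm : Measurable ℓ := (h.continuous_lW hk.pos).measurable
  have hdom : ∀ᶠ ε : ℝ in 𝓝[>] 0, KoornwinderDom p q k ε ε (A - ε) (B - ε) := by
    filter_upwards [self_mem_nhdsWithin, hid.eventually_lt_const hA, hid.eventually_lt_const hB]
      with ε (e1 : 0 < ε) e2 e3
    exact ⟨by simpa using e1, by simpa using e1, by simpa using e2, by simpa using e3, hk.pos,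
      hk.neg, by rwa [show (ε + ε + (A - ε) + (B - ε) - p - q : ℂ) = A + B - p - q by ring]⟩
  have hHm : ∀ᶠ ε : ℝ in 𝓝[>] 0, Measurable (H ε) := hdom.mono fun ε e =>
    (h.continuous_hW e.ha e.hb e.hc e.hd).measurable
  have hin : ∀ᶠ ε : ℝ in 𝓝[>] 0, ∀ y x, ‖innerFactor (H ε) ℓ y x‖ ≤ K * Real.exp (-c * |x|) := by
    filter_upwards [hb] with ε e y x
    refine (norm_innerFactor_le hC e hl y x).trans ?_
    gcongr
    exact le_add_of_nonneg_right hL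
  have hℓK : ∀ x, ‖ℓ x‖ ≤ K := fun x => (hl x).1.trans (le_add_of_nonneg_left (by positivity))
  have hJM : ∀ᶠ ε : ℝ in 𝓝[>] 0, ∀ y, ‖J ε y‖ ≤ M := by
    filter_upwards [hin] with ε e y
    exact norm_integral_le_of_norm_le ((integrable_prod_exp hc).const_mul _)
      (Eventually.of_forall fun v => norm_wt_le (e y) hℓK hℓK v)
  have hJlim : ∀ t : ℝ, Tendsto (fun ε => J ε (ε * t)) (𝓝[>] 0)
      (𝓝 (koornwinder n p q Γ k k k A B)) := fun t => by
    refine tendsto_integral_wt ?_ (fun x => h.tendsto_innerFactor hk hA hB t x)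
      (fun _ => tendsto_const_nhds) (fun _ => tendsto_const_nhds) ⟨K, c, hc, ?_⟩
    · filter_upwards [hHm] with ε e
      exact ⟨(measurable_innerFactor e hℓm).comp (f := fun x : ℝ => (ε * t, x)) (by fun_prop),
        hℓm, hℓm⟩
    · filter_upwards [hin] with ε e x
      exact ⟨e _ x, hℓK x, hℓK x⟩
  have main : Tendsto (fun ε : ℝ => ∫ t : ℝ, ((ε : ℂ) ^ 2 * H ε (ε * t)) * J ε (ε * t)) (𝓝[>] 0)
      (𝓝 (∫ t : ℝ, p * q / Real.pi ^ 2 * (Γ A ^ 2 * Γ B ^ 2) *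
        ((t ^ 2 / (1 + t ^ 2) ^ 2 : ℝ) : ℂ) * koornwinder n p q Γ k k k A B)) := by
    refine tendsto_integral_filter_of_dominated_convergence
      (fun t => C * M * (1 + t ^ 2)⁻¹) ?_ ?_ (integrable_inv_one_add_sq.const_mul _)
      (Eventually.of_forall fun t => (h.tendsto_sq_mul_hW hA hB t).mul (hJlim t))
    · filter_upwards [hHm] with ε e
      exact (((e.comp (measurable_const_mul ε)).const_mul _).mul
        ((stronglyMeasurable_integral_innerFactor e hℓm).measurable.comp
          (measurable_const_mul ε))).aestronglyMeasurable
    · filter_upwards [hb, hJM, self_mem_nhdsWithin] with ε e1 e2 (e3 : 0 < ε)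
      refine Eventually.of_forall fun t => ?_
      have hM0 : 0 ≤ M := (norm_nonneg _).trans (e2 0)
      rw [norm_mul, norm_mul, norm_pow, Complex.norm_real, Real.norm_of_nonneg e3.le]
      have b1 : ε ^ 2 * ‖H ε (ε * t)‖ ≤ C * (1 + t ^ 2)⁻¹ := by
        calc ε ^ 2 * ‖H ε (ε * t)‖
            ≤ ε ^ 2 * (C * ((ε * t) ^ 2 / (ε ^ 2 + (ε * t) ^ 2) ^ 2) *
                Real.exp (-c * |ε * t|)) := by
              gcongr
              exact e1 _
          _ ≤ ε ^ 2 * (C * ((ε * t) ^ 2 / (ε ^ 2 + (ε * t) ^ 2) ^ 2) * 1) := by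
              gcongr
              rw [Real.exp_le_one_iff]
              nlinarith [abs_nonneg (ε * t)]
          _ = C * (t ^ 2 / (1 + t ^ 2) ^ 2) := by
              have : (1 + t ^ 2) ≠ 0 := by positivity
              rw [mul_pow, ← mul_one_add (ε ^ 2)]
              field_simp
          _ ≤ _ := by
              gcongr
              rw [div_le_iff₀ (by positivity)]
              field_simp
              linarith
      calc _ ≤ C * (1 + t ^ 2)⁻¹ * M := by
            gcongr
            exact e2 _
        _ = _ := by ring
  rw [integral_mul_const, integral_const_mul, integral_complex_ofReal, integral_sq_div_sq] at main
  convert (main.const_mul ((n : ℂ) + 1)).congr' ?_ using 2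
  · have hpi : (Real.pi : ℂ) ≠ 0 := Complex.ofReal_ne_zero.2 Real.pi_ne_zero
    push_cast
    field_simp
  · filter_upwards [hdom, self_mem_nhdsWithin] with ε e (e3 : 0 < ε)
    have hsc := Measure.integral_comp_mul_left (fun y => H ε y * J ε y) ε
    rw [abs_of_pos (inv_pos.2 e3)] at hsc
    have e5 : ∫ t : ℝ, ((ε : ℂ) ^ 2 * H ε (ε * t)) * J ε (ε * t) =
        ε * ∫ y : ℝ, H ε y * J ε y := by
      have e0 : (ε : ℂ) ≠ 0 := Complex.ofReal_ne_zero.2 e3.ne'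
      simp_rw [mul_assoc ((ε : ℂ) ^ 2)]
      rw [integral_const_mul, hsc, Complex.real_smul, Complex.ofReal_inv]
      field_simp
    have e6 : koornwinder (n + 1) p q Γ k ε ε (A - ε) (B - ε) =
        (n + 1) * ∫ y : ℝ, H ε y * J ε y :=
      integral_wt_succ (fun x => by simp only [Complex.ofReal_neg, neg_mul, lW_neg])
        (integrable_koornwinder h (n + 1) e)
    rw [e5, e6]
    ring

end ShiftedGamma

end

section

namespace ShiftedGamma

variable {p q k A B : ℂ} {Γ : ℂ → ℂ}

theorem tendsto_mul_gamma_two_mul (h : ShiftedGamma p q Γ) :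
    Tendsto (fun ε : ℝ => (ε : ℂ) * Γ (ε + ε)) (𝓝[>] 0) (𝓝 (p * Γ q / (4 * Real.pi))) := by
  have hpi : (Real.pi : ℂ) ≠ 0 := Complex.ofReal_ne_zero.2 Real.pi_ne_zero
  have hp := h.ne_left
  have hε := tendsto_ofReal_pos
  have h1 : Tendsto (fun ε : ℝ => Γ ((ε : ℂ) + ε + q)) (𝓝[>] 0) (𝓝 (Γ q)) :=
    (h.differentiableAt h.re_right).continuousAt.tendsto.comp
      (by simpa using (hε.add hε).add_const q)
  have h2 := tendsto_sn_mul_div (p := p) 2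
  have h3 := h1.div h2 (div_ne_zero (mul_ne_zero (mul_ne_zero two_ne_zero hpi) two_ne_zero) hp)
  convert h3.congr' ?_ using 2
  · field_simp
    ring
  · have h4 := h2.eventually_ne (div_ne_zero (mul_ne_zero (mul_ne_zero two_ne_zero hpi)
      two_ne_zero) hp)
    filter_upwards [h4, self_mem_nhdsWithin] with ε e (e3 : 0 < ε)
    have e0 : (ε : ℂ) ≠ 0 := Complex.ofReal_ne_zero.2 e3.ne'
    have e1 : sn p ((ε : ℂ) * 2) ≠ 0 := fun h => e (by rw [h, zero_div])
    have e2 := h.add_right (u := (ε : ℂ) + ε) (by simpa using e3)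
    rw [show 2 * Complex.sin (Real.pi * ((ε : ℂ) + ε) / p) = sn p (ε * 2) by
      unfold sn; rw [mul_two]] at e2
    rw [Pi.div_apply, e2]
    field_simp

theorem tendsto_mul_koornwinderValue_pinch (h : ShiftedGamma p q Γ) (n : ℕ) (hk : InCone p q k)
    (hA : InCone p q A) (hB : InCone p q B) (hsq : p * Γ q = (p * q) ^ ((1 : ℂ) / 2)) :
    Tendsto (fun ε : ℝ => (ε : ℂ) * koornwinderValue (n + 1) p q Γ k ε ε (A - ε) (B - ε)) (𝓝[>] 0)
      (𝓝 ((n + 1) * (p * q / (2 * Real.pi)) * (Γ A ^ 2 * Γ B ^ 2) *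
        koornwinderValue n p q Γ k k k A B)) := by
  have hpi : (Real.pi : ℂ) ≠ 0 := Complex.ofReal_ne_zero.2 Real.pi_ne_zero
  have hε := tendsto_ofReal_pos
  have hcont : ∀ {u : ℝ → ℂ} {u₀ : ℂ}, Tendsto u (𝓝[>] 0) (𝓝 u₀) → InCone p q u₀ →
      Tendsto (fun ε => Γ (u ε)) (𝓝[>] 0) (𝓝 (Γ u₀)) := fun hu hu0 =>
    (h.differentiableAt hu0.pos).continuousAt.tendsto.comp hu
  have l1 : Tendsto (fun ε : ℝ => ∏ j ∈ Finset.range n, Γ (ε + ε + (j + 1 : ℂ) * k)) (𝓝[>] 0)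
      (𝓝 (∏ j ∈ Finset.range n, Γ ((j + 1 : ℂ) * k))) :=
    tendsto_finsetProd _ fun j _ => hcont (by simpa using (hε.add hε).add_const ((j + 1 : ℂ) * k))
      (hk.nat_succ_mul j)
  have l2 : Tendsto (fun ε : ℝ => ∏ j ∈ Finset.range (n + 1), Γ (A - ε + (B - ε) + j * k)) (𝓝[>] 0)
      (𝓝 (∏ j ∈ Finset.range (n + 1), Γ (A + B + j * k))) :=
    tendsto_finsetProd _ fun j _ => hcont (by
      simpa using ((hε.const_sub A).add (hε.const_sub B)).add_const ((j : ℂ) * k))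
      ((hA.add hB).add_nat_mul hk j)
  have main := ((h.tendsto_mul_gamma_two_mul.mul (l1.mul l2)).const_mul
    (2 ^ (n + 1) * ((n + 1).factorial : ℂ) * ((p * q) ^ ((1 : ℂ) / 2)) ^ (n + 1) *
    ((∏ j ∈ Finset.range (n + 1), Γ ((j + 1) * k) / Γ k) *
      (∏ j ∈ Finset.range (n + 1), Γ (A + j * k) ^ 2 * Γ (B + j * k) ^ 2) /
      ∏ j ∈ Finset.range (n + 1), Γ (A + B + (2 * n - j) * k))))
  convert main.congr' ?_ using 2
  · have hS : ((p * q) ^ ((1 : ℂ) / 2)) ^ 2 = p * q := by rw [← hsq, h.sq_left_mul]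
    have hk0 := hk.gamma_ne_zero h
    have hAB := ((hA.add hB).add_nat_mul hk n).gamma_ne_zero h
    unfold koornwinderValue
    rw [hsq, Nat.factorial_succ, Finset.prod_range_succ' (fun j : ℕ => Γ ((j + 1) * k) / Γ k),
      Finset.prod_range_succ' (fun j : ℕ => Γ (A + j * k) ^ 2 * Γ (B + j * k) ^ 2),
      Finset.prod_range_succ (fun j : ℕ => Γ (A + B + (2 * n - j) * k)),
      Finset.prod_range_succ (fun j : ℕ => Γ (A + B + j * k))]
    have e1 : A + B + (2 * n - n) * k = A + B + n * k := by ring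
    have e2 : ∏ j ∈ Finset.range n, Γ ((j + 1) * k) / Γ k *
        (Γ (k + k + j * k) * Γ (A + B + j * k) * (Γ (k + A + j * k) * Γ (k + B + j * k) *
        (Γ (k + B + j * k) * Γ (k + A + j * k))) / Γ (k + k + A + B + (2 * n - j - 2) * k)) =
        (∏ j ∈ Finset.range n, Γ (((j + 1 : ℕ) + 1) * k) / Γ k) *
        (∏ j ∈ Finset.range n, Γ (A + (j + 1 : ℕ) * k) ^ 2 * Γ (B + (j + 1 : ℕ) * k) ^ 2) *
        ((∏ j ∈ Finset.range n, Γ ((j + 1) * k)) * (∏ j ∈ Finset.range n, Γ (A + B + j * k)) /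
        ∏ j ∈ Finset.range n, Γ (A + B + (2 * n - j) * k)) := by
      simp only [← Finset.prod_mul_distrib, ← Finset.prod_div_distrib]
      refine Finset.prod_congr rfl fun j _ => ?_
      push_cast
      rw [show k + k + j * k = (j + 1 + 1 : ℂ) * k by ring,
        show k + A + j * k = A + (j + 1) * k by ring, show k + B + j * k = B + (j + 1) * k by ring,
        show k + k + A + B + (2 * n - j - 2) * k = A + B + (2 * n - j) * k by ring]
      ring
    rw [e1, e2]
    generalize (p * q) ^ ((1 : ℂ) / 2) = S at hS ⊢
    generalize ∏ j ∈ Finset.range n, Γ (((j + 1 : ℕ) + 1) * k) / Γ k = P₁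
    generalize ∏ j ∈ Finset.range n, Γ (A + (j + 1 : ℕ) * k) ^ 2 * Γ (B + (j + 1 : ℕ) * k) ^ 2 = P₂
    generalize ∏ j ∈ Finset.range n, Γ ((j + 1) * k) = P₃
    generalize ∏ j ∈ Finset.range n, Γ (A + B + j * k) = P₄
    generalize ∏ j ∈ Finset.range n, Γ (A + B + (2 * n - j) * k) = P₅
    rw [← hS]
    push_cast
    simp only [zero_add, one_mul, zero_mul, add_zero, div_self hk0, mul_one]
    field_simp
    ring
  · refine Eventually.of_forall fun ε => ?_
    unfold koornwinderValue
    have e2 : ∏ j ∈ Finset.range (n + 1), Γ ((j + 1) * k) / Γ k *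
        (Γ (ε + ε + j * k) * Γ (A - ε + (B - ε) + j * k) * (Γ (ε + (A - ε) + j * k) *
        Γ (ε + (B - ε) + j * k) * (Γ (ε + (B - ε) + j * k) * Γ (ε + (A - ε) + j * k))) /
        Γ (ε + ε + (A - ε) + (B - ε) + (2 * (n + 1 : ℕ) - j - 2) * k)) =
        (∏ j ∈ Finset.range (n + 1), Γ ((j + 1) * k) / Γ k) *
        (∏ j ∈ Finset.range (n + 1), Γ (A + j * k) ^ 2 * Γ (B + j * k) ^ 2) *
        ((∏ j ∈ Finset.range (n + 1), Γ (ε + ε + j * k)) *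
          (∏ j ∈ Finset.range (n + 1), Γ (A - ε + (B - ε) + j * k)) /
        ∏ j ∈ Finset.range (n + 1), Γ (A + B + (2 * n - j) * k)) := by
      simp only [← Finset.prod_mul_distrib, ← Finset.prod_div_distrib]
      refine Finset.prod_congr rfl fun j _ => ?_
      push_cast
      rw [show (ε : ℂ) + (A - ε) + j * k = A + j * k by ring,
        show (ε : ℂ) + (B - ε) + j * k = B + j * k by ring,
        show (ε : ℂ) + ε + (A - ε) + (B - ε) + (2 * (n + 1) - j - 2) * k =
          A + B + (2 * n - j) * k by ring]
      ring
    beta_reduce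
    rw [e2, Finset.prod_range_succ' (fun j : ℕ => Γ (ε + ε + j * k))]
    push_cast
    simp only [zero_mul, add_zero]
    ring

end ShiftedGamma

end

section

namespace InCone

variable {p q k : ℂ}

/-- The closed ball of radius `R` around `u` lies in the cone. -/
def Deep (p q : ℂ) (R : ℝ) (u : ℂ) : Prop := ∀ s : ℂ, ‖s‖ ≤ R → InCone p q (u + s)

theorem Deep.inCone {R : ℝ} {u : ℂ} (h : Deep p q R u) (hR : 0 ≤ R) : InCone p q u := by
  simpa using h 0 (by simpa using hR)

theorem Deep.add {R r : ℝ} {u v : ℂ} (h : Deep p q (R + r) u) (hv : ‖v‖ ≤ r) :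
    Deep p q R (u + v) := fun s hs => by
  rw [add_assoc]
  exact h _ ((norm_add_le _ _).trans (by linarith))

theorem eventually_deep (hk : InCone p q k) (R : ℝ) (u : ℂ) :
    ∀ᶠ T : ℝ in atTop, Deep p q R (u + T * k) := by
  have h1 : Tendsto (fun T : ℝ => u.re - R + T * k.re) atTop atTop :=
    tendsto_atTop_add_const_left _ _ (tendsto_id.atTop_mul_const hk.pos)
  have h2 : Tendsto (fun T : ℝ => (u / (p * q)).re + R / ‖p * q‖ + T * (k / (p * q)).re)
      atTop atBot :=
    tendsto_atBot_add_const_left _ _ (tendsto_id.atTop_mul_const_of_neg hk.neg)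
  filter_upwards [h1.eventually_gt_atTop 0, h2.eventually_lt_atBot 0] with T e1 e2 s hs
  constructor
  · have := (abs_le.1 ((Complex.abs_re_le_norm s).trans hs)).1
    simp only [Complex.add_re, Complex.re_ofReal_mul]
    linarith
  · have h3 : (s / (p * q)).re ≤ R / ‖p * q‖ := (Complex.re_le_norm _).trans (by
      rw [norm_div]
      gcongr)
    rw [add_div, add_div, mul_div_assoc, Complex.add_re, Complex.add_re, Complex.re_ofReal_mul]
    linarith

end InCone

open InCone

namespace ShiftedGamma

variable {p q k a b c d : ℂ} {Γ : ℂ → ℂ}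

theorem koornwinder_eq_of_deep (h : ShiftedGamma p q Γ) {n : ℕ} (hk : InCone p q k)
    (hsq : p * Γ q = (p * q) ^ ((1 : ℂ) / 2)) (hpq : p.re * q.im - p.im * q.re ≠ 0)
    (ih : ∀ A B, InCone p q A → InCone p q B →
      koornwinder n p q Γ k k k A B = koornwinderValue n p q Γ k k k A B)
    {R : ℝ} (hR : R = ‖p / 2‖ + ‖q / 2‖) (ha : Deep p q R a) (hb : Deep p q R b)
    (hc : Deep p q R c) (hd : Deep p q R d) (hm : Deep p q R ((a + b) / 2))
    (hc' : Deep p q R (c + (b - a) / 2)) (hd' : Deep p q R (d - (b - a) / 2)) :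
    koornwinder (n + 1) p q Γ k a b c d = koornwinderValue (n + 1) p q Γ k a b c d := by
  subst hR
  have hR : 0 ≤ ‖p / 2‖ + ‖q / 2‖ := by positivity
  have hpi : (Real.pi : ℂ) ≠ 0 := Complex.ofReal_ne_zero.2 Real.pi_ne_zero
  have r1 := h.symm_koornwinder_ratio (n + 1) (a := a) (b := c) (c := b) (d := d) hk hpq
    (fun s hs => ⟨ha s hs, hc s hs, hb s hs, hd s hs⟩) (s := (b - a) / 2)
  rw [show a + (b - a) / 2 = (a + b) / 2 by ring, show b - (b - a) / 2 = (a + b) / 2 by ring] at r1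
  replace r1 := r1 (hm.inCone hR).pos (hc'.inCone hR).pos (hm.inCone hR).pos (hd'.inCone hR).pos
  rw [koornwinder_swap_mid, koornwinder_swap_mid _ _ _ _ _ a, koornwinderValue_swap_mid,
    koornwinderValue_swap_mid (a := (a + b) / 2)] at r1
  generalize (a + b) / 2 = m at *
  generalize c + (b - a) / 2 = c' at *
  generalize d - (b - a) / 2 = d' at *
  have hA := (hc'.inCone hR).add (hm.inCone hR)
  have hB := (hd'.inCone hR).add (hm.inCone hR)
  have hid : Tendsto (fun ε : ℝ => ε) (𝓝[>] 0) (𝓝 0) := tendsto_id.mono_left nhdsWithin_le_nhds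
  have r2 : ∀ᶠ ε : ℝ in 𝓝[>] 0,
      koornwinder (n + 1) p q Γ k ε ε (c' + m - ε) (d' + m - ε) *
          koornwinderValue (n + 1) p q Γ k m m c' d' =
        koornwinder (n + 1) p q Γ k m m c' d' *
          koornwinderValue (n + 1) p q Γ k ε ε (c' + m - ε) (d' + m - ε) := by
    filter_upwards [self_mem_nhdsWithin, hid.eventually_lt_const hA.pos,
      hid.eventually_lt_const hB.pos] with ε (e1 : 0 < ε) e2 e3
    have r := h.symm_koornwinder_ratio (n + 1) (a := m) (b := m) (c := c') (d := d') hk hpq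
      (fun s hs => ⟨hm s hs, hm s hs, hc' s hs, hd' s hs⟩) (s := ε - m)
    rw [add_sub_cancel, ← sub_add, ← sub_add, sub_add_eq_add_sub, sub_add_eq_add_sub] at r
    exact r (by simpa using e1) (by simpa using e1) (by simpa using e2) (by simpa using e3)
  have l1 := (h.tendsto_mul_koornwinder_pinch n hk hA.pos hB.pos
    (re_sub_neg h.re_left h.re_right (hA.add hB).neg)).mul_const
      (koornwinderValue (n + 1) p q Γ k m m c' d')
  have l2 := (h.tendsto_mul_koornwinderValue_pinch n hk hA hB hsq).const_mul
    (koornwinder (n + 1) p q Γ k m m c' d')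
  have key := tendsto_nhds_unique_of_eventuallyEq l1 l2 (by
    filter_upwards [r2] with ε e
    rw [mul_assoc, e]
    ring)
  rw [ih _ _ hA hB, mul_comm] at key
  have hne : (n + 1) * (p * q / (2 * Real.pi)) * (Γ (c' + m) ^ 2 * Γ (d' + m) ^ 2) *
      koornwinderValue n p q Γ k k k (c' + m) (d' + m) ≠ 0 :=
    mul_ne_zero (mul_ne_zero (mul_ne_zero (Nat.cast_add_one_ne_zero n)
      (div_ne_zero (mul_ne_zero h.ne_left h.ne_right) (mul_ne_zero two_ne_zero hpi)))
      (mul_ne_zero (pow_ne_zero 2 (hA.gamma_ne_zero h)) (pow_ne_zero 2 (hB.gamma_ne_zero h))))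
      (koornwinderValue_ne_zero h n hk hk hk hA hB)
  have key' := mul_right_cancel₀ hne key
  rw [← key'] at r1
  have hne' := koornwinderValue_ne_zero h (n + 1) hk (hm.inCone hR) (hm.inCone hR)
    (hc'.inCone hR) (hd'.inCone hR)
  exact (mul_left_cancel₀ hne' (r1.trans (mul_comm _ _))).symm

theorem isOpen_convex_re_pos (u v : ℂ) :
    IsOpen {z : ℂ | 0 < (u + z * v).re} ∧ Convex ℝ {z : ℂ | 0 < (u + z * v).re} := by
  refine ⟨isOpen_lt (by fun_prop) (by fun_prop), ?_⟩
  intro x (hx : 0 < (u + x * v).re) y (hy : 0 < (u + y * v).re) s t hs ht hst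
  have hst' : (s : ℂ) + t = 1 := by exact_mod_cast hst
  have e : u + (s • x + t • y) * v = s * (u + x * v) + t * (u + y * v) := by
    simp only [Complex.real_smul]
    linear_combination (-u) * hst'
  show 0 < (u + (s • x + t • y) * v).re
  rw [e, Complex.add_re, Complex.re_ofReal_mul, Complex.re_ofReal_mul]
  rcases hs.eq_or_lt with rfl | hs
  · rw [zero_add] at hst
    simpa [hst] using hy
  · exact add_pos_of_pos_of_nonneg (mul_pos hs hx) (mul_nonneg ht hy.le)

theorem koornwinder_eq (h : ShiftedGamma p q Γ) (hsq : p * Γ q = (p * q) ^ ((1 : ℂ) / 2))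
    (hpq : p.re * q.im - p.im * q.re ≠ 0) (n : ℕ) :
    ∀ {a b c d : ℂ}, KoornwinderDom p q k a b c d →
      koornwinder n p q Γ k a b c d = koornwinderValue n p q Γ k a b c d := by
  induction n with
  | zero =>
    intro a b c d _
    simp [koornwinder, koornwinderValue, wt, integral_const, volume_pi,
      Measure.real]
  | succ n ih =>
    intro a b c d hD
    have hk := hD.inCone
    have ih' : ∀ A B, InCone p q A → InCone p q B →
        koornwinder n p q Γ k k k A B = koornwinderValue n p q Γ k k k A B := fun A B hA hB =>
      ih (KoornwinderDom.of_inCone h.re_left h.re_right hk hk hk hA hB)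
    set S : ℂ → ℂ → Set ℂ := fun u v => {z | 0 < (u + z * v).re} with hS
    set U := S a k ∩ (S b k ∩ (S c k ∩ (S d k ∩
      S (-((a + b + c + d - p - q) / (p * q))) (-(4 * (k / (p * q))))))) with hU
    have hUo : IsOpen U := (isOpen_convex_re_pos _ _).1.inter <| (isOpen_convex_re_pos _ _).1.inter <|
      (isOpen_convex_re_pos _ _).1.inter <| (isOpen_convex_re_pos _ _).1.inter
        (isOpen_convex_re_pos _ _).1
    have hUc : Convex ℝ U := (isOpen_convex_re_pos _ _).2.inter <| (isOpen_convex_re_pos _ _).2.inter <|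
      (isOpen_convex_re_pos _ _).2.inter <| (isOpen_convex_re_pos _ _).2.inter
        (isOpen_convex_re_pos _ _).2
    have hUiff : ∀ z, z ∈ U ↔ KoornwinderDom p q k (a + z * k) (b + z * k) (c + z * k)
        (d + z * k) := fun z => by
      have e : (-((a + b + c + d - p - q) / (p * q)) + z * -(4 * (k / (p * q)))).re =
          -((a + z * k + (b + z * k) + (c + z * k) + (d + z * k) - p - q) / (p * q)).re := by
        rw [← Complex.neg_re]
        congr 1
        ring
      simp only [hU, hS, mem_inter_iff, Set.mem_ofPred_eq, e, neg_pos]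
      exact ⟨fun ⟨h1, h2, h3, h4, h5⟩ => ⟨h1, h2, h3, h4, hk.pos, hk.neg, h5⟩,
        fun h => ⟨h.ha, h.hb, h.hc, h.hd, h.hs⟩⟩
    have h0 : (0 : ℂ) ∈ U := by
      rw [hUiff]
      simpa using hD
    set R := ‖p / 2‖ + ‖q / 2‖ with hR
    have hR0 : 0 ≤ R := by positivity
    obtain ⟨T, t1, t2, t3, t4, t5, t6, t7⟩ := ((hk.eventually_deep (R + ‖k‖) a).and <|
      (hk.eventually_deep (R + ‖k‖) b).and <| (hk.eventually_deep (R + ‖k‖) c).and <|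
      (hk.eventually_deep (R + ‖k‖) d).and <| (hk.eventually_deep (R + ‖k‖) ((a + b) / 2)).and <|
      (hk.eventually_deep (R + ‖k‖) (c + (b - a) / 2)).and
      (hk.eventually_deep (R + ‖k‖) (d - (b - a) / 2))).exists
    have key : ∀ z ∈ Metric.ball (T : ℂ) 1, z ∈ U ∧
        koornwinder (n + 1) p q Γ k (a + z * k) (b + z * k) (c + z * k) (d + z * k) =
        koornwinderValue (n + 1) p q Γ k (a + z * k) (b + z * k) (c + z * k) (d + z * k) := by
      intro z hz
      rw [mem_ball_iff_norm] at hz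
      have hz' : ‖(z - T) * k‖ ≤ ‖k‖ := by
        rw [norm_mul]
        exact mul_le_of_le_one_left (norm_nonneg _) hz.le
      have g : ∀ {u : ℂ}, Deep p q (R + ‖k‖) (u + T * k) → Deep p q R (u + z * k) := fun {u} hu => by
        have := hu.add hz'
        rwa [show u + T * k + (z - T) * k = u + z * k by ring] at this
      refine ⟨?_, h.koornwinder_eq_of_deep hk hsq hpq ih' hR (g t1) (g t2) (g t3) (g t4) ?_ ?_ ?_⟩
      · rw [hUiff]
        exact KoornwinderDom.of_inCone h.re_left h.re_right hk ((g t1).inCone hR0)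
          ((g t2).inCone hR0) ((g t3).inCone hR0) ((g t4).inCone hR0)
      · convert g t5 using 1
        ring
      · convert g t6 using 1
        ring
      · convert g t7 using 1
        ring
    have hF := (differentiableOn_koornwinder h (n + 1) hUo (a := fun z => a + z * k)
      (b := fun z => b + z * k) (c := fun z => c + z * k) (d := fun z => d + z * k) (by fun_prop)
      (by fun_prop) (by fun_prop) (by fun_prop) fun z hz => (hUiff z).1 hz).analyticOnNhd hUo
    have hG := (differentiableOn_koornwinderValue h (n + 1) (a := fun z => a + z * k)
      (b := fun z => b + z * k) (c := fun z => c + z * k) (d := fun z => d + z * k) (by fun_prop)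
      (by fun_prop) (by fun_prop) (by fun_prop) fun z hz => (hUiff z).1 hz).analyticOnNhd hUo
    have := hF.eqOn_of_preconnected_of_eventuallyEq hG hUc.isPreconnected
      (key T (Metric.mem_ball_self one_pos)).1 (by
        filter_upwards [Metric.ball_mem_nhds (T : ℂ) one_pos] with z hz
        exact (key z hz).2) h0
    simpa using this

end ShiftedGamma

section families

variable {p q k a b c d : ℂ} {Γ : ℂ → ℂ → ℂ → ℂ}

theorem tendsto_koornwinderValue {ι : Type*} {l : Filter ι} [l.IsCountablyGenerated] {P : ι → ℂ}
    (hΓ : ∀ p q : ℂ, 0 < p.re → 0 < q.re → ShiftedGamma p q (Γ p q)) (hP0 : ∀ t, 0 < (P t).re)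
    (hP : Tendsto P l (𝓝 p)) (hp : 0 < p.re) (hq : 0 < q.re) (n : ℕ)
    (hD : KoornwinderDom p q k a b c d) :
    Tendsto (fun t => koornwinderValue n (P t) q (Γ (P t) q) k a b c d) l
      (𝓝 (koornwinderValue n p q (Γ p q) k a b c d)) := by
  have h := hΓ p q hp hq
  have g : ∀ {u : ℂ}, 0 < u.re → Tendsto (fun t => Γ (P t) q u) l (𝓝 (Γ p q u)) := fun hu =>
    ShiftedGamma.tendsto_of_tendsto (fun t => hΓ _ _ (hP0 t) hq) h hP tendsto_const_nhds
      tendsto_const_nhds hu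
  have g' : ∀ {u v : ℂ} (j : ℕ), 0 < u.re → 0 < v.re →
      Tendsto (fun t => Γ (P t) q (u + v + j * k)) l (𝓝 (Γ p q (u + v + j * k))) :=
    fun j hu hv => g (re_add_nat_mul_pos (by rw [Complex.add_re]; exact add_pos hu hv) hD.hk j)
  have hk := hD.inCone
  have hpow : Tendsto (fun t => (P t * q) ^ ((1 : ℂ) / 2)) l (𝓝 ((p * q) ^ ((1 : ℂ) / 2))) :=
    (hP.mul_const q).cpow tendsto_const_nhds (ShiftedGamma.mul_mem_slitPlane hp hq)
  unfold koornwinderValue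
  refine ((hpow.pow n).const_mul _).mul (tendsto_finsetProd _ fun j hj => ?_)
  have hj := hD.denom h (Finset.mem_range.1 hj)
  exact ((g (hk.nat_succ_mul j).pos).div (g hk.pos) (hk.gamma_ne_zero h)).mul
    ((((g' j hD.ha hD.hb).mul (g' j hD.hc hD.hd)).mul (((g' j hD.ha hD.hc).mul
      (g' j hD.hb hD.hd)).mul ((g' j hD.ha hD.hd).mul (g' j hD.hb hD.hc)))).div (g hj.1) hj.2.2)

/-- Evaluation of the hyperbolic Koornwinder-type integral on its whole parameter domain. -/
theorem koornwinder_eq_koornwinderValue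
    (hΓ : ∀ p q : ℂ, 0 < p.re → 0 < q.re → ShiftedGamma p q (Γ p q)) (hp : 0 < p.re)
    (hq : 0 < q.re) (n : ℕ) (hD : KoornwinderDom p q k a b c d) :
    koornwinder n p q (Γ p q) k a b c d = koornwinderValue n p q (Γ p q) k a b c d := by
  by_cases hpq : p.re * q.im - p.im * q.re = 0
  · set P : ℝ → ℂ := fun t => p + t * Complex.I with hPdef
    have hPre : ∀ t, (P t).re = p.re := fun t => by simp [hPdef]
    have hP0 : ∀ t, 0 < (P t).re := fun t => by rwa [hPre]
    have hP : Tendsto P (𝓝[>] 0) (𝓝 p) := by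
      simpa using (ShiftedGamma.tendsto_ofReal_pos.mul_const Complex.I).const_add p
    have hp0 : p ≠ 0 := fun h => by simp [h] at hp
    have hq0 : q ≠ 0 := fun h => by simp [h] at hq
    have hdiv : ∀ {u : ℝ → ℂ} {u₀ : ℂ}, Tendsto u (𝓝[>] 0) (𝓝 u₀) → (u₀ / (p * q)).re < 0 →
        ∀ᶠ t in 𝓝[>] 0, (u t / (P t * q)).re < 0 := fun hu hu0 =>
      ((Complex.continuous_re.tendsto _).comp
        (hu.div (hP.mul_const q) (mul_ne_zero hp0 hq0))).eventually_lt_const hu0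
    refine tendsto_nhds_unique_of_eventuallyEq (l := 𝓝[>] (0 : ℝ)) (tendsto_koornwinder n
      (fun t => hΓ _ _ (hP0 t) hq) (hΓ p q hp hq) hP tendsto_const_nhds tendsto_const_nhds
      tendsto_const_nhds tendsto_const_nhds tendsto_const_nhds tendsto_const_nhds hD)
      (tendsto_koornwinderValue hΓ hP0 hP hp hq n hD) ?_
    filter_upwards [self_mem_nhdsWithin, hdiv tendsto_const_nhds hD.hk',
      hdiv ((hP.const_sub (a + b + c + d)).sub_const q) hD.hs] with t (ht : 0 < t) e1 e2
    refine (hΓ _ _ (hP0 t) hq).koornwinder_eq (ShiftedGamma.left_mul_eq_cpow hΓ (hP0 t) hq) ?_ n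
      ⟨hD.ha, hD.hb, hD.hc, hD.hd, hD.hk, e1, e2⟩
    have : (P t).im = p.im + t := by simp [hPdef]
    rw [hPre, this]
    nlinarith [mul_pos ht hq]
  · exact (hΓ p q hp hq).koornwinder_eq (ShiftedGamma.left_mul_eq_cpow hΓ hp hq) hpq n hD

end families

end

section

namespace ShiftedGamma

variable {p q : ℂ} {Γ : ℂ → ℂ}

theorem reflection_mul_reflection_neg (h : ShiftedGamma p q Γ) {ζ : ℂ} (hζ : ζ.re = 0) :
    Γ (p + q - ζ) * Γ (p + q + ζ) = -(sn p ζ * sn q ζ) := by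
  have h1 := h.add_left (u := q - ζ) (by simpa [hζ] using h.re_right)
  have h2 := h.add_right (u := p + ζ) (by simpa [hζ] using h.re_left)
  have h3 := h.mul_sub_self (u := p + ζ) (by simpa [hζ] using h.re_left)
    (by simpa [hζ] using h.re_right)
  rw [show p + q - (p + ζ) = q - ζ by ring] at h3
  rw [show Real.pi * (q - ζ) / q = Real.pi - Real.pi * ζ / q by
    have := h.ne_right
    field_simp, Complex.sin_pi_sub, show q - ζ + p = p + q - ζ by ring] at h1
  rw [show Real.pi * (p + ζ) / p = Real.pi * ζ / p + Real.pi by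
    have := h.ne_left
    field_simp
    ring, Complex.sin_add_pi, show p + ζ + q = p + q + ζ by ring] at h2
  rw [h1, h2]
  unfold sn
  linear_combination (-4 * Complex.sin (Real.pi * ζ / p) * Complex.sin (Real.pi * ζ / q)) * h3

theorem two_mul_cos_mul_gPair (h : ShiftedGamma p q Γ) {ζ : ℂ} (hζ : ζ.re = 0) :
    2 * Complex.cos (Real.pi * ζ / p) * gPair Γ (p / 2) (p / 2) ζ = 1 := by
  have hp2 : (p / 2).re = p.re / 2 := by simp
  have h1 := h.add_right (u := p / 2 + ζ) (by
    rw [Complex.add_re, hζ, hp2]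
    linarith [h.re_left])
  have h2 := h.mul_sub_self (u := p / 2 - ζ) (by
    rw [Complex.sub_re, hζ, hp2]
    linarith [h.re_left]) (by
    rw [Complex.sub_re, hζ, hp2, Complex.add_re]
    linarith [h.re_left, h.re_right])
  rw [show Real.pi * (p / 2 + ζ) / p = Real.pi * ζ / p + Real.pi / 2 by
    have := h.ne_left
    field_simp
    ring, Complex.sin_add_pi_div_two] at h1
  rw [show p + q - (p / 2 - ζ) = p / 2 + ζ + q by ring, h1] at h2
  unfold gPair
  linear_combination h2

theorem sn_two_mul (q ζ : ℂ) : sn q (2 * ζ) = 2 * Complex.cos (Real.pi * ζ / q) * sn q ζ := by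
  unfold sn
  rw [show Real.pi * (2 * ζ) / q = 2 * (Real.pi * ζ / q) by ring, Complex.sin_two_mul]
  ring

theorem hW_half_periods (h : ShiftedGamma p q Γ) (a : ℂ) {ζ : ℂ} (hζ : ζ.re = 0) :
    hW p q Γ a (p / 2) (q / 2) ((p + q) / 2) ζ = lW p q Γ a ζ := by
  have h1 := h.two_mul_cos_mul_gPair hζ
  have h2 := h.symm.two_mul_cos_mul_gPair hζ
  have hpq : ((p + q) / 2 + ζ).re = (p.re + q.re) / 2 := by simp [hζ]
  have h3 := h.mul_sub_self (u := (p + q) / 2 + ζ) (by linarith [h.re_left, h.re_right])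
    (by rw [hpq, Complex.add_re]; linarith [h.re_left, h.re_right])
  rw [show p + q - ((p + q) / 2 + ζ) = (p + q) / 2 - ζ by ring] at h3
  change gPair Γ _ _ ζ = 1 at h3
  unfold hW lW
  rw [h3, sn_two_mul, sn_two_mul]
  linear_combination
    (-sn p ζ * sn q ζ * gPair Γ a a ζ * 2 * Complex.cos (Real.pi * ζ / q) *
      gPair Γ (q / 2) (q / 2) ζ) * h1 - sn p ζ * sn q ζ * gPair Γ a a ζ * h2

/-- The exceptional set of real points where the reflection equation for `Γ (a ± x * I)` fails. -/
def badSet (p q a : ℂ) : Set ℝ :=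
  range (fun m : ℕ × ℕ => (m.1 * p + m.2 * q - (a - p - q)).im) ∪
    range (fun m : ℕ × ℕ => -(m.1 * p + m.2 * q - (a - p - q)).im)

theorem countable_badSet (p q a : ℂ) : (badSet p q a).Countable :=
  (countable_range _).union (countable_range _)

theorem reflection_ratio (h : ShiftedGamma p q Γ) {a : ℂ} (ha : 0 < a.re) {x : ℝ}
    (hx : x ∉ badSet p q a) :
    Γ (p + q - x * Complex.I) / Γ (p + q - (a + x * Complex.I)) *
      (Γ (p + q + x * Complex.I) / Γ (p + q - (a - x * Complex.I))) =
      lW p q Γ a (x * Complex.I) := by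
  have e1 := h.mul_sub_self_of_forall_ne (u := a + x * Complex.I) (by simpa using ha)
    fun m n e => hx (Or.inl ⟨(m, n), by
      have := congrArg Complex.im (show (x : ℂ) * Complex.I = m * p + n * q - (a - p - q) by
        linear_combination e)
      simpa using this.symm⟩)
  have e2 := h.mul_sub_self_of_forall_ne (u := a - x * Complex.I) (by simpa using ha)
    fun m n e => hx (Or.inr ⟨(m, n), by
      have := congrArg Complex.im (show -((x : ℂ) * Complex.I) = m * p + n * q - (a - p - q) by
        linear_combination e)
      rw [Complex.neg_im, Complex.im_ofReal_mul, Complex.I_im, mul_one] at this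
      exact (neg_eq_iff_eq_neg.1 this).symm⟩)
  rw [div_eq_mul_inv, div_eq_mul_inv, ← eq_inv_of_mul_eq_one_left e1,
    ← eq_inv_of_mul_eq_one_left e2, mul_mul_mul_comm,
    h.reflection_mul_reflection_neg (by simp)]
  rfl

end ShiftedGamma

theorem ae_bcShort_mul_bcLong_eq {n : ℕ} {p q a k : ℂ} {Γ : ℂ → ℂ} (h : ShiftedGamma p q Γ)
    (ha : 0 < a.re) (hk : 0 < k.re) :
    (fun v : Fin n → ℝ =>
      bcShort (fun x => Γ (p + q - x * Complex.I) / Γ (p + q - (a + x * Complex.I))) v *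
        bcLong (fun x => Γ (p + q - x * Complex.I) / Γ (p + q - (k + x * Complex.I))) v) =ᵐ[volume]
    wt (fun x => hW p q Γ a (p / 2) (q / 2) ((p + q) / 2) (x * Complex.I))
      (fun x => lW p q Γ k (x * Complex.I)) (fun x => lW p q Γ k (x * Complex.I)) := by
  filter_upwards [ae_notMem_countable ((ShiftedGamma.countable_badSet p q a).union
    (ShiftedGamma.countable_badSet p q k))] with v ⟨hv1, hv2, hv3⟩
  unfold bcShort bcLong wt
  have e : ∀ {b : ℂ} {x : ℝ}, 0 < b.re → x ∉ ShiftedGamma.badSet p q b →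
      Γ (p + q - x * Complex.I) / Γ (p + q - (b + x * Complex.I)) *
        (Γ (p + q - (-x : ℝ) * Complex.I) / Γ (p + q - (b + (-x : ℝ) * Complex.I))) =
        lW p q Γ b (x * Complex.I) := fun {b x} hb hx => by
    rw [← h.reflection_ratio hb hx, Complex.ofReal_neg, neg_mul, sub_neg_eq_add, ← sub_eq_add_neg]
  congr 1
  · refine Finset.prod_congr rfl fun j _ => ?_
    rw [e ha fun hx => hv1 j (Or.inl hx), ← h.hW_half_periods a (by simp)]
  · refine Finset.prod_congr rfl fun r hr => ?_
    have hne : r.1 ≠ r.2 := (Finset.mem_filter.1 hr).2.ne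
    have e1 := e hk fun hx => hv2 _ _ hne (Or.inr hx)
    have e2 := e hk fun hx => hv3 _ _ hne (Or.inr hx)
    rw [neg_sub] at e2
    rw [mul_assoc, e1, e2]

theorem prod_filter_lt_fin_four {M : Type*} [CommMonoid M] (F : Fin 4 × Fin 4 → M) :
    ∏ r ∈ Finset.univ.filter (fun r : Fin 4 × Fin 4 => r.1 < r.2), F r =
      F (0, 1) * F (2, 3) * (F (0, 2) * F (1, 3) * (F (0, 3) * F (1, 2))) := by
  rw [show Finset.univ.filter (fun r : Fin 4 × Fin 4 => r.1 < r.2) =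
    {(0, 1), (2, 3), (0, 2), (1, 3), (0, 3), (1, 2)} by
      ext ⟨i, j⟩
      fin_cases i <;> fin_cases j <;> simp]
  simp [mul_assoc]

theorem koornwinderValue_eq_NBC {G : ℂ → ℂ → ℂ → ℂ} {p q k a b c d : ℂ}
    (h : ShiftedGamma p q (fun u => G p q (Complex.I * (u - (p + q) / 2)))) (n : ℕ)
    (hD : KoornwinderDom p q k a b c d)
    (hpair : ∀ x ∈ ({a + b, c + d, a + c, b + d, a + d, b + c} : Set ℂ),
      ((x - p - q) / (p * q)).re < 0) :
    koornwinderValue n p q (fun u => G p q (Complex.I * (u - (p + q) / 2))) k a b c d =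
      NBC G n p q ![-a, -b, -c, -d] (-k) := by
  set Γ : ℂ → ℂ := fun u => G p q (Complex.I * (u - (p + q) / 2)) with hΓ
  have key : ∀ (Z : ℂ) {X : ℂ}, 0 < X.re → ((X - p - q) / (p * q)).re < 0 →
      Z = (p + q) / 2 - X → G p q (Complex.I * Z) = (Γ X)⁻¹ := fun Z X h1 h2 hZ => by
    rw [← eq_inv_of_mul_eq_one_right (h.mul_sub_self_of_forall_ne h1 (h.forall_ne_of_re_neg h2)),
      hZ]
    congr 2
    ring
  unfold koornwinderValue NBC
  congr 1
  refine Finset.prod_congr rfl fun j hj => ?_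
  have hsub := fun {u : ℂ} => InCone.re_sub_neg (u := u) h.re_left h.re_right
  obtain ⟨d1, d2, -⟩ := hD.denom h (Finset.mem_range.1 hj)
  have hk1 := hD.inCone.nat_succ_mul j
  have hpos : ∀ {x y : ℂ}, 0 < x.re → 0 < y.re → 0 < (x + y + j * k).re := fun hx hy =>
    re_add_nat_mul_pos (by rw [Complex.add_re]; exact add_pos hx hy) hD.hk j
  have hneg : ∀ {x : ℂ}, ((x - p - q) / (p * q)).re < 0 →
      ((x + j * k - p - q) / (p * q)).re < 0 := by
    intro x hx
    rw [show (x + j * k - p - q) / (p * q) = (x - p - q) / (p * q) + j * (k / (p * q)) by ring,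
      Complex.add_re, ← Complex.ofReal_natCast, Complex.re_ofReal_mul]
    have := mul_nonneg (Nat.cast_nonneg (α := ℝ) j) (neg_nonneg.2 hD.hk'.le)
    linarith
  rw [prod_filter_lt_fin_four]
  simp only [Matrix.cons_val]
  rw [key ((p + q) / 2 + -k) hD.hk (hsub hD.hk') (by ring),
    key ((p + q) / 2 + (2 * n - j - 2) * -k + (-a + -b + -c + -d)) d1 d2 (by ring),
    key ((p + q) / 2 + (j + 1) * -k) hk1.pos (hsub hk1.neg) (by ring),
    key ((p + q) / 2 + j * -k + -a + -b) (hpos hD.ha hD.hb) (hneg (hpair _ (by simp)))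
      (by ring),
    key ((p + q) / 2 + j * -k + -c + -d) (hpos hD.hc hD.hd) (hneg (hpair _ (by simp)))
      (by ring),
    key ((p + q) / 2 + j * -k + -a + -c) (hpos hD.ha hD.hc) (hneg (hpair _ (by simp)))
      (by ring),
    key ((p + q) / 2 + j * -k + -b + -d) (hpos hD.hb hD.hd) (hneg (hpair _ (by simp)))
      (by ring),
    key ((p + q) / 2 + j * -k + -a + -d) (hpos hD.ha hD.hd) (hneg (hpair _ (by simp)))
      (by ring),
    key ((p + q) / 2 + j * -k + -b + -c) (hpos hD.hb hD.hc) (hneg (hpair _ (by simp)))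
      (by ring)]
  simp only [div_eq_mul_inv, mul_inv, inv_inv]
  ring

end

end

/-- **Generalized Cherednik–Macdonald identity for `Σ` of type `B_n`, case (i)**:
the integral equals `N_BC(ω₊,ω₋; γ = (k_s,-ω₊/2,-ω₋/2,-ω), κ = k_l)`. -/
theorem generalized_CM_Bn_case_i (n : ℕ) (hn : 2 ≤ n)
    (G : ℂ → ℂ → ℂ → ℂ)
    (hG : ∀ a b : ℂ, 0 < a.re → 0 < b.re → IsHypGamma a b (G a b))
    (op om ks kl : ℂ) (hop : 0 < op.re) (hom : 0 < om.re) (him : (op*om).im < 0)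
    (hks1 : ks.re < 0) (hks2 : ∃ w : ℂ, 0 < w.re ∧ ks = op*om*w)
    (hkl1 : kl.re < 0) (hkl2 : ∃ w : ℂ, 0 < w.re ∧ kl = op*om*w) :
    Integrable (fun v : Fin n → ℝ =>
      bcShort (fun x => G op om ((x:ℂ) + Complex.I*(op+om)/2) /
          G op om ((x:ℂ) + Complex.I*(ks+(op+om)/2))) v *
        bcLong (fun x => G op om ((x:ℂ) + Complex.I*(op+om)/2) /
          G op om ((x:ℂ) + Complex.I*(kl+(op+om)/2))) v) ∧
    ∫ v : Fin n → ℝ,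
        (bcShort (fun x => G op om ((x:ℂ) + Complex.I*(op+om)/2) /
            G op om ((x:ℂ) + Complex.I*(ks+(op+om)/2))) v *
          bcLong (fun x => G op om ((x:ℂ) + Complex.I*(op+om)/2) /
            G op om ((x:ℂ) + Complex.I*(kl+(op+om)/2))) v) =
      NBC G n op om ![ks, -op/2, -om/2, -(op+om)/2] kl := by
  have hpq : op * om ≠ 0 := fun h => by simp [h] at him
  have hre : ∀ {κ : ℂ}, (∃ w : ℂ, 0 < w.re ∧ κ = op * om * w) → (-κ / (op * om)).re < 0 := by
    rintro κ ⟨w, hw, rfl⟩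
    rw [neg_div, mul_div_cancel_left₀ _ hpq, Complex.neg_re]
    linarith
  have hΓ : ∀ p q : ℂ, 0 < p.re → 0 < q.re →
      ShiftedGamma p q (fun u => G p q (Complex.I * (u - (p + q) / 2))) :=
    fun p q hp hq => (hG p q hp hq).shiftedGamma hp hq
  have h := hΓ op om hop hom
  have hop0 := h.ne_left
  have hom0 := h.ne_right
  have hks : 0 < (-ks).re := by simpa using hks1
  have hkl : 0 < (-kl).re := by simpa using hkl1
  have hD : KoornwinderDom op om (-kl) (-ks) (op / 2) (om / 2) ((op + om) / 2) := by
    refine ⟨hks, by simpa using hop, by simpa using hom, ?_, hkl, hre hkl2, ?_⟩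
    · rw [show (op + om) / 2 = op / 2 + om / 2 by ring, Complex.add_re]
      exact add_pos (by simpa using hop) (by simpa using hom)
    · rw [show -ks + op / 2 + om / 2 + (op + om) / 2 - op - om = -ks by ring]
      exact hre hks2
  have hae := ae_bcShort_mul_bcLong_eq (n := n) h hks hkl
  have e : ∀ x κ : ℂ, G op om (x + Complex.I * (op + om) / 2) /
      G op om (x + Complex.I * (κ + (op + om) / 2)) =
      G op om (Complex.I * (op + om - x * Complex.I - (op + om) / 2)) /
        G op om (Complex.I * (op + om - (-κ + x * Complex.I) - (op + om) / 2)) := fun x κ => by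
    congr 2 <;> linear_combination x * Complex.I_sq
  simp only [e]
  refine ⟨(integrable_koornwinder h n hD).congr hae.symm, ?_⟩
  rw [integral_congr_ae hae]
  refine (koornwinder_eq_koornwinderValue hΓ hop hom n hD).trans
    ((koornwinderValue_eq_NBC h n hD ?_).trans ?_)
  · have h1 := ShiftedGamma.re_div_pos hop
    have h2 := ShiftedGamma.re_div_pos hom
    have h3 := hre hks2
    have hr : ∀ x (r s t : ℝ), 0 ≤ r → s ≤ 0 → t ≤ 0 → s + t < 0 →
        x = r * (-ks) + op + om + (s * om + t * op) →
        ((x - op - om) / (op * om)).re < 0 := by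
      rintro x r s t hr hs ht hst rfl
      rw [show (r * (-ks) + op + om + (s * om + t * op) - op - om) / (op * om) =
        r * (-ks / (op * om)) + (s * (1 / op) + t * (1 / om)) by
          field_simp
          ring, Complex.add_re, Complex.add_re, Complex.re_ofReal_mul, Complex.re_ofReal_mul,
        Complex.re_ofReal_mul]
      have h4 := mul_nonneg hr (neg_nonneg.2 h3.le)
      have h5 := mul_nonneg (neg_nonneg.2 hs) h1.le
      have h6 := mul_nonneg (neg_nonneg.2 ht) h2.le
      rcases hs.lt_or_eq with hs | rfl
      · linarith [mul_pos (neg_pos.2 hs) h1]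
      · linarith [mul_pos (neg_pos.2 ((zero_add t).symm.trans_lt hst)) h2]
    rintro x (rfl | rfl | rfl | rfl | rfl | rfl)
    · exact hr _ 1 (-1) (-1 / 2) (by norm_num) (by norm_num) (by norm_num) (by norm_num)
        (by push_cast; ring)
    · exact hr _ 0 0 (-1 / 2) (by norm_num) (by norm_num) (by norm_num) (by norm_num)
        (by push_cast; ring)
    · exact hr _ 1 (-1 / 2) (-1) (by norm_num) (by norm_num) (by norm_num) (by norm_num)
        (by push_cast; ring)
    · exact hr _ 0 (-1 / 2) 0 (by norm_num) (by norm_num) (by norm_num) (by norm_num)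
        (by push_cast; ring)
    · exact hr _ 1 (-1 / 2) (-1 / 2) (by norm_num) (by norm_num) (by norm_num) (by norm_num)
        (by push_cast; ring)
    · exact hr _ 0 (-1 / 2) (-1 / 2) (by norm_num) (by norm_num) (by norm_num) (by norm_num)
        (by push_cast; ring)
  · simp only [neg_neg, neg_div]

end
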